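/- arXiv:2605.24443 — 2 statements merged into one kernel-verified Lean document; each statement's English description precedes it below -/
import Mathlib

section
/- Global polynomial-to-log-concave estimate. Let n ≥ 1 be an integer and d a real with n ≤ d < ∞. Let V : ℝⁿ → ℝ be C² with V > −d pointwise and Z_{V,d} finite, and let W : ℝⁿ → ℝ be C² with ∫_{ℝⁿ} e^{−W(y)} dy finite; let μ_{W,∞} be the probability measure with density proportional to e^{−W}. Assume D²V ≤ C_V⁽²⁾·Id and D²W ≥ c_W⁽²⁾·Id with 0 < c_W⁽²⁾, C_V⁽²⁾ < ∞, and assume c⁽⁰⁾_{V,d} = inf_{x ∈ ℝⁿ} (d + V(x))/(d + |x|²) > 0. Let φ : ℝⁿ → ℝ be convex and C² with (∇φ)_# μ_{V,d} = μ_{W,∞}. Then for every x ∈ ℝⁿ and every unit vector e, ⟨D²φ(x)e, e⟩ ≤ √( C_V⁽²⁾/( c_W⁽²⁾ · c⁽⁰⁾_{V,d} ) ); equivalently, ∇φ is Lipschitz with this constant. -/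
open MeasureTheory Metric Set
open scoped ENNReal RealInnerProductSpace

noncomputable section

/-- Euclidean space `ℝⁿ`. -/
abbrev Euc (n : ℕ) := EuclideanSpace ℝ (Fin n)

/-- The second directional derivative `⟨D²f(x)v, v⟩`. -/
def hess {n : ℕ} (f : Euc n → ℝ) (x v : Euc n) : ℝ :=
  iteratedFDeriv ℝ 2 f x ![v, v]

/-- The normalization constant `Z_{U,p} = ∫ (1 + U(x)/p)^(−p) dx`. -/
def Znorm {n : ℕ} (U : Euc n → ℝ) (p : ℝ) : ℝ :=
  ∫ x, (1 + U x / p) ^ (-p)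

/-- The measure `μ_{U,p}` with density `Z_{U,p}⁻¹ (1 + U(x)/p)^(−p)` w.r.t. Lebesgue. -/
def muUP {n : ℕ} (U : Euc n → ℝ) (p : ℝ) : Measure (Euc n) :=
  volume.withDensity fun x => ENNReal.ofReal ((Znorm U p)⁻¹ * (1 + U x / p) ^ (-p))

/-- The ratio `(p + U(x))/(p + |x|²)`. -/
def ratio0 {n : ℕ} (U : Euc n → ℝ) (p : ℝ) (x : Euc n) : ℝ :=
  (p + U x) / (p + ‖x‖ ^ 2)

/-- The ratio `|∇U(x)|²/(√p + |x|)²`. -/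
def ratio1 {n : ℕ} (U : Euc n → ℝ) (p : ℝ) (x : Euc n) : ℝ :=
  ‖gradient U x‖ ^ 2 / (Real.sqrt p + ‖x‖) ^ 2

/-- `c⁽⁰⁾_{U,p}(S) = inf_{x ∈ S} (p + U(x))/(p + |x|²)`. -/
def cLow {n : ℕ} (U : Euc n → ℝ) (p : ℝ) (S : Set (Euc n)) : ℝ := sInf (ratio0 U p '' S)

/-- `C⁽⁰⁾_{U,p}(S) = sup_{x ∈ S} (p + U(x))/(p + |x|²)`. -/
def cUp {n : ℕ} (U : Euc n → ℝ) (p : ℝ) (S : Set (Euc n)) : ℝ := sSup (ratio0 U p '' S)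

/-- `C⁽¹⁾_{U,p}(S) = sup_{x ∈ S} |∇U(x)|²/(√p + |x|)²`. -/
def cGrad {n : ℕ} (U : Euc n → ℝ) (p : ℝ) (S : Set (Euc n)) : ℝ := sSup (ratio1 U p '' S)

/-- The Lebesgue volume of the unit ball in `ℝⁿ`. -/
def unitBallVol (n : ℕ) : ℝ := (volume (ball (0 : Euc n) 1)).toReal

/-- The log-concave probability measure with density proportional to `e^{−W}`. -/
def muExp {n : ℕ} (W : Euc n → ℝ) : Measure (Euc n) :=
  volume.withDensity fun y =>
    ENNReal.ofReal ((∫ z, Real.exp (-W z))⁻¹ * Real.exp (-W y))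

open scoped MatrixOrder in
/-- Positive definite matrices: determinant comparison. -/
lemma aux_logdet {n : ℕ} (A P Q : Matrix (Fin n) (Fin n) ℝ) (hA : A.PosDef) (hP : P.PosDef)
    (hQ : Q.PosDef) (ε : ℝ) (h : ((2 * (1 + ε)) • A - P - Q).PosSemidef) :
    Real.log P.det + Real.log Q.det ≤ 2 * Real.log A.det + 2 * n * ε := by
  have key : ∀ B : Matrix (Fin n) (Fin n) ℝ, B.PosDef → Real.log B.det ≤ B.trace - n := by
    intro B hB
    rw [hB.1.det_eq_prod_eigenvalues, hB.1.trace_eq_sum_eigenvalues]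
    simp only [RCLike.ofReal_real_eq_id, id]
    rw [Real.log_prod (fun i _ => (hB.eigenvalues_pos i).ne')]
    have : (n : ℝ) = ∑ i : Fin n, (1 : ℝ) := by simp
    rw [this, ← Finset.sum_sub_distrib]
    exact Finset.sum_le_sum fun i _ => Real.log_le_sub_one_of_pos (hB.eigenvalues_pos i)
  obtain ⟨S, hS, hAS⟩ := CStarAlgebra.isStrictlyPositive_iff_eq_star_mul_self.mp
        hA.isStrictlyPositive
  rw [Matrix.star_eq_conjTranspose] at hAS
  have hSd : IsUnit S.det := (Matrix.isUnit_iff_isUnit_det S).1 hS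
  have hinj : Function.Injective (S⁻¹).mulVec := by
    apply Matrix.mulVec_injective_of_isUnit
    exact (Matrix.isUnit_nonsing_inv_iff).2 hS
  have hdetA : A.det = S.det ^ 2 := by
    rw [hAS, Matrix.det_mul, Matrix.det_conjTranspose]; simp [sq]
  have hSne : S.det ≠ 0 := hSd.ne_zero
  have hdet : ∀ B : Matrix (Fin n) (Fin n) ℝ, B.PosDef →
      Real.log ((S⁻¹).conjTranspose * B * S⁻¹).det = Real.log B.det - Real.log A.det := by
    intro B hB
    rw [← Real.log_div hB.det_pos.ne' hA.det_pos.ne', hdetA]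
    congr 1
    rw [Matrix.det_mul, Matrix.det_mul, Matrix.det_conjTranspose, Matrix.det_nonsing_inv,
      Ring.inverse_eq_inv']
    simp
    field_simp
  have h1 := key _ (hP.conjTranspose_mul_mul_same hinj)
  have h2 := key _ (hQ.conjTranspose_mul_mul_same hinj)
  rw [hdet P hP] at h1
  rw [hdet Q hQ] at h2
  have h3 := (h.conjTranspose_mul_mul_same S⁻¹).trace_nonneg
  have hone : (S⁻¹).conjTranspose * A * S⁻¹ = 1 := by
    rw [hAS, Matrix.conjTranspose_nonsing_inv, ← Matrix.mul_assoc,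
      Matrix.nonsing_inv_mul _ (by rw [Matrix.det_conjTranspose]; simpa using hSd),
      Matrix.one_mul, Matrix.mul_nonsing_inv _ hSd]
  rw [Matrix.mul_sub, Matrix.mul_sub, Matrix.sub_mul, Matrix.sub_mul, Matrix.mul_smul,
    Matrix.smul_mul, hone, Matrix.trace_sub, Matrix.trace_sub, Matrix.trace_smul,
    Matrix.trace_one] at h3
  simp only [Fintype.card_fin, smul_eq_mul] at h3
  linarith

/-- Second order necessary condition. -/
lemma aux_second {g g' : ℝ → ℝ} {a : ℝ} (h1 : ∀ t, HasDerivAt g (g' t) t)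
    (h2 : HasDerivAt g' a 0) (hmax : ∀ t, g t ≤ g 0) : a ≤ 0 := by
  by_contra hcon
  push Not at hcon
  have hd : deriv g = g' := funext fun t => (h1 t).deriv
  have hlm : IsLocalMax g 0 := Filter.Eventually.of_forall hmax
  have hmin : IsLocalMin g 0 := by
    apply isLocalMin_of_deriv_deriv_pos
    · rw [hd, h2.deriv]; exact hcon
    · exact hlm.deriv_eq_zero
    · exact (h1 0).continuousAt
  have heq : g =ᶠ[nhds 0] fun _ => g 0 := by
    filter_upwards [hmin] with t ht using le_antisymm (hmax t) ht
  have h3 := heq.deriv.deriv_eq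
  rw [hd, h2.deriv] at h3
  simp at h3
  linarith

lemma aux_line1 {n : ℕ} {f : Euc n → ℝ} (hf : ContDiff ℝ 2 f) (x v : Euc n) (t : ℝ) :
    HasDerivAt (fun t : ℝ => f (x + t • v)) (fderiv ℝ f (x + t • v) v) t := by
  have h1 : HasDerivAt (fun t : ℝ => x + t • v) v t := by
    simpa using ((hasDerivAt_id t).smul_const v).const_add x
  have h2 := ((hf.differentiable (by norm_num)) (x + t • v)).hasFDerivAt
  exact h2.comp_hasDerivAt t h1

lemma aux_hess {n : ℕ} (f : Euc n → ℝ) (x v : Euc n) :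
    hess f x v = fderiv ℝ (fderiv ℝ f) x v v := by
  simp [hess, iteratedFDeriv_two_apply]

lemma aux_line2 {n : ℕ} {f : Euc n → ℝ} (hf : ContDiff ℝ 2 f) (x v : Euc n) (t : ℝ) :
    HasDerivAt (fun t : ℝ => fderiv ℝ f (x + t • v) v) (hess f (x + t • v) v) t := by
  have h1 : HasDerivAt (fun t : ℝ => x + t • v) v t := by
    simpa using ((hasDerivAt_id t).smul_const v).const_add x
  have hc : ContDiff ℝ 1 (fderiv ℝ f) := hf.fderiv_right (by norm_num)
  have h2 := ((hc.differentiable (by norm_num)) (x + t • v)).hasFDerivAt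
  have h3 := h2.comp_hasDerivAt t h1
  rw [aux_hess]
  have h4 := h3.clm_apply (hasDerivAt_const t v)
  simpa using h4

/-- Lower Taylor bound. -/
lemma aux_taylor {n : ℕ} {f : Euc n → ℝ} (hf : ContDiff ℝ 2 f) {c : ℝ}
    (hc : ∀ x v, c * ‖v‖ ^ 2 ≤ hess f x v) (x v : Euc n) :
    f x + fderiv ℝ f x v + c / 2 * ‖v‖ ^ 2 ≤ f (x + v) := by
  set k := c * ‖v‖ ^ 2 with hk
  have hmono : MonotoneOn (fun t : ℝ => fderiv ℝ f (x + t • v) v - k * t) univ := by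
    have hd : ∀ t : ℝ, HasDerivAt (fun t : ℝ => fderiv ℝ f (x + t • v) v - k * t)
        (hess f (x + t • v) v - k * 1) t := fun t =>
      (aux_line2 hf x v t).sub ((hasDerivAt_id t).const_mul k)
    apply monotoneOn_of_deriv_nonneg convex_univ
    · exact fun t _ => (hd t).continuousAt.continuousWithinAt
    · exact fun t _ => (hd t).differentiableAt.differentiableWithinAt
    · intro t _
      rw [(hd t).deriv]
      have := hc (x + t • v) v
      linarith
  have hmono2 : MonotoneOn (fun t : ℝ => f (x + t • v) - k / 2 * t ^ 2 - t * fderiv ℝ f x v)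
      (Icc 0 1) := by
    have hd : ∀ t : ℝ, HasDerivAt (fun t : ℝ => f (x + t • v) - k / 2 * t ^ 2 - t * fderiv ℝ f x v)
        (fderiv ℝ f (x + t • v) v - k / 2 * (2 * t) - 1 * fderiv ℝ f x v) t := fun t => by
      have h2 : HasDerivAt (fun t : ℝ => t ^ 2) (2 * t) t := by simpa using hasDerivAt_pow 2 t
      exact ((aux_line1 hf x v t).sub (h2.const_mul _)).sub
        ((hasDerivAt_id t).mul_const _)
    apply monotoneOn_of_deriv_nonneg (convex_Icc 0 1)
    · exact fun t _ => (hd t).continuousAt.continuousWithinAt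
    · exact fun t _ => (hd t).differentiableAt.differentiableWithinAt
    · intro t ht
      rw [interior_Icc] at ht
      rw [(hd t).deriv]
      have := hmono (mem_univ 0) (mem_univ t) ht.1.le
      simp at this
      linarith
  have := hmono2 (left_mem_Icc.2 zero_le_one) (right_mem_Icc.2 zero_le_one) zero_le_one
  simp at this
  linarith

lemma aux_hess_neg {n : ℕ} {f : Euc n → ℝ} (x v : Euc n) :
    hess (fun x => - f x) x v = - hess f x v := by
  rw [aux_hess, aux_hess]
  have : fderiv ℝ (fun x => - f x) = fun x => - fderiv ℝ f x := by
    funext y; exact fderiv_fun_neg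
  rw [this, fderiv_fun_neg]
  simp

lemma aux_second_diff_lower {n : ℕ} {f : Euc n → ℝ} (hf : ContDiff ℝ 2 f) {c : ℝ}
    (hc : ∀ x v, c * ‖v‖ ^ 2 ≤ hess f x v) (x v : Euc n) :
    c * ‖v‖ ^ 2 ≤ f (x + v) + f (x - v) - 2 * f x := by
  have h1 := aux_taylor hf hc x v
  have h2 := aux_taylor hf hc x (-v)
  rw [norm_neg, map_neg, ← sub_eq_add_neg x v] at h2
  linarith

lemma aux_second_diff_upper {n : ℕ} {f : Euc n → ℝ} (hf : ContDiff ℝ 2 f) {c : ℝ}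
    (hc : ∀ x v, hess f x v ≤ c * ‖v‖ ^ 2) (x v : Euc n) :
    f (x + v) + f (x - v) - 2 * f x ≤ c * ‖v‖ ^ 2 := by
  have h1 := aux_second_diff_lower (f := fun x => - f x) hf.neg (c := -c)
    (fun x v => by rw [aux_hess_neg]; linarith [hc x v]) x v
  linarith

/-- An upper bound on second differences bounds the Hessian. -/
lemma aux_hess_le {n : ℕ} {f : Euc n → ℝ} (hf : ContDiff ℝ 2 f) {c : ℝ} (x v : Euc n)
    (h : ∀ t : ℝ, f (x + t • v) + f (x - t • v) - 2 * f x ≤ c * t ^ 2) : hess f x v ≤ c := by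
  have e1 : ∀ t : ℝ, HasDerivAt (fun t : ℝ => f (x + t • v) + f (x + t • (-v)) - c * t ^ 2)
      (fderiv ℝ f (x + t • v) v + fderiv ℝ f (x + t • (-v)) (-v) - c * (2 * t)) t := fun t => by
    have h2 : HasDerivAt (fun t : ℝ => t ^ 2) (2 * t) t := by simpa using hasDerivAt_pow 2 t
    exact ((aux_line1 hf x v t).add (aux_line1 hf x (-v) t)).sub (h2.const_mul c)
  have e2 : HasDerivAt (fun t : ℝ => fderiv ℝ f (x + t • v) v + fderiv ℝ f (x + t • (-v)) (-v)
      - c * (2 * t)) (hess f (x + (0:ℝ) • v) v + hess f (x + (0:ℝ) • (-v)) (-v) - c * (2 * 1)) 0 :=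
    ((aux_line2 hf x v 0).add (aux_line2 hf x (-v) 0)).sub
      (((hasDerivAt_id (0:ℝ)).const_mul 2).const_mul c)
  have := aux_second e1 e2 (fun t => by
    have := h t
    simp [← sub_eq_add_neg]
    linarith)
  simp [aux_hess] at this
  rw [aux_hess]
  linarith

lemma aux_hess_nonneg {n : ℕ} {f : Euc n → ℝ} (hf : ContDiff ℝ 2 f) (hc : ConvexOn ℝ univ f)
    (x v : Euc n) : 0 ≤ hess f x v := by
  have := aux_hess_le (f := fun x => - f x) hf.neg (c := 0) x v (fun t => by
    have h := hc.2 (mem_univ (x + t • v)) (mem_univ (x - t • v))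
      (show (0:ℝ) ≤ 1/2 by norm_num) (show (0:ℝ) ≤ 1/2 by norm_num) (by norm_num)
    have e : (1/2:ℝ) • (x + t • v) + (1/2:ℝ) • (x - t • v) = x := by
      rw [← smul_add]; simp [← two_smul ℝ]
    rw [e] at h
    simp only [smul_eq_mul] at h
    linarith)
  rw [aux_hess_neg] at this
  linarith

lemma aux_grad_inner {n : ℕ} (φ : Euc n → ℝ) (x v : Euc n) :
    ⟪gradient φ x, v⟫ = fderiv ℝ φ x v := by
  simp [gradient]

lemma aux_grad_contDiff {n : ℕ} {φ : Euc n → ℝ} (hφ : ContDiff ℝ 2 φ) :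
    ContDiff ℝ 1 (gradient φ) := by
  have hc : ContDiff ℝ 1 (fderiv ℝ φ) := hφ.fderiv_right (by norm_num)
  exact (InnerProductSpace.toDual ℝ (Euc n)).symm.contDiff.comp hc

lemma aux_grad_fderiv {n : ℕ} {φ : Euc n → ℝ} (hφ : ContDiff ℝ 2 φ) (x v w : Euc n) :
    ⟪fderiv ℝ (gradient φ) x v, w⟫ = fderiv ℝ (fderiv ℝ φ) x v w := by
  have hc : ContDiff ℝ 1 (fderiv ℝ φ) := hφ.fderiv_right (by norm_num)
  have h1 := ((hc.differentiable (by norm_num)) x).hasFDerivAt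
  have hT := (((aux_grad_contDiff hφ).differentiable (by norm_num)) x).hasFDerivAt
  have h2 := h1.clm_apply (hasFDerivAt_const w x)
  have h3 := hT.inner ℝ (hasFDerivAt_const w x)
  have e : (fun y => ⟪gradient φ y, w⟫) = fun y => fderiv ℝ φ y w :=
    funext fun y => aux_grad_inner φ y w
  rw [e] at h3
  have h4 := congrArg (fun L => L v) (h3.unique h2)
  simpa using h4

lemma aux_hess_grad {n : ℕ} {φ : Euc n → ℝ} (hφ : ContDiff ℝ 2 φ) (x v : Euc n) :
    hess φ x v = ⟪fderiv ℝ (gradient φ) x v, v⟫ := by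
  rw [aux_grad_fderiv hφ, aux_hess]

lemma aux_grad_symm {n : ℕ} {φ : Euc n → ℝ} (hφ : ContDiff ℝ 2 φ) (x v w : Euc n) :
    ⟪fderiv ℝ (gradient φ) x v, w⟫ = ⟪v, fderiv ℝ (gradient φ) x w⟫ := by
  rw [← real_inner_comm v, aux_grad_fderiv hφ, aux_grad_fderiv hφ]
  exact (hφ.contDiffAt.isSymmSndFDerivAt (by simp)) v w

/-- The Hessian matrix. -/
def hessMat {n : ℕ} (φ : Euc n → ℝ) (x : Euc n) : Matrix (Fin n) (Fin n) ℝ :=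
  LinearMap.toMatrix (EuclideanSpace.basisFun (Fin n) ℝ).toBasis
    (EuclideanSpace.basisFun (Fin n) ℝ).toBasis (fderiv ℝ (gradient φ) x).toLinearMap

lemma hessMat_det {n : ℕ} (φ : Euc n → ℝ) (x : Euc n) :
    (hessMat φ x).det = (fderiv ℝ (gradient φ) x).det := by
  rw [hessMat, LinearMap.det_toMatrix]

lemma hessMat_psd {n : ℕ} {φ : Euc n → ℝ} (hφ : ContDiff ℝ 2 φ) (hc : ConvexOn ℝ univ φ)
    (x : Euc n) : (hessMat φ x).PosSemidef := by
  rw [hessMat, LinearMap.posSemidef_toMatrix_iff]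
  refine ⟨fun v w => aux_grad_symm hφ x v w, fun v => ?_⟩
  have := aux_hess_nonneg hφ hc x v
  rw [aux_hess_grad hφ] at this
  exact this

lemma hessMat_diff_psd {n : ℕ} {φ : Euc n → ℝ} (hφ : ContDiff ℝ 2 φ) (k : ℝ) (x y z : Euc n)
    (h : ∀ v, hess φ y v + hess φ z v ≤ k * hess φ x v) :
    (k • hessMat φ x - hessMat φ y - hessMat φ z).PosSemidef := by
  simp only [hessMat]
  rw [← map_smul, ← map_sub, ← map_sub, LinearMap.posSemidef_toMatrix_iff]
  refine ⟨fun v w => ?_, fun v => ?_⟩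
  · simp [inner_sub_left, inner_sub_right, inner_smul_left, inner_smul_right,
      aux_grad_symm hφ _ v w]
  · have := h v
    simp only [aux_hess_grad hφ] at this
    simp [inner_sub_left, inner_smul_left]
    linarith

lemma aux_tangent {n : ℕ} {φ : Euc n → ℝ} (hφ : ContDiff ℝ 2 φ) (hc : ConvexOn ℝ univ φ)
    (x v : Euc n) : φ x + ⟪gradient φ x, v⟫ ≤ φ (x + v) := by
  have := aux_taylor hφ (c := 0) (fun x v => by simpa using aux_hess_nonneg hφ hc x v) x v
  rw [aux_grad_inner]; linarith

lemma aux_mono {n : ℕ} {φ : Euc n → ℝ} (hφ : ContDiff ℝ 2 φ) (hc : ConvexOn ℝ univ φ)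
    (x y : Euc n) : 0 ≤ ⟪gradient φ y - gradient φ x, y - x⟫ := by
  have h1 := aux_tangent hφ hc x (y - x)
  have h2 := aux_tangent hφ hc y (x - y)
  simp only [add_sub_cancel, inner_sub_left, inner_sub_right] at *
  linarith

/-- Injectivity at nondegenerate points. -/
lemma aux_inj {n : ℕ} {φ : Euc n → ℝ} (hφ : ContDiff ℝ 2 φ) (hc : ConvexOn ℝ univ φ)
    (a b : Euc n) (hdet : (fderiv ℝ (gradient φ) a).det ≠ 0)
    (hab : gradient φ a = gradient φ b) : a = b := by
  have hzero : ∀ t ∈ Ioo (0:ℝ) 1, ⟪gradient φ (a + t • (b - a)), b - a⟫ = ⟪gradient φ a, b - a⟫ := by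
    intro t ht
    have h1 := aux_mono hφ hc a (a + t • (b - a))
    have h2 := aux_mono hφ hc (a + t • (b - a)) b
    rw [add_sub_cancel_left, inner_smul_right, inner_sub_left] at h1
    have e : b - (a + t • (b - a)) = (1 - t) • (b - a) := by module
    rw [e, inner_smul_right, inner_sub_left, ← hab] at h2
    have h3 := nonneg_of_mul_nonneg_right h1 ht.1
    have h4 := nonneg_of_mul_nonneg_right h2 (by linarith [ht.2])
    linarith
  have hd : hess φ a (b - a) = 0 := by
    have h := aux_line2 hφ a (b - a) 0
    simp only [zero_smul, add_zero] at h
    have h' := h.hasDerivWithinAt (s := Ioo (0:ℝ) 1)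
    have hu : UniqueDiffWithinAt ℝ (Ioo (0:ℝ) 1) 0 :=
      uniqueDiffWithinAt_convex (convex_Ioo 0 1) (by simp) (by
        rw [closure_Ioo (by norm_num)]; simp)
    have hconst : HasDerivWithinAt (fun t : ℝ => fderiv ℝ φ (a + t • (b - a)) (b - a)) 0
        (Ioo (0:ℝ) 1) 0 := by
      refine (hasDerivWithinAt_const (0:ℝ) (Ioo (0:ℝ) 1) (⟪gradient φ a, b - a⟫)).congr ?_ ?_
      · intro t ht; rw [← aux_grad_inner, hzero t ht]
      · simp [aux_grad_inner]
    exact hu.eq_deriv _ h' hconst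
  by_contra hne
  have hpd : (hessMat φ a).PosDef :=
    (hessMat_psd hφ hc a).posDef_iff_det_ne_zero.2 (by rwa [hessMat_det])
  have hvne : ((b - a).ofLp) ≠ 0 := by
    intro h
    apply hne
    have : b - a = 0 := by ext i; exact congrFun h i
    exact (sub_eq_zero.1 this).symm
  have hpos := hpd.dotProduct_mulVec_pos hvne
  have : hess φ a (b - a) = star (b - a).ofLp ⬝ᵥ (hessMat φ a).mulVec (b - a).ofLp := by
    rw [aux_hess_grad hφ, EuclideanSpace.inner_eq_star_dotProduct]
    have := LinearMap.toMatrix_mulVec_repr (EuclideanSpace.basisFun (Fin n) ℝ).toBasis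
      (EuclideanSpace.basisFun (Fin n) ℝ).toBasis (fderiv ℝ (gradient φ) a).toLinearMap (b - a)
    have h2 : (hessMat φ a).mulVec (b - a).ofLp = (fderiv ℝ (gradient φ) a (b - a)).ofLp := by
      have e : ∀ u : Euc n, ⇑((EuclideanSpace.basisFun (Fin n) ℝ).toBasis.repr u) = u.ofLp := by
        intro u; ext i; simp
      rw [e, e] at this
      exact this
    rw [h2, dotProduct_comm]
    simp [dotProduct_comm]
  rw [← this, hd] at hpos
  exact lt_irrefl _ hpos

/-- Monge-Ampere equation. -/
lemma aux_MA {n : ℕ} {φ : Euc n → ℝ} (hφ : ContDiff ℝ 2 φ) (hc : ConvexOn ℝ univ φ)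
    (F G : Euc n → ℝ) (hF : Continuous F) (hG : Continuous G) (hFp : ∀ x, 0 < F x)
    (hGp : ∀ x, 0 < G x)
    (hpush : Measure.map (fun x => gradient φ x) (volume.withDensity fun x => ENNReal.ofReal (F x))
      = volume.withDensity fun x => ENNReal.ofReal (G x)) (x : Euc n) :
    F x = |(fderiv ℝ (gradient φ) x).det| * G (gradient φ x) := by
  set T := gradient φ with hT
  have hTc : ContDiff ℝ 1 T := aux_grad_contDiff hφ
  have hTcont : Continuous T := hTc.continuous
  have hTm : Measurable T := hTcont.measurable
  have hTd : ∀ x, HasFDerivAt T (fderiv ℝ T x) x := fun x =>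
    ((hTc.differentiable (by norm_num)) x).hasFDerivAt
  have hdetc : Continuous fun x => (fderiv ℝ T x).det :=
    ContinuousLinearMap.continuous_det.comp (hTc.continuous_fderiv (by norm_num))
  set f : Euc n → ℝ≥0∞ := fun x => ENNReal.ofReal (F x) with hf
  set g : Euc n → ℝ≥0∞ := fun x => ENNReal.ofReal (G x) with hg
  have hfm : Measurable f := ENNReal.measurable_ofReal.comp hF.measurable
  have hgm : Measurable g := ENNReal.measurable_ofReal.comp hG.measurable
  set N := {x | (fderiv ℝ T x).det = 0} with hN
  have hNcl : IsClosed N := isClosed_eq hdetc continuous_const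
  have hN0 : volume N = 0 := by
    have h1 : volume (T '' N) = 0 :=
      addHaar_image_eq_zero_of_det_fderivWithin_eq_zero volume
        (fun x _ => (hTd x).hasFDerivWithinAt) (fun x hx => hx)
    have h2 : (volume.withDensity g) (T '' N) = 0 := withDensity_absolutelyContinuous _ _ h1
    rw [← hpush] at h2
    have h3 : (volume.withDensity f) (T ⁻¹' (T '' N)) = 0 := by
      have := (Measure.tendsto_ae_map (μ := volume.withDensity f) hTm.aemeasurable)
      rw [← compl_mem_ae_iff] at h2
      have h4 := this h2
      rw [← compl_mem_ae_iff]
      exact h4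
    have h5 : (volume.withDensity f) N = 0 := measure_mono_null (subset_preimage_image T N) h3
    exact withDensity_absolutelyContinuous' hfm.aemeasurable
      (Filter.Eventually.of_forall fun x => by simp [hf, hFp x]) h5
  have hae : f =ᵐ[volume.restrict Nᶜ] fun x => ENNReal.ofReal |(fderiv ℝ T x).det| * g (T x) := by
    apply ae_eq_of_forall_setLIntegral_eq_of_sigmaFinite hfm
    · exact (ENNReal.measurable_ofReal.comp hdetc.abs.measurable).mul (hgm.comp hTm)
    intro s hs _
    rw [Measure.restrict_restrict hs]
    set A := s ∩ Nᶜ with hA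
    have hAm : MeasurableSet A := hs.inter hNcl.measurableSet.compl
    have hinj : InjOn T A := fun a ha b _ hab => aux_inj hφ hc a b ha.2 hab
    rw [← lintegral_image_eq_lintegral_abs_det_fderiv_mul volume hAm
      (fun x _ => (hTd x).hasFDerivWithinAt) hinj]
    have hTA : MeasurableSet (T '' A) := measurable_image_of_fderivWithin hAm
      (fun x _ => (hTd x).hasFDerivWithinAt) hinj
    rw [← withDensity_apply _ hTA, ← hpush, Measure.map_apply hTm hTA]
    have : T ⁻¹' (T '' A) = A := by
      apply Subset.antisymm _ (subset_preimage_image _ _)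
      rintro b ⟨a, ha, hab⟩
      rwa [← aux_inj hφ hc a b ha.2 hab]
    rw [this, withDensity_apply _ hAm]
  have hae2 : f =ᵐ[volume] fun x => ENNReal.ofReal |(fderiv ℝ T x).det| * g (T x) := by
    have : (volume : Measure (Euc n)).restrict Nᶜ = volume := by
      apply Measure.restrict_eq_self_of_ae_mem
      rw [← compl_mem_ae_iff] at hN0
      exact hN0
    rwa [this] at hae
  have hae3 : F =ᵐ[volume] fun x => |(fderiv ℝ T x).det| * G (T x) := by
    filter_upwards [hae2] with x hx
    simp only [hf, hg] at hx
    rw [← ENNReal.ofReal_mul (abs_nonneg _)] at hx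
    rwa [ENNReal.ofReal_eq_ofReal_iff (hFp x).le
      (mul_nonneg (abs_nonneg _) (hGp _).le)] at hx
  have := (Continuous.ae_eq_iff_eq volume hF (hdetc.abs.mul (hG.comp hTcont))).1 hae3
  exact congrFun this x

lemma aux_coercive {n : ℕ} {φ : Euc n → ℝ} (hφ : ContDiff ℝ 2 φ) (hc : ConvexOn ℝ univ φ)
    (F G : Euc n → ℝ) (hG : Continuous G) (hGp : ∀ x, 0 < G x)
    (hpush : Measure.map (fun x => gradient φ x) (volume.withDensity fun x => ENNReal.ofReal (F x))
      = volume.withDensity fun x => ENNReal.ofReal (G x)) :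
    ∃ C, ∀ x, ‖x‖ / 2 - C ≤ φ x := by
  have hTm : Measurable (fun x => gradient φ x) := (aux_grad_contDiff hφ).continuous.measurable
  have hdense : ∀ y : Euc n, ∃ z, y ∈ ball (gradient φ z) (1/2) := by
    intro y
    by_contra hcon
    push Not at hcon
    have h1 : (fun x => gradient φ x) ⁻¹' (ball y (1/2)) = ∅ := by
      ext z
      simp only [mem_preimage, mem_empty_iff_false, iff_false]
      rw [mem_ball_comm]
      exact hcon z
    have h2 : (volume.withDensity fun x => ENNReal.ofReal (G x)) (ball y (1/2)) = 0 := by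
      rw [← hpush, Measure.map_apply hTm measurableSet_ball, h1, measure_empty]
    have h3 : (volume : Measure (Euc n)) (ball y (1/2)) = 0 :=
      withDensity_absolutelyContinuous' (ENNReal.measurable_ofReal.comp hG.measurable).aemeasurable
      (Filter.Eventually.of_forall fun x => by simp [hGp x]) h2
    exact (measure_ball_pos volume y (by norm_num : (0:ℝ) < 1/2)).ne' h3
  obtain ⟨t, ht⟩ := (isCompact_sphere (0 : Euc n) 1).elim_finite_subcover
    (fun z : Euc n => ball (gradient φ z) (1/2)) (fun z => isOpen_ball)
    (fun y _ => mem_iUnion.2 (hdense y))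
  refine ⟨(∑ z ∈ t, |φ z - ⟪gradient φ z, z⟫|) + |φ 0|, fun x => ?_⟩
  have hsum : 0 ≤ ∑ z ∈ t, |φ z - ⟪gradient φ z, z⟫| := Finset.sum_nonneg fun _ _ => abs_nonneg _
  by_cases hx : x = 0
  · subst hx
    have := neg_abs_le (φ 0)
    rw [norm_zero]; linarith
  have hxp : 0 < ‖x‖ := norm_pos_iff.2 hx
  have hmem : (‖x‖⁻¹ • x) ∈ sphere (0 : Euc n) 1 := by
    simp [norm_smul, hxp.ne']
  obtain ⟨z, hz⟩ := mem_iUnion.1 (ht hmem)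
  obtain ⟨hzt, hz⟩ := mem_iUnion.1 hz
  rw [mem_ball, dist_eq_norm] at hz
  have h1 := aux_tangent hφ hc z (x - z)
  rw [add_sub_cancel, inner_sub_right] at h1
  have h2 : |φ z - ⟪gradient φ z, z⟫| ≤ ∑ z ∈ t, |φ z - ⟪gradient φ z, z⟫| :=
    Finset.single_le_sum (f := fun z => |φ z - ⟪gradient φ z, z⟫|)
      (fun _ _ => abs_nonneg _) hzt
  have h3 := neg_abs_le (φ z - ⟪gradient φ z, z⟫)
  have h4 : ‖x‖ / 2 ≤ ⟪gradient φ z, x⟫ := by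
    have h5 := real_inner_le_norm (‖x‖⁻¹ • x - gradient φ z) x
    rw [inner_sub_left, inner_smul_left, real_inner_self_eq_norm_sq] at h5
    have h6 : (starRingEnd ℝ) ‖x‖⁻¹ * ‖x‖ ^ 2 = ‖x‖ := by
      simp; field_simp
    rw [h6] at h5
    nlinarith
  have := abs_nonneg (φ 0)
  linarith

lemma aux_growth {n : ℕ} {φ : Euc n → ℝ} (hφ : ContDiff ℝ 2 φ) (hc : ConvexOn ℝ univ φ)
    (F G : Euc n → ℝ)
    (hpush : Measure.map (fun x => gradient φ x) (volume.withDensity fun x => ENNReal.ofReal (F x))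
      = volume.withDensity fun x => ENNReal.ofReal (G x))
    (p cF CG κ : ℝ) (hp : 0 ≤ p) (hcF : 0 < cF) (hκ : 0 < κ) (hCG : 0 < CG)
    (hFl : ∀ x, cF * (1 + ‖x‖) ^ (-p) ≤ F x)
    (hGu : ∀ y, G y ≤ CG * Real.exp (-κ * ‖y‖ ^ 2)) (η : ℝ) (hη : 0 < η) :
    ∃ C, 0 ≤ C ∧ ∀ x, ‖gradient φ x‖ ^ 2 ≤ η * ‖x‖ + C := by
  have hTm : Measurable (fun x => gradient φ x) := (aux_grad_contDiff hφ).continuous.measurable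
  have hint : Integrable (fun y : Euc n => Real.exp (-(κ/2) * ‖y‖ ^ 2)) := by
    have h := (GaussianFourier.integrable_cexp_neg_mul_sq_norm_add (V := Euc n)
      (b := ((κ/2 : ℝ) : ℂ)) (by simpa using hκ) 0 0).re
    refine h.congr (Filter.Eventually.of_forall fun y => ?_)
    simp only [zero_mul, add_zero]
    have : -((κ/2 : ℝ) : ℂ) * (‖y‖ : ℂ) ^ 2 = ((-(κ/2) * ‖y‖ ^ 2 : ℝ) : ℂ) := by push_cast; ring
    rw [this, ← Complex.ofReal_exp]
    exact Complex.ofReal_re _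
  set J := ∫ y : Euc n, Real.exp (-(κ/2) * ‖y‖ ^ 2) with hJ
  have hJ0 : 0 ≤ J := integral_nonneg fun y => (Real.exp_pos _).le
  set w := (volume (ball (0 : Euc n) 1)).toReal with hw
  have hwfin : volume (ball (0 : Euc n) 1) ≠ ⊤ := measure_ball_lt_top.ne
  have hw0 : 0 < w := ENNReal.toReal_pos (measure_ball_pos volume _ one_pos).ne' hwfin
  have key : ∀ x0 : Euc n, gradient φ x0 ≠ 0 →
      cF * (5 * (1 + ‖x0‖)) ^ (-p) * w ≤ CG * J * Real.exp (-(κ/18) * ‖gradient φ x0‖ ^ 2) := by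
    intro x0 hy0
    set R := 1 + ‖x0‖ with hR
    have hR1 : 1 ≤ R := by have := norm_nonneg x0; linarith
    set y0 := gradient φ x0 with hy0d
    set s := ‖y0‖ with hs
    have hs0 : 0 < s := norm_pos_iff.2 hy0
    set e := s⁻¹ • y0 with he
    have hen : ‖e‖ = 1 := by
      rw [he, norm_smul, ← hs, norm_inv, Real.norm_of_nonneg hs0.le, inv_mul_cancel₀ hs0.ne']
    have hey : ⟪y0, e⟫ = s := by
      rw [he, inner_smul_right, real_inner_self_eq_norm_sq, ← hs]; field_simp
    set B := ball (x0 + (2 * R) • e) R with hB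
    have hBprop : ∀ x ∈ B, ‖x‖ ≤ 4 * R ∧ s / 3 ≤ ‖gradient φ x‖ := by
      intro x hx
      rw [hB, mem_ball, dist_eq_norm] at hx
      set v := x - (x0 + (2 * R) • e) with hv
      have hxe : x - x0 = (2 * R) • e + v := by rw [hv]; abel
      have hn3 : ‖x - x0‖ ≤ 3 * R := by
        rw [hxe]
        refine (norm_add_le _ _).trans ?_
        rw [norm_smul, hen, Real.norm_of_nonneg (by linarith)]
        linarith
      constructor
      · have : ‖x‖ ≤ ‖x0‖ + ‖x - x0‖ := by
          have := norm_add_le x0 (x - x0)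
          rwa [add_sub_cancel] at this
        linarith
      · have h1 := aux_mono hφ hc x0 x
        rw [inner_sub_left] at h1
        have h2 : s * R ≤ ⟪y0, x - x0⟫ := by
          rw [hxe, inner_add_right, inner_smul_right, hey]
          have h3 := abs_le.1 (abs_real_inner_le_norm y0 v)
          have : ‖y0‖ * ‖v‖ ≤ s * R := mul_le_mul_of_nonneg_left hx.le hs0.le
          linarith [h3.1]
        have h4 := real_inner_le_norm (gradient φ x) (x - x0)
        have h5 : ‖gradient φ x‖ * ‖x - x0‖ ≤ ‖gradient φ x‖ * (3 * R) :=
          mul_le_mul_of_nonneg_left hn3 (norm_nonneg _)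
        have h6 : s * R ≤ (3 * ‖gradient φ x‖) * R := by linarith
        have := le_of_mul_le_mul_right h6 (by linarith)
        linarith
    have hlow : ENNReal.ofReal (cF * (5 * R) ^ (-p) * w) ≤
        (volume.withDensity fun x => ENNReal.ofReal (F x)) B := by
      rw [withDensity_apply _ measurableSet_ball]
      have h1 : ∫⁻ x in B, ENNReal.ofReal (cF * (5 * R) ^ (-p)) ≤
          ∫⁻ x in B, ENNReal.ofReal (F x) := by
        refine setLIntegral_mono' measurableSet_ball fun x hx => ?_
        apply ENNReal.ofReal_le_ofReal
        refine le_trans ?_ (hFl x)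
        apply mul_le_mul_of_nonneg_left _ hcF.le
        apply Real.rpow_le_rpow_of_nonpos
        · have := norm_nonneg x; linarith
        · have := (hBprop x hx).1; linarith
        · linarith
      refine le_trans ?_ h1
      rw [setLIntegral_const, ENNReal.ofReal_mul (by positivity)]
      apply mul_le_mul_right
      rw [hw, ENNReal.ofReal_toReal hwfin, hB]
      rw [Measure.addHaar_ball_center volume (x0 + (2 * R) • e)]
      exact measure_mono (ball_subset_ball hR1)
    have hup : (volume.withDensity fun x => ENNReal.ofReal (F x)) B ≤
        ENNReal.ofReal (CG * J * Real.exp (-(κ/18) * s ^ 2)) := by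
      have hSm : MeasurableSet {y : Euc n | s / 3 ≤ ‖y‖} :=
        measurableSet_le measurable_const measurable_norm
      calc (volume.withDensity fun x => ENNReal.ofReal (F x)) B
          ≤ (volume.withDensity fun x => ENNReal.ofReal (F x))
            ((fun x => gradient φ x) ⁻¹' {y | s / 3 ≤ ‖y‖}) :=
              measure_mono fun x hx => (hBprop x hx).2
        _ = ∫⁻ y in {y : Euc n | s / 3 ≤ ‖y‖}, ENNReal.ofReal (G y) := by
            rw [← Measure.map_apply hTm hSm, hpush, withDensity_apply _ hSm]
        _ ≤ ∫⁻ y in {y : Euc n | s / 3 ≤ ‖y‖}, ENNReal.ofReal (CG * Real.exp (-(κ/18) * s ^ 2))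
              * ENNReal.ofReal (Real.exp (-(κ/2) * ‖y‖ ^ 2)) := by
            refine setLIntegral_mono' hSm fun y hy => ?_
            rw [← ENNReal.ofReal_mul (by positivity)]
            apply ENNReal.ofReal_le_ofReal
            refine (hGu y).trans ?_
            rw [mul_assoc, ← Real.exp_add]
            apply mul_le_mul_of_nonneg_left _ hCG.le
            apply Real.exp_le_exp.2
            have hy' : s / 3 ≤ ‖y‖ := hy
            have : (s/3)^2 ≤ ‖y‖^2 := by gcongr
            nlinarith
        _ ≤ ∫⁻ y : Euc n, ENNReal.ofReal (CG * Real.exp (-(κ/18) * s ^ 2))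
              * ENNReal.ofReal (Real.exp (-(κ/2) * ‖y‖ ^ 2)) := setLIntegral_le_lintegral _ _
        _ = ENNReal.ofReal (CG * J * Real.exp (-(κ/18) * s ^ 2)) := by
            rw [lintegral_const_mul _ (by fun_prop),
              ← ofReal_integral_eq_lintegral_ofReal hint
                (Filter.Eventually.of_forall fun y => (Real.exp_pos _).le),
              ← ENNReal.ofReal_mul (by positivity)]
            congr 1; ring
    exact (ENNReal.ofReal_le_ofReal_iff (by positivity)).1 (hlow.trans hup)
  set θ := η * κ / (90 * (p + 1)) with hθ
  have hθ0 : 0 < θ := by positivity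
  set M := CG * J / (cF * w) with hM
  refine ⟨|18 / κ * (Real.log M + p * (5 * θ - 1 - Real.log θ))|, abs_nonneg _, fun x => ?_⟩
  by_cases hx : gradient φ x = 0
  · rw [hx]; simp; positivity
  have h := key x hx
  set R := 1 + ‖x‖ with hR
  have hR0 : 0 < R := by have := norm_nonneg x; linarith
  set s := ‖gradient φ x‖ with hs
  have hexp : Real.exp (κ/18 * s^2) ≤ M * (5 * R) ^ p := by
    rw [Real.rpow_neg (by positivity)] at h
    have h1 : Real.exp (-(κ/18) * s^2) = (Real.exp (κ/18 * s^2))⁻¹ := by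
      rw [← Real.exp_neg]; congr 1; ring
    rw [h1] at h
    have hE := Real.exp_pos (κ/18 * s^2)
    have hP : 0 < (5 * R) ^ p := by positivity
    rw [hM, div_mul_eq_mul_div (CG * J) (cF * w) ((5 * R) ^ p), le_div_iff₀ (by positivity)]
    have h2 := mul_le_mul_of_nonneg_right h (mul_pos hE hP).le
    have e1 : cF * ((5 * R) ^ p)⁻¹ * w * (Real.exp (κ/18 * s^2) * (5 * R) ^ p) =
      Real.exp (κ/18 * s^2) * (cF * w) := by field_simp
    have e2 : CG * J * (Real.exp (κ/18 * s^2))⁻¹ * (Real.exp (κ/18 * s^2) * (5 * R) ^ p) =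
      CG * J * (5 * R) ^ p := by field_simp
    rwa [e1, e2] at h2
  have hMp : 0 < M := by
    by_contra hcon
    have : M * (5 * R) ^ p ≤ 0 := mul_nonpos_of_nonpos_of_nonneg (not_lt.1 hcon) (by positivity)
    linarith [Real.exp_pos (κ/18 * s^2)]
  have hlog := Real.log_le_log (Real.exp_pos _) hexp
  rw [Real.log_exp, Real.log_mul hMp.ne' (by positivity), Real.log_rpow (by positivity)] at hlog
  have hl2 := Real.log_le_sub_one_of_pos (show 0 < θ * (5 * R) by positivity)
  rw [Real.log_mul hθ0.ne' (by positivity)] at hl2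
  have h3 : κ/18 * s^2 ≤ Real.log M + p * (5 * θ - 1 - Real.log θ) + p * (5 * θ * ‖x‖) := by
    have := mul_le_mul_of_nonneg_left hl2 hp
    rw [hR] at this hlog
    nlinarith
  have h4 : s^2 ≤ 18 / κ * (Real.log M + p * (5 * θ - 1 - Real.log θ)) + η * ‖x‖ := by
    have h5 := mul_le_mul_of_nonneg_left h3 (show 0 ≤ 18 / κ by positivity)
    have e1 : 18 / κ * (κ/18 * s^2) = s^2 := by field_simp
    rw [e1, mul_add] at h5
    have e2 : 18 / κ * (p * (5 * θ * ‖x‖)) = η * ‖x‖ * (p / (p + 1)) := by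
      rw [hθ]; field_simp; ring
    have e3 : η * ‖x‖ * (p / (p + 1)) ≤ η * ‖x‖ * 1 := by
      apply mul_le_mul_of_nonneg_left _ (by positivity)
      rw [div_le_one (by positivity)]; linarith
    linarith
  have := le_abs_self (18 / κ * (Real.log M + p * (5 * θ - 1 - Real.log θ)))
  linarith

lemma aux_core {n : ℕ} {φ V W : Euc n → ℝ} (hφ : ContDiff ℝ 2 φ)
    (hV : ContDiff ℝ 2 V) (hW : ContDiff ℝ 2 W)
    (d CV cW c0 c : ℝ) (hd : 0 < d) (hCV : 0 < CV) (hc0 : 0 < c0)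
    (hVlow : ∀ x, -d < V x)
    (hHV : ∀ x v : Euc n, hess V x v ≤ CV * ‖v‖ ^ 2)
    (hHW : ∀ y v : Euc n, cW * ‖v‖ ^ 2 ≤ hess W y v)
    (hratio : ∀ x, c0 * (d + ‖x‖ ^ 2) ≤ d + V x)
    (hpd : ∀ x, (hessMat φ x).PosDef)
    (hMA : ∀ x, Real.log (hessMat φ x).det = W (gradient φ x) - d * Real.log (d + V x) + c)
    (ε : ℝ) (x h : Euc n)
    (hmax : ∀ z, φ (z + h) + φ (z - h) - 2 * (1 + ε) * φ z ≤
      φ (x + h) + φ (x - h) - 2 * (1 + ε) * φ x) :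
    2 * W ((1 + ε) • gradient φ x) - 2 * W (gradient φ x) +
      cW * ‖(1/2 : ℝ) • (gradient φ (x + h) - gradient φ (x - h))‖ ^ 2 ≤
      CV / c0 * ‖h‖ ^ 2 + 2 * n * ε := by
  have e1 : ∀ (v : Euc n) (t : ℝ), HasDerivAt
      (fun t : ℝ => φ (x + h + t • v) + φ (x - h + t • v) - 2 * (1 + ε) * φ (x + t • v))
      (fderiv ℝ φ (x + h + t • v) v + fderiv ℝ φ (x - h + t • v) v
        - 2 * (1 + ε) * fderiv ℝ φ (x + t • v) v) t := fun v t =>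
    ((aux_line1 hφ (x + h) v t).add (aux_line1 hφ (x - h) v t)).sub
      ((aux_line1 hφ x v t).const_mul _)
  have e2 : ∀ (v : Euc n), HasDerivAt
      (fun t : ℝ => fderiv ℝ φ (x + h + t • v) v + fderiv ℝ φ (x - h + t • v) v
        - 2 * (1 + ε) * fderiv ℝ φ (x + t • v) v)
      (hess φ (x + h + (0:ℝ) • v) v + hess φ (x - h + (0:ℝ) • v) v
        - 2 * (1 + ε) * hess φ (x + (0:ℝ) • v) v) 0 := fun v =>
    ((aux_line2 hφ (x + h) v 0).add (aux_line2 hφ (x - h) v 0)).sub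
      ((aux_line2 hφ x v 0).const_mul _)
  have hm : ∀ (v : Euc n) (t : ℝ),
      φ (x + h + t • v) + φ (x - h + t • v) - 2 * (1 + ε) * φ (x + t • v) ≤
      φ (x + h + (0:ℝ) • v) + φ (x - h + (0:ℝ) • v) - 2 * (1 + ε) * φ (x + (0:ℝ) • v) := by
    intro v t
    have := hmax (x + t • v)
    rw [show x + t • v + h = x + h + t • v by abel, show x + t • v - h = x - h + t • v by abel] at this
    simpa using this
  have hgrad : gradient φ (x + h) + gradient φ (x - h) = (2 * (1 + ε)) • gradient φ x := by
    apply ext_inner_right ℝ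
    intro v
    have h0 := IsLocalMax.hasDerivAt_eq_zero (Filter.Eventually.of_forall (hm v)) (e1 v 0)
    simp only [zero_smul, add_zero] at h0
    rw [inner_add_left, inner_smul_left, aux_grad_inner, aux_grad_inner, aux_grad_inner]
    simp only [conj_trivial]
    linarith
  have hhess : ∀ v, hess φ (x + h) v + hess φ (x - h) v ≤ 2 * (1 + ε) * hess φ x v := by
    intro v
    have h0 := aux_second (e1 v) (e2 v) (hm v)
    simp only [zero_smul, add_zero] at h0
    linarith
  have hdet := aux_logdet _ _ _ (hpd x) (hpd (x + h)) (hpd (x - h)) ε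
    (hessMat_diff_psd hφ _ x (x + h) (x - h) hhess)
  rw [hMA, hMA, hMA] at hdet
  set δ := (1/2 : ℝ) • (gradient φ (x + h) - gradient φ (x - h)) with hδ
  have hp : gradient φ (x + h) = (1 + ε) • gradient φ x + δ := by
    have : (1 + ε) • gradient φ x = (1/2 : ℝ) • (gradient φ (x + h) + gradient φ (x - h)) := by
      rw [hgrad, smul_smul]; congr 1; ring
    rw [this, hδ]; module
  have hq : gradient φ (x - h) = (1 + ε) • gradient φ x - δ := by
    have : (1 + ε) • gradient φ x = (1/2 : ℝ) • (gradient φ (x + h) + gradient φ (x - h)) := by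
      rw [hgrad, smul_smul]; congr 1; ring
    rw [this, hδ]; module
  have hWd := aux_second_diff_lower hW hHW ((1 + ε) • gradient φ x) δ
  rw [← hp, ← hq] at hWd
  have hVd := aux_second_diff_upper hV hHV x h
  have hb : 0 < d + V x := by linarith [hVlow x]
  have hlog : ∀ z, Real.log (d + V z) - Real.log (d + V x) ≤ (V z - V x) / (d + V x) := by
    intro z
    have hz : 0 < d + V z := by linarith [hVlow z]
    rw [← Real.log_div hz.ne' hb.ne']
    refine (Real.log_le_sub_one_of_pos (by positivity)).trans (le_of_eq ?_)
    field_simp; ring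
  have h1 := hlog (x + h)
  have h2 := hlog (x - h)
  have h3 : (V (x + h) - V x) / (d + V x) + (V (x - h) - V x) / (d + V x) ≤
      CV * ‖h‖ ^ 2 / (d + V x) := by
    rw [← add_div]
    gcongr
    linarith
  have h4 : d * (CV * ‖h‖ ^ 2 / (d + V x)) ≤ CV / c0 * ‖h‖ ^ 2 := by
    have hr : c0 * d ≤ d + V x := by
      have := hratio x
      nlinarith [sq_nonneg ‖x‖]
    have : d * (CV * ‖h‖ ^ 2 / (d + V x)) ≤ d * (CV * ‖h‖ ^ 2 / (c0 * d)) := by gcongr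
    refine this.trans (le_of_eq ?_)
    field_simp
  have h5 : d * (Real.log (d + V (x + h)) - Real.log (d + V x)
      + (Real.log (d + V (x - h)) - Real.log (d + V x))) ≤ d * (CV * ‖h‖ ^ 2 / (d + V x)) :=
    mul_le_mul_of_nonneg_left (by linarith) hd.le
  linarith

lemma aux_rad {n : ℕ} {φ : Euc n → ℝ} (hφ : ContDiff ℝ 2 φ) (K : ℝ) (x h : Euc n)
    (hglob : ∀ t ∈ Icc (0:ℝ) 1, φ (x + t • h) + φ (x - t • h) - K * ‖t • h‖ ^ 2 ≤
      φ (x + h) + φ (x - h) - K * ‖h‖ ^ 2) :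
    K * ‖h‖ ^ 2 ≤ ⟪(1/2 : ℝ) • (gradient φ (x + h) - gradient φ (x - h)), h⟫ := by
  have h2 : HasDerivAt (fun t : ℝ => t ^ 2) (2 * 1) 1 := by simpa using hasDerivAt_pow 2 (1:ℝ)
  have hder : HasDerivAt (fun t : ℝ => φ (x + t • h) + φ (x + t • (-h)) - K * ‖h‖ ^ 2 * t ^ 2)
      (fderiv ℝ φ (x + (1:ℝ) • h) h + fderiv ℝ φ (x + (1:ℝ) • (-h)) (-h)
        - K * ‖h‖ ^ 2 * (2 * 1)) 1 :=
    ((aux_line1 hφ x h 1).add (aux_line1 hφ x (-h) 1)).sub (h2.const_mul _)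
  simp only [one_smul, map_neg, ← sub_eq_add_neg] at hder
  rw [← aux_grad_inner, ← aux_grad_inner] at hder
  have hle : ∀ t ∈ Icc (0:ℝ) 1, φ (x + t • h) + φ (x + t • (-h)) - K * ‖h‖ ^ 2 * t ^ 2 ≤
      φ (x + (1:ℝ) • h) + φ (x + (1:ℝ) • (-h)) - K * ‖h‖ ^ 2 * (1:ℝ) ^ 2 := by
    intro t ht
    have hn : ‖t • h‖ = t * ‖h‖ := by rw [norm_smul, Real.norm_of_nonneg ht.1]
    have := hglob t ht
    rw [hn] at this
    simp only [one_smul, smul_neg, ← sub_eq_add_neg]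
    have e : K * (t * ‖h‖) ^ 2 = K * ‖h‖ ^ 2 * t ^ 2 := by ring
    linarith
  by_contra hneg
  push Not at hneg
  have hdneg : ⟪gradient φ (x + h), h⟫ - ⟪gradient φ (x - h), h⟫ - K * ‖h‖ ^ 2 * (2 * 1) < 0 := by
    rw [inner_smul_left, inner_sub_left] at hneg
    simp only [conj_trivial] at hneg
    linarith
  have hs' := (hasDerivAt_iff_tendsto_slope_left_right.1 hder).1
  have hev := hs'.eventually (gt_mem_nhds hdneg)
  have hev2 : ∀ᶠ t in nhdsWithin (1:ℝ) (Iio 1), t ∈ Ioo (0:ℝ) 1 := Ioo_mem_nhdsLT one_pos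
  obtain ⟨t, ht1, ht2⟩ := (hev.and hev2).exists
  rw [slope_def_field] at ht1
  have := hle t ⟨ht2.1.le, ht2.2.le⟩
  simp only [one_smul, smul_neg, ← sub_eq_add_neg] at this ht1
  have h7 : t - 1 < 0 := by linarith [ht2.2]
  have := div_nonneg_of_nonpos (sub_nonpos.2 this) h7.le
  linarith

set_option maxHeartbeats 2000000 in
lemma aux_main {n : ℕ} {φ V W : Euc n → ℝ} (hφ : ContDiff ℝ 2 φ) (hc : ConvexOn ℝ univ φ)
    (hV : ContDiff ℝ 2 V) (hW : ContDiff ℝ 2 W)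
    (d CV cW c0 c : ℝ) (hd : 0 < d) (hCV : 0 < CV) (hcW : 0 < cW) (hc0 : 0 < c0)
    (hVlow : ∀ x, -d < V x)
    (hHV : ∀ x v : Euc n, hess V x v ≤ CV * ‖v‖ ^ 2)
    (hHW : ∀ y v : Euc n, cW * ‖v‖ ^ 2 ≤ hess W y v)
    (hratio : ∀ x, c0 * (d + ‖x‖ ^ 2) ≤ d + V x)
    (hpd : ∀ x, (hessMat φ x).PosDef)
    (hMA : ∀ x, Real.log (hessMat φ x).det = W (gradient φ x) - d * Real.log (d + V x) + c)
    (Cφ : ℝ) (hcoer : ∀ x, ‖x‖ / 2 - Cφ ≤ φ x)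
    (hgrowth : ∀ η : ℝ, 0 < η → ∃ C, 0 ≤ C ∧ ∀ x, ‖gradient φ x‖ ^ 2 ≤ η * ‖x‖ + C)
    (CW : ℝ) (hCW : 0 ≤ CW)
    (hWlow : ∀ y (ε : ℝ), 0 ≤ ε → W y - ε * CW ≤ W ((1 + ε) • y))
    (K : ℝ) (hK : 0 < K) (hK2 : CV / c0 < cW * K ^ 2) (x0 h0 : Euc n) :
    φ (x0 + h0) + φ (x0 - h0) - 2 * φ x0 ≤ K * ‖h0‖ ^ 2 := by
  by_contra hcon
  push Not at hcon
  set r := ‖h0‖ with hr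
  have hr0 : 0 ≤ r := norm_nonneg _
  set a := (φ (x0 + h0) + φ (x0 - h0) - 2 * φ x0 - K * r ^ 2) / 2 with ha
  have ha0 : 0 < a := by rw [ha]; linarith
  -- upper bound for second differences
  have hu : ∀ x h : Euc n, φ (x + h) + φ (x - h) - 2 * φ x ≤
      ‖h‖ * (‖gradient φ (x + h)‖ + ‖gradient φ (x - h)‖) := by
    intro x h
    have h1 := aux_tangent hφ hc (x + h) (-h)
    have h2 := aux_tangent hφ hc (x - h) h
    rw [inner_neg_right, add_neg_cancel_right] at h1
    rw [sub_add_cancel] at h2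
    have h3 := real_inner_le_norm (gradient φ (x + h)) h
    have h4 := (abs_le.1 (abs_real_inner_le_norm (gradient φ (x - h)) h)).1
    nlinarith
  have hu2 : ∀ η C : ℝ, 0 < η → (∀ x, ‖gradient φ x‖ ^ 2 ≤ η * ‖x‖ + C) →
      ∀ m : ℝ, 0 < m → ∀ x h : Euc n, ‖h‖ ≤ r →
      φ (x + h) + φ (x - h) - 2 * φ x ≤ ‖h‖ ^ 2 / m + m * (η * (‖x‖ + r) + C) := by
    intro η C hη hC m hm x h hh
    refine (hu x h).trans ?_
    have hs : ∀ z, ‖z‖ ≤ ‖x‖ + r → ‖h‖ * ‖gradient φ z‖ ≤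
        (‖h‖ ^ 2 / m + m * (η * (‖x‖ + r) + C)) / 2 := by
      intro z hz
      have h1 : ‖gradient φ z‖ ^ 2 ≤ η * (‖x‖ + r) + C :=
        (hC z).trans (by nlinarith)
      have h2 : m * ‖gradient φ z‖ ^ 2 ≤ m * (η * (‖x‖ + r) + C) :=
        mul_le_mul_of_nonneg_left h1 hm.le
      have h3 : 2 * (‖h‖ * ‖gradient φ z‖) ≤ ‖h‖ ^ 2 / m + m * ‖gradient φ z‖ ^ 2 := by
        have e : ‖h‖ ^ 2 / m + m * ‖gradient φ z‖ ^ 2 - 2 * (‖h‖ * ‖gradient φ z‖) =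
          (‖h‖ - m * ‖gradient φ z‖) ^ 2 / m := by field_simp; ring
        have : 0 ≤ (‖h‖ - m * ‖gradient φ z‖) ^ 2 / m := by positivity
        linarith
      linarith
    have h1 := hs (x + h) ((norm_add_le _ _).trans (by linarith))
    have h2 := hs (x - h) ((norm_sub_le _ _).trans (by linarith))
    rw [mul_add]
    linarith
  -- constants
  set g := cW * K ^ 2 - CV / c0 with hg
  have hg0 : 0 < g := by rw [hg]; linarith
  set C1 := (2 * n + 2 * CW) / g + 1 with hC1
  have hC10 : 0 < C1 := by positivity
  set lam := 4 * C1 / a with hlam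
  have hlam0 : 0 < lam := by positivity
  obtain ⟨C2, hC20, hC2⟩ := hgrowth (1 / lam) (by positivity)
  set C3 := lam * (1 / lam * r + C2) with hC3
  have hC30 : 0 ≤ C3 := by positivity
  obtain ⟨ε, hε0, hε1, hε2⟩ : ∃ ε : ℝ, 0 < ε ∧ ε * (2 * |φ x0| + 1) ≤ a ∧
      ε * (C3 + 2 * |Cφ| + 1) ≤ a / 2 := by
    refine ⟨min (a / (2 * |φ x0| + 1)) (a / 2 / (C3 + 2 * |Cφ| + 1)), by positivity, ?_, ?_⟩
    · rw [← le_div_iff₀ (by positivity)]; exact min_le_left _ _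
    · rw [← le_div_iff₀ (by positivity)]; exact min_le_right _ _
  -- the functional
  set Φ : Euc n × Euc n → ℝ := fun q =>
    φ (q.1 + q.2) + φ (q.1 - q.2) - 2 * (1 + ε) * φ q.1 - K * ‖q.2‖ ^ 2 with hΦ
  have hφc : Continuous φ := hφ.continuous
  have hΦc : Continuous Φ := by rw [hΦ]; fun_prop
  have hΦ0 : a ≤ Φ (x0, h0) := by
    simp only [hΦ]
    have := le_abs_self (φ x0)
    have : ε * φ x0 ≤ ε * |φ x0| := mul_le_mul_of_nonneg_left this hε0.le
    rw [← hr]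
    linarith
  obtain ⟨C4, hC40, hC4⟩ := hgrowth (ε / 2) (by positivity)
  set ρ := max ‖x0‖ ((r ^ 2 + (ε / 2 * r + C4) + 2 * ε * |Cφ|) / (ε / 2)) with hρ
  have hfar : ∀ x h : Euc n, ‖h‖ ≤ r → ρ < ‖x‖ → Φ (x, h) ≤ 0 := by
    intro x h hh hx
    simp only [hΦ]
    have h1 := hu2 (ε / 2) C4 (by positivity) hC4 1 one_pos x h hh
    have h2 := hcoer x
    have h3 : (r ^ 2 + (ε / 2 * r + C4) + 2 * ε * |Cφ|) / (ε / 2) < ‖x‖ :=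
      (le_max_right _ _).trans_lt hx
    rw [div_lt_iff₀ (by positivity)] at h3
    have h4 : ε * (‖x‖ / 2 - |Cφ|) ≤ ε * φ x :=
      mul_le_mul_of_nonneg_left (by linarith [le_abs_self Cφ]) hε0.le
    have h5 : ‖h‖ ^ 2 ≤ r ^ 2 := by gcongr
    have h6 : 0 ≤ K * ‖h‖ ^ 2 := by positivity
    linarith
  have hcomp : IsCompact (closedBall (0 : Euc n) ρ ×ˢ closedBall (0 : Euc n) r) :=
    (isCompact_closedBall _ _).prod (isCompact_closedBall _ _)
  have hmem0 : (x0, h0) ∈ closedBall (0 : Euc n) ρ ×ˢ closedBall (0 : Euc n) r := by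
    refine ⟨?_, ?_⟩
    · rw [mem_closedBall_zero_iff]; exact le_max_left _ _
    · rw [mem_closedBall_zero_iff]
  obtain ⟨⟨x, h⟩, hmem, hmax⟩ := hcomp.exists_isMaxOn ⟨_, hmem0⟩ hΦc.continuousOn
  have hhr : ‖h‖ ≤ r := by simpa using hmem.2
  have hval : a ≤ Φ (x, h) := hΦ0.trans (hmax hmem0)
  have hglob : ∀ z k : Euc n, ‖k‖ ≤ r → Φ (z, k) ≤ Φ (x, h) := by
    intro z k hk
    by_cases hz : ‖z‖ ≤ ρ
    · exact hmax ⟨by simpa using hz, by simpa using hk⟩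
    · exact (hfar z k hk (not_le.1 hz)).trans (ha0.le.trans hval)
  have hcore := aux_core hφ hV hW d CV cW c0 c hd hCV hc0 hVlow hHV hHW hratio hpd hMA ε x h
    (fun z => by
      have := hglob z h hhr
      simp only [hΦ] at this
      linarith)
  set δ := (1/2 : ℝ) • (gradient φ (x + h) - gradient φ (x - h)) with hδ
  -- radial derivative
  have hrad : K * ‖h‖ ^ 2 ≤ ⟪δ, h⟫ := by
    refine aux_rad hφ K x h fun t ht => ?_
    have hn : ‖t • h‖ ≤ r := by
      rw [norm_smul, Real.norm_of_nonneg ht.1]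
      exact (mul_le_of_le_one_left (norm_nonneg h) ht.2).trans hhr
    have := hglob x (t • h) hn
    simp only [hΦ] at this
    linarith
  have hδK : K * ‖h‖ ≤ ‖δ‖ := by
    by_cases hh : ‖h‖ = 0
    · rw [hh]; simp
    have hhp : 0 < ‖h‖ := lt_of_le_of_ne (norm_nonneg _) (Ne.symm hh)
    have := hrad.trans (real_inner_le_norm δ h)
    have h2 : (K * ‖h‖) * ‖h‖ ≤ ‖δ‖ * ‖h‖ := by linarith [this, sq ‖h‖, mul_assoc K ‖h‖ ‖h‖]
    exact le_of_mul_le_mul_right h2 hhp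
  have hδ2 : K ^ 2 * ‖h‖ ^ 2 ≤ ‖δ‖ ^ 2 := by
    rw [← mul_pow]; gcongr
  have hh2 : ‖h‖ ^ 2 ≤ C1 * ε := by
    have h1 := hWlow (gradient φ x) ε hε0.le
    have h2 : cW * (K ^ 2 * ‖h‖ ^ 2) ≤ cW * ‖δ‖ ^ 2 := mul_le_mul_of_nonneg_left hδ2 hcW.le
    have h3 : g * ‖h‖ ^ 2 ≤ (2 * n + 2 * CW) * ε := by
      have e : g * ‖h‖ ^ 2 = cW * (K ^ 2 * ‖h‖ ^ 2) - CV / c0 * ‖h‖ ^ 2 := by rw [hg]; ring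
      have e2 : (2 * n + 2 * CW) * ε = 2 * n * ε + 2 * (ε * CW) := by ring
      linarith
    have h4 : ‖h‖ ^ 2 ≤ (2 * n + 2 * CW) * ε / g := by
      rw [le_div_iff₀ hg0]; linarith
    have h5 : C1 * ε = (2 * n + 2 * CW) * ε / g + ε := by rw [hC1]; ring
    linarith
  have hfin := hu2 (1 / lam) C2 (by positivity) hC2 (ε * lam) (by positivity) x h hhr
  have h1 : ‖h‖ ^ 2 / (ε * lam) ≤ a / 4 := by
    rw [div_le_iff₀ (by positivity)]
    refine hh2.trans (le_of_eq ?_)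
    rw [hlam]; field_simp
  have h2 : ε * lam * (1 / lam * (‖x‖ + r) + C2) = ε * ‖x‖ + ε * C3 := by
    rw [hC3]; field_simp; ring
  have h4 : ε * (‖x‖ / 2 - |Cφ|) ≤ ε * φ x :=
    mul_le_mul_of_nonneg_left (by linarith [le_abs_self Cφ, hcoer x]) hε0.le
  have h6 : 0 ≤ K * ‖h‖ ^ 2 := by positivity
  simp only [hΦ] at hval
  rw [h2] at hfin
  linarith

lemma aux_int_pos {n : ℕ} (f : Euc n → ℝ) (hf : Integrable f) (hp : ∀ x, 0 < f x) :
    0 < ∫ x, f x := by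
  refine (integral_pos_iff_support_of_nonneg (fun x => (hp x).le) hf).2 ?_
  have : Function.support f = univ := by
    ext x; simp [(hp x).ne']
  rw [this]
  exact isOpen_univ.measure_pos volume ⟨0, mem_univ _⟩

lemma aux_norm_bound {n : ℕ} {φ : Euc n → ℝ} (hφ : ContDiff ℝ 2 φ) (hc : ConvexOn ℝ univ φ)
    (K : ℝ) (hK : 0 < K) (hh : ∀ x v, hess φ x v ≤ K * ‖v‖ ^ 2) (x : Euc n) :
    ‖fderiv ℝ (gradient φ) x‖ ≤ K := by
  refine ContinuousLinearMap.opNorm_le_bound _ hK.le fun v => ?_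
  set A := fderiv ℝ (gradient φ) x with hA
  have h1 := aux_hess_nonneg hφ hc x (K • v - A v)
  rw [aux_hess_grad hφ, ← hA] at h1
  have h2 := hh x v
  have h3 := hh x (A v)
  rw [aux_hess_grad hφ, ← hA] at h2 h3
  have hs := aux_grad_symm hφ x (A v) v
  rw [← hA, real_inner_self_eq_norm_sq] at hs
  have e : ⟪A (K • v - A v), K • v - A v⟫ =
      K ^ 2 * ⟪A v, v⟫ - 2 * K * ‖A v‖ ^ 2 + ⟪A (A v), A v⟫ := by
    rw [map_sub, map_smul, inner_sub_left, inner_sub_right, inner_sub_right, inner_smul_left,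
      inner_smul_left, inner_smul_right, inner_smul_right, hs, real_inner_self_eq_norm_sq]
    simp only [conj_trivial]
    ring
  rw [e] at h1
  have h4 : K ^ 2 * ⟪A v, v⟫ ≤ K ^ 2 * (K * ‖v‖ ^ 2) := by gcongr
  have h5 : K * ‖A v‖ ^ 2 ≤ K * (K * ‖v‖) ^ 2 := by nlinarith
  have h6 := le_of_mul_le_mul_left h5 hK
  exact le_of_sq_le_sq h6 (by positivity)

lemma aux_W {n : ℕ} {W : Euc n → ℝ} (hW : ContDiff ℝ 2 W) (cW : ℝ) (hcW : 0 < cW)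
    (hHW : ∀ y v : Euc n, cW * ‖v‖ ^ 2 ≤ hess W y v) :
    ∃ CW, 0 ≤ CW ∧ (∀ y, W 0 - CW + cW / 4 * ‖y‖ ^ 2 ≤ W y) ∧
      (∀ y (ε : ℝ), 0 ≤ ε → W y - ε * CW ≤ W ((1 + ε) • y)) := by
  set L := fderiv ℝ W 0 with hL
  have hlow : ∀ y, W 0 - ‖L‖ ^ 2 / cW + cW / 4 * ‖y‖ ^ 2 ≤ W y := by
    intro y
    have h1 := aux_taylor hW hHW 0 y
    rw [zero_add, ← hL] at h1
    have h2 := L.le_opNorm y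
    rw [Real.norm_eq_abs] at h2
    have h3 := (abs_le.1 h2).1
    have e : ‖L‖ ^ 2 / cW + cW / 4 * ‖y‖ ^ 2 - ‖L‖ * ‖y‖ = (‖L‖ - cW / 2 * ‖y‖) ^ 2 / cW := by
      field_simp; ring
    have h4 : 0 ≤ (‖L‖ - cW / 2 * ‖y‖) ^ 2 / cW := by positivity
    linarith
  refine ⟨‖L‖ ^ 2 / cW, by positivity, hlow, fun y ε hε => ?_⟩
  have h1 := aux_taylor hW hHW y (ε • y)
  have h2 := aux_taylor hW hHW y (-y)
  rw [add_neg_cancel, map_neg] at h2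
  rw [map_smul, smul_eq_mul, show y + ε • y = (1 + ε) • y by module] at h1
  have h3 := hlow y
  have h4 : 0 ≤ cW / 4 * ‖y‖ ^ 2 := by positivity
  have h5 : 0 ≤ cW / 2 * ‖ε • y‖ ^ 2 := by positivity
  have h6 : 0 ≤ cW / 2 * ‖-y‖ ^ 2 := by positivity
  have h7 : ε * (-(‖L‖ ^ 2 / cW)) ≤ ε * fderiv ℝ W y y :=
    mul_le_mul_of_nonneg_left (by linarith) hε
  linarith

lemma aux_V {n : ℕ} {V : Euc n → ℝ} (hV : ContDiff ℝ 2 V) (d CV : ℝ) (hd : 0 < d) (hCV : 0 < CV)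
    (hVlow : ∀ x, -d < V x)
    (hHV : ∀ x v : Euc n, hess V x v ≤ CV * ‖v‖ ^ 2) :
    ∃ A, 0 < A ∧ ∀ x, A * (1 + ‖x‖) ^ (-(2 * d)) ≤ (1 + V x / d) ^ (-d) := by
  set B := (CV + 2 * |V 0| + 2 * d) / d with hB
  have hB0 : 0 < B := by positivity
  refine ⟨B ^ (-d), by positivity, fun x => ?_⟩
  have hp : 0 < 1 + V x / d := by
    have : 1 + V x / d = (d + V x) / d := by field_simp
    rw [this]
    have := hVlow x
    exact div_pos (by linarith) hd
  have h1 := aux_second_diff_upper hV hHV 0 x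
  rw [zero_add, zero_sub] at h1
  have h2 := hVlow (-x)
  have h3 : 1 + V x / d ≤ B * (1 + ‖x‖) ^ 2 := by
    rw [hB, div_mul_eq_mul_div, le_div_iff₀ hd]
    have e : (1 + V x / d) * d = d + V x := by field_simp
    rw [e]
    have := le_abs_self (V 0)
    have h0 := abs_nonneg (V 0)
    have hx := norm_nonneg x
    have h4 : CV * ‖x‖ ^ 2 ≤ CV * (1 + ‖x‖) ^ 2 := by gcongr; linarith
    have h5 : (2 * |V 0| + 2 * d) * 1 ≤ (2 * |V 0| + 2 * d) * (1 + ‖x‖) ^ 2 := by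
      gcongr
      nlinarith
    linarith
  have h4 := Real.rpow_le_rpow_of_nonpos hp h3 (neg_nonpos.2 hd.le)
  refine le_trans (le_of_eq ?_) h4
  rw [Real.mul_rpow hB0.le (by positivity), ← Real.rpow_natCast (1 + ‖x‖) 2,
    ← Real.rpow_mul (by positivity)]
  congr 2
  push_cast
  ring

/-- **Global polynomial-to-log-concave estimate** (`D = ∞`, `R = ∞`). -/
theorem global_poly_to_logconcave_estimate
    {n : ℕ} (hn : 1 ≤ n) (d : ℝ) (hnd : (n : ℝ) ≤ d)
    (V W : Euc n → ℝ) (hVreg : ContDiff ℝ 2 V) (hWreg : ContDiff ℝ 2 W)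
    (hVlow : ∀ x, -d < V x)
    (hZV : Integrable fun x : Euc n => (1 + V x / d) ^ (-d))
    (hZW : Integrable fun y : Euc n => Real.exp (-W y))
    (CV2 cW2 : ℝ) (hCV2 : 0 < CV2) (hcW2 : 0 < cW2)
    (hHessV : ∀ x v : Euc n, hess V x v ≤ CV2 * ‖v‖ ^ 2)
    (hHessW : ∀ y v : Euc n, cW2 * ‖v‖ ^ 2 ≤ hess W y v)
    (hc0V : 0 < cLow V d univ)
    (φ : Euc n → ℝ) (hφreg : ContDiff ℝ 2 φ) (hφconv : ConvexOn ℝ univ φ)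
    (hpush : Measure.map (fun x => gradient φ x) (muUP V d) = muExp W) :
    (∀ (x e : Euc n), ‖e‖ = 1 →
        hess φ x e ≤ Real.sqrt (CV2 / (cW2 * cLow V d univ))) ∧
      ∀ a b : Euc n, ‖gradient φ a - gradient φ b‖ ≤
        Real.sqrt (CV2 / (cW2 * cLow V d univ)) * ‖a - b‖ := by
  have hd : 0 < d := by
    have : (1 : ℝ) ≤ n := by exact_mod_cast hn
    linarith
  set c0 := cLow V d univ with hc0
  have hratio : ∀ x, c0 * (d + ‖x‖ ^ 2) ≤ d + V x := by
    intro x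
    have h1 : c0 ≤ ratio0 V d x := by
      refine csInf_le ⟨0, ?_⟩ ⟨x, mem_univ _, rfl⟩
      rintro _ ⟨z, -, rfl⟩
      have := hVlow z
      exact div_nonneg (by linarith) (by positivity)
    rw [ratio0, le_div_iff₀ (by positivity)] at h1
    exact h1
  have hbase : ∀ x, 1 + V x / d = (d + V x) / d := fun x => by field_simp
  have hp : ∀ x, 0 < 1 + V x / d := by
    intro x
    rw [hbase]
    have := hVlow x
    exact div_pos (by linarith) hd
  have hZ : 0 < Znorm V d := aux_int_pos _ hZV fun x => Real.rpow_pos_of_pos (hp x) _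
  have hY : 0 < ∫ z, Real.exp (-W z) := aux_int_pos _ hZW fun x => Real.exp_pos _
  set Z := Znorm V d with hZdef
  set Y := ∫ z, Real.exp (-W z) with hYdef
  set F : Euc n → ℝ := fun x => Z⁻¹ * (1 + V x / d) ^ (-d) with hF
  set G : Euc n → ℝ := fun y => Y⁻¹ * Real.exp (-W y) with hG
  have hpush' : Measure.map (fun x => gradient φ x)
      (volume.withDensity fun x => ENNReal.ofReal (F x))
      = volume.withDensity fun x => ENNReal.ofReal (G x) := hpush
  have hVc : Continuous V := hVreg.continuous
  have hWc : Continuous W := hWreg.continuous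
  have hFc : Continuous F := by
    refine continuous_const.mul (Continuous.rpow_const (by fun_prop) fun x => Or.inl (hp x).ne')
  have hGc : Continuous G := by rw [hG]; fun_prop
  have hFp : ∀ x, 0 < F x := fun x => mul_pos (inv_pos.2 hZ) (Real.rpow_pos_of_pos (hp x) _)
  have hGp : ∀ x, 0 < G x := fun x => mul_pos (inv_pos.2 hY) (Real.exp_pos _)
  have hMA0 := aux_MA hφreg hφconv F G hFc hGc hFp hGp hpush'
  have hpd : ∀ x, (hessMat φ x).PosDef := by
    intro x
    refine (hessMat_psd hφreg hφconv x).posDef_iff_det_ne_zero.2 fun h0 => ?_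
    have h1 := hMA0 x
    rw [← hessMat_det, h0, abs_zero, zero_mul] at h1
    exact (hFp x).ne' h1
  have hMA : ∀ x, Real.log (hessMat φ x).det = W (gradient φ x) - d * Real.log (d + V x) +
      (d * Real.log d + Real.log Y - Real.log Z) := by
    intro x
    have h1 := hMA0 x
    have hdet := (hpd x).det_pos
    rw [← hessMat_det, abs_of_pos hdet] at h1
    have h2 := congrArg Real.log h1
    have hdv : 0 < d + V x := by linarith [hVlow x]
    rw [Real.log_mul hdet.ne' (hGp _).ne'] at h2
    simp only [hF, hG] at h2
    rw [Real.log_mul (inv_pos.2 hZ).ne' (Real.rpow_pos_of_pos (hp x) _).ne',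
      Real.log_mul (inv_pos.2 hY).ne' (Real.exp_pos _).ne', Real.log_exp,
      Real.log_rpow (hp x), hbase, Real.log_div hdv.ne' hd.ne', Real.log_inv, Real.log_inv] at h2
    linarith
  obtain ⟨Cφ, hcoer⟩ := aux_coercive hφreg hφconv F G hGc hGp hpush'
  obtain ⟨CW, hCW, hWl, hWlow⟩ := aux_W hWreg cW2 hcW2 hHessW
  obtain ⟨A, hA, hVA⟩ := aux_V hVreg d CV2 hd hCV2 hVlow hHessV
  have hgrowth := aux_growth hφreg hφconv F G hpush' (2 * d) (Z⁻¹ * A)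
    (Y⁻¹ * Real.exp (-(W 0 - CW))) (cW2 / 4) (by positivity) (by positivity) (by positivity)
    (by positivity)
    (fun x => by
      rw [mul_assoc]
      exact mul_le_mul_of_nonneg_left (hVA x) (inv_pos.2 hZ).le)
    (fun y => by
      rw [mul_assoc, ← Real.exp_add]
      refine mul_le_mul_of_nonneg_left (Real.exp_le_exp.2 ?_) (inv_pos.2 hY).le
      have := hWl y
      linarith)
  set K0 := Real.sqrt (CV2 / (cW2 * c0)) with hK0
  have hK0p : 0 < K0 := Real.sqrt_pos.2 (by positivity)
  have hK0s : K0 ^ 2 = CV2 / (cW2 * c0) := Real.sq_sqrt (by positivity)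
  have hK : ∀ K, K0 < K → ∀ x h : Euc n, φ (x + h) + φ (x - h) - 2 * φ x ≤ K * ‖h‖ ^ 2 := by
    intro K hKK
    have hKp : 0 < K := hK0p.trans hKK
    refine aux_main hφreg hφconv hVreg hWreg d CV2 cW2 c0 _ hd hCV2 hcW2 hc0V hVlow hHessV hHessW
      hratio hpd hMA Cφ hcoer hgrowth CW hCW hWlow K hKp ?_
    have h1 : K0 ^ 2 < K ^ 2 := by gcongr
    have h2 : CV2 / c0 = cW2 * K0 ^ 2 := by rw [hK0s]; field_simp
    rw [h2]
    gcongr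
  have hhess : ∀ x v : Euc n, hess φ x v ≤ K0 * ‖v‖ ^ 2 := by
    intro x v
    have h1 : ∀ K, K0 < K → hess φ x v ≤ K * ‖v‖ ^ 2 := by
      intro K hKK
      refine aux_hess_le hφreg x v fun t => ?_
      refine (hK K hKK x (t • v)).trans (le_of_eq ?_)
      rw [norm_smul, mul_pow, Real.norm_eq_abs, sq_abs]
      ring
    refine ge_of_tendsto (x := nhdsWithin K0 (Ioi K0)) (f := fun K => K * ‖v‖ ^ 2) ?_
      (Filter.eventually_of_mem self_mem_nhdsWithin h1)
    exact ((continuous_id.mul continuous_const).tendsto K0).mono_left nhdsWithin_le_nhds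
  refine ⟨fun x e he => ?_, fun a b => ?_⟩
  · have := hhess x e
    rw [he] at this
    linarith
  · exact convex_univ.norm_image_sub_le_of_norm_fderiv_le (𝕜 := ℝ)
      (fun x _ => ((aux_grad_contDiff hφreg).differentiable (by norm_num)) x)
      (fun x _ => aux_norm_bound hφreg hφconv K0 hK0p hhess x) (mem_univ b) (mem_univ a)
end
end

section
/- Caffarelli's contraction theorem with sharp constant. Let n ≥ 1 be an integer, and let V, W : ℝⁿ → ℝ be C² functions such that f = e^{−V} and g = e^{−W} are probability densities with respect to Lebesgue measure. Assume D²V ≤ C_V⁽²⁾·Id and D²W ≥ c_W⁽²⁾·Id with 0 < c_W⁽²⁾, C_V⁽²⁾ < ∞. Let φ : ℝⁿ → ℝ be convex and differentiable with (∇φ)_# (f dx) = g dy. Then T = ∇φ is globally Lipschitz with Lipschitz constant √(C_V⁽²⁾/c_W⁽²⁾). -/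
open MeasureTheory Metric Set
open scoped ENNReal RealInnerProductSpace

noncomputable section

section
open MeasureTheory Metric Set
open scoped ENNReal RealInnerProductSpace Pointwise

/-- One-dimensional Brunn-Minkowski for compact sets. -/
theorem bm_compact {A B : Set ℝ} (hA : IsCompact A) (hB : IsCompact B) (hA0 : A.Nonempty)
    (hB0 : B.Nonempty) : volume A + volume B ≤ volume (A + B) := by
  obtain ⟨a, ha, hamax⟩ := hA.exists_isGreatest hA0
  obtain ⟨b, hb, hbmin⟩ := hB.exists_isLeast hB0
  have h1 : volume A = volume ((fun x => x + b) '' A) := by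
    rw [Set.image_add_right, measure_preimage_add_right]
  have h2 : volume B = volume ((fun x => a + x) '' B) := by
    rw [Set.image_add_left, measure_preimage_add]
  have h3 : volume B = volume ((fun x => a + x) '' B \ {a + b}) := by
    rw [h2, measure_sdiff_null (by simp)]
  rw [h1, h3, ← measure_union]
  · apply measure_mono
    rintro z (⟨x, hx, rfl⟩ | ⟨⟨x, hx, rfl⟩, -⟩)
    · exact Set.add_mem_add hx hb
    · exact Set.add_mem_add ha hx
  · rw [Set.disjoint_left]
    rintro z ⟨x, hx, rfl⟩ ⟨⟨y, hy, hxy⟩, hne⟩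
    apply hne
    have := hamax hx
    have := hbmin hy
    simp only at hxy
    simp only [mem_singleton_iff]
    linarith
  · exact ((hB.image (by fun_prop)).measurableSet).diff (measurableSet_singleton _)

theorem bm_one {A B S : Set ℝ} (hA : MeasurableSet A) (hB : MeasurableSet B) (hA0 : A.Nonempty)
    (hB0 : B.Nonempty) (hS : ∀ a ∈ A, ∀ b ∈ B, (a + b) / 2 ∈ S) :
    volume A + volume B ≤ 2 * volume S := by
  have key : ∀ K L : Set ℝ, K ⊆ A → L ⊆ B → IsCompact K → IsCompact L →
      volume K + volume L ≤ 2 * volume S := by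
    intro K L hK hL hKc hLc
    obtain ⟨a, ha⟩ := hA0
    obtain ⟨b, hb⟩ := hB0
    calc volume K + volume L ≤ volume (insert a K) + volume (insert b L) :=
          add_le_add (measure_mono (subset_insert _ _)) (measure_mono (subset_insert _ _))
      _ ≤ volume (insert a K + insert b L) :=
          bm_compact (hKc.insert a) (hLc.insert b) (insert_nonempty _ _) (insert_nonempty _ _)
      _ ≤ volume ((2:ℝ) • S) := by
          apply measure_mono
          rintro z ⟨x, hx, y, hy, rfl⟩
          refine ⟨(x + y) / 2, hS x (insert_subset ha hK hx) y (insert_subset hb hL hy), ?_⟩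
          simp; ring
      _ = 2 * volume S := by
          rw [Measure.addHaar_smul]; simp
  rw [hA.measure_eq_iSup_isCompact, hB.measure_eq_iSup_isCompact]
  refine ENNReal.iSup_add_iSup_le ?_
  intro K L
  by_cases hK : K ⊆ A ∧ IsCompact K <;> by_cases hL : L ⊆ B ∧ IsCompact L
  · simpa [hK, hL] using key K L hK.1 hL.1 hK.2 hL.2
  · have := key K ∅ hK.1 (empty_subset _) hK.2 isCompact_empty
    simpa [hK, iSup_and', hL] using this
  · have := key ∅ L (empty_subset _) hL.1 isCompact_empty hL.2
    simpa [hL, iSup_and', hK] using this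
  · simp [hL, iSup_and', hK]

theorem ennreal_four_mul_le (a b c : ℝ≥0∞) (h : a + b ≤ 2 * c) : a * b ≤ c ^ 2 := by
  by_cases hc : c = ⊤
  · subst hc; simp
  have hab : a + b ≠ ⊤ := ne_top_of_le_ne_top (by finiteness) h
  have ha : a ≠ ⊤ := fun h => hab (by simp [h])
  have hb : b ≠ ⊤ := fun h => hab (by simp [h])
  lift a to NNReal using ha
  lift b to NNReal using hb
  lift c to NNReal using hc
  norm_cast at *
  have h' : (a:ℝ) + b ≤ 2 * c := by exact_mod_cast h
  have : (a:ℝ) * b ≤ c ^ 2 := by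
    nlinarith [sq_nonneg ((a:ℝ) - b), a.2, b.2, c.2, NNReal.coe_nonneg a, NNReal.coe_nonneg b]
  exact_mod_cast this

/-- normalized version -/
theorem pl_norm {f g h : ℝ → ℝ} (hf : Measurable f) (hg : Measurable g) (hh : Measurable h)
    (hf0 : ∀ x, 0 ≤ f x) (hg0 : ∀ x, 0 ≤ g x) (hh0 : ∀ x, 0 ≤ h x)
    (hf1 : ∀ x, f x ≤ 1) (hg1 : ∀ x, g x ≤ 1)
    (hfs : ∀ t < 1, ∃ x, t < f x) (hgs : ∀ t < 1, ∃ x, t < g x)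
    (H : ∀ x y, f x * g y ≤ h ((x + y) / 2) ^ 2) :
    (∫⁻ x, ENNReal.ofReal (f x)) + (∫⁻ x, ENNReal.ofReal (g x))
      ≤ 2 * (∫⁻ x, ENNReal.ofReal (h x)) := by
  rw [lintegral_eq_lintegral_meas_lt _ (.of_forall hf0) hf.aemeasurable,
    lintegral_eq_lintegral_meas_lt _ (.of_forall hg0) hg.aemeasurable,
    lintegral_eq_lintegral_meas_lt _ (.of_forall hh0) hh.aemeasurable,
    ← lintegral_add_left, ← lintegral_const_mul']
  · apply setLIntegral_mono' measurableSet_Ioi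
    intro t (ht : 0 < t)
    by_cases ht1 : t < 1
    · apply bm_one (measurableSet_lt measurable_const hf) (measurableSet_lt measurable_const hg)
        (hfs t ht1) (hgs t ht1)
      intro a (ha : t < f a) b (hb : t < g b)
      show t < h _
      have := H a b
      have : t ^ 2 < h ((a + b) / 2) ^ 2 := by nlinarith
      exact lt_of_pow_lt_pow_left₀ 2 (hh0 _) this
    · have e1 : {a | t < f a} = ∅ := by
        ext x; simp; exact (hf1 x).trans (not_lt.1 ht1)
      have e2 : {a | t < g a} = ∅ := by
        ext x; simp; exact (hg1 x).trans (not_lt.1 ht1)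
      simp [e1, e2]
  · simp
  · exact Antitone.measurable (fun s t hst => measure_mono fun x (hx : t < f x) => lt_of_le_of_lt hst hx)

theorem pl_bdd {f g h : ℝ → ℝ} (hf : Measurable f) (hg : Measurable g) (hh : Measurable h)
    (hf0 : ∀ x, 0 ≤ f x) (hg0 : ∀ x, 0 ≤ g x) (hh0 : ∀ x, 0 ≤ h x)
    (hfb : BddAbove (range f)) (hgb : BddAbove (range g))
    (H : ∀ x y, f x * g y ≤ h ((x + y) / 2) ^ 2) :
    (∫⁻ x, ENNReal.ofReal (f x)) * (∫⁻ x, ENNReal.ofReal (g x))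
      ≤ (∫⁻ x, ENNReal.ofReal (h x)) ^ 2 := by
  by_cases hf00 : ∀ x, f x = 0
  · simp [hf00]
  by_cases hg00 : ∀ x, g x = 0
  · simp [hg00]
  push Not at hf00 hg00
  obtain ⟨x0, hx0⟩ := hf00
  obtain ⟨y0, hy0⟩ := hg00
  set a := ⨆ x, f x
  set b := ⨆ x, g x
  have ha : 0 < a := lt_of_lt_of_le (lt_of_le_of_ne (hf0 x0) (Ne.symm hx0)) (le_ciSup hfb x0)
  have hb : 0 < b := lt_of_lt_of_le (lt_of_le_of_ne (hg0 y0) (Ne.symm hy0)) (le_ciSup hgb y0)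
  set c := Real.sqrt (a * b)
  have hc : 0 < c := Real.sqrt_pos.2 (mul_pos ha hb)
  have hcc : c ^ 2 = a * b := Real.sq_sqrt (mul_pos ha hb).le
  have key := pl_norm (f := fun x => f x / a) (g := fun x => g x / b) (h := fun x => h x / c)
    (by fun_prop) (by fun_prop) (by fun_prop) (fun x => div_nonneg (hf0 x) ha.le)
    (fun x => div_nonneg (hg0 x) hb.le) (fun x => div_nonneg (hh0 x) hc.le)
    (fun x => (div_le_one ha).2 (le_ciSup hfb x)) (fun x => (div_le_one hb).2 (le_ciSup hgb x))
    (fun t ht => by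
      obtain ⟨x, hx⟩ := exists_lt_of_lt_ciSup (show t * a < ⨆ x, f x by nlinarith)
      exact ⟨x, (lt_div_iff₀ ha).2 hx⟩)
    (fun t ht => by
      obtain ⟨x, hx⟩ := exists_lt_of_lt_ciSup (show t * b < ⨆ x, g x by nlinarith)
      exact ⟨x, (lt_div_iff₀ hb).2 hx⟩)
    (fun x y => by
      rw [div_mul_div_comm, div_pow, hcc]
      exact div_le_div_of_nonneg_right (H x y) (mul_pos ha hb).le)
  have key2 := ennreal_four_mul_le _ _ _ key
  have sc : ∀ (u : ℝ → ℝ) (r : ℝ), 0 < r → (∀ x, 0 ≤ u x) →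
      ∫⁻ x, ENNReal.ofReal (u x) = ENNReal.ofReal r * ∫⁻ x, ENNReal.ofReal (u x / r) := by
    intro u r hr hu
    rw [← lintegral_const_mul' _ _ (by simp)]
    congr 1; ext x
    rw [← ENNReal.ofReal_mul hr.le, mul_div_cancel₀ _ hr.ne']
  rw [sc f a ha hf0, sc g b hb hg0, sc h c hc hh0, mul_pow, ← ENNReal.ofReal_pow hc.le, hcc,
    ENNReal.ofReal_mul ha.le, mul_mul_mul_comm]
  gcongr

theorem pl_one {f g h : ℝ → ℝ≥0∞} (hf : Measurable f) (hg : Measurable g) (hh : Measurable h)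
    (H : ∀ x y, f x * g y ≤ h ((x + y) / 2) ^ 2) :
    (∫⁻ x, f x) * (∫⁻ x, g x) ≤ (∫⁻ x, h x) ^ 2 := by
  have step : ∀ N : ℕ, (∫⁻ x, min (f x) N) * (∫⁻ x, min (g x) N) ≤ (∫⁻ x, h x) ^ 2 := by
    intro N
    have fin : ∀ u : ℝ → ℝ≥0∞, ∀ x, min (u x) N ≠ ⊤ := fun u x =>
      ne_top_of_le_ne_top (ENNReal.natCast_ne_top N) (min_le_right _ _)
    have e : ∀ u : ℝ → ℝ≥0∞, ∫⁻ x, min (u x) N = ∫⁻ x, ENNReal.ofReal (min (u x) N).toReal := by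
      intro u; congr 1; ext x; rw [ENNReal.ofReal_toReal (fin u x)]
    have bd : ∀ u : ℝ → ℝ≥0∞, BddAbove (range fun x => (min (u x) N).toReal) := by
      intro u
      refine ⟨N, ?_⟩
      rintro _ ⟨x, rfl⟩
      exact ENNReal.toReal_le_of_le_ofReal (by positivity) (by simp)
    refine le_trans ?_ (pow_le_pow_left' (lintegral_mono (fun x => min_le_left (h x) N)) 2)
    rw [e, e, e]
    apply pl_bdd (by fun_prop) (by fun_prop) (by fun_prop) (fun _ => ENNReal.toReal_nonneg)
      (fun _ => ENNReal.toReal_nonneg) (fun _ => ENNReal.toReal_nonneg) (bd f) (bd g)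
    intro x y
    rw [← ENNReal.toReal_mul, ← ENNReal.toReal_pow]
    apply ENNReal.toReal_mono (ENNReal.pow_ne_top (fin h _))
    rcases le_total (h ((x + y) / 2)) N with h1 | h1
    · rw [min_eq_left h1]
      exact le_trans (mul_le_mul' (min_le_left _ _) (min_le_left _ _)) (H x y)
    · rw [min_eq_right h1, sq]
      exact mul_le_mul' (min_le_right _ _) (min_le_right _ _)
  have lim : ∀ u : ℝ → ℝ≥0∞, Measurable u →
      Filter.Tendsto (fun N : ℕ => ∫⁻ x, min (u x) N) Filter.atTop (nhds (∫⁻ x, u x)) := by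
    intro u hu
    apply lintegral_tendsto_of_tendsto_of_monotone (fun N => by fun_prop)
    · refine .of_forall fun x M N hMN => ?_
      exact min_le_min_left _ (by exact_mod_cast hMN)
    · refine .of_forall fun x => ?_
      have := (tendsto_const_nhds (x := u x)).min ENNReal.tendsto_nat_nhds_top
      simpa using this
  by_cases hf0 : ∫⁻ x, f x = 0
  · simp [hf0]
  by_cases hg0 : ∫⁻ x, g x = 0
  · simp [hg0]
  exact le_of_tendsto (ENNReal.Tendsto.mul (lim f hf) (Or.inl hf0) (lim g hg) (Or.inl hg0))
    (.of_forall step)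

theorem pl_pi (n : ℕ) : ∀ {f g h : (Fin n → ℝ) → ℝ≥0∞} (_ : Measurable f) (_ : Measurable g)
    (_ : Measurable h) (_ : ∀ x y, f x * g y ≤ h ((1/2 : ℝ) • (x + y)) ^ 2),
    (∫⁻ x, f x) * (∫⁻ x, g x) ≤ (∫⁻ x, h x) ^ 2 := by
  induction n with
  | zero =>
    intro f g h hf hg hh H
    have : (volume : Measure (Fin 0 → ℝ)) = Measure.dirac default := by
      rw [volume_pi, Measure.pi_of_empty _ default]
    simp only [this, lintegral_dirac]
    convert H default default
  | succ n ih =>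
    intro f g h hf hg hh H
    have e := (volume_preserving_piFinSuccAbove (fun _ : Fin (n + 1) => ℝ) 0).symm
    have conv : ∀ u : (Fin (n+1) → ℝ) → ℝ≥0∞, Measurable u →
        ∫⁻ x, u x = ∫⁻ t : ℝ, ∫⁻ x : Fin n → ℝ,
          u ((MeasurableEquiv.piFinSuccAbove (fun _ => ℝ) 0).symm (t, x)) := by
      intro u hu
      rw [← e.lintegral_comp hu]
      exact lintegral_prod _ (hu.comp (MeasurableEquiv.measurable _)).aemeasurable
    have meas : ∀ u : (Fin (n+1) → ℝ) → ℝ≥0∞, Measurable u →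
      Measurable (fun t : ℝ => ∫⁻ x : Fin n → ℝ,
          u ((MeasurableEquiv.piFinSuccAbove (fun _ => ℝ) 0).symm (t, x))) := by
      intro u hu
      exact Measurable.lintegral_prod_right (hu.comp (MeasurableEquiv.measurable _))
    rw [conv f hf, conv g hg, conv h hh]
    apply pl_one (meas f hf) (meas g hg) (meas h hh)
    intro s t
    apply ih
    · exact hf.comp ((MeasurableEquiv.measurable _).comp (by fun_prop))
    · exact hg.comp ((MeasurableEquiv.measurable _).comp (by fun_prop))
    · exact hh.comp ((MeasurableEquiv.measurable _).comp (by fun_prop))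
    · intro x y
      refine (H _ _).trans (le_of_eq ?_)
      congr 2
      ext i
      refine Fin.cases ?_ (fun j => ?_) i
      · simp [MeasurableEquiv.piFinSuccAbove]; ring
      · simp [MeasurableEquiv.piFinSuccAbove]; ring

/-- Midpoint Prekopa-Leindler inequality on Euclidean space. -/
theorem pl_euc {n : ℕ} {f g h : Euc n → ℝ≥0∞} (hf : Measurable f) (hg : Measurable g)
    (hh : Measurable h) (H : ∀ x y, f x * g y ≤ h ((1/2 : ℝ) • (x + y)) ^ 2) :
    (∫⁻ x, f x) * (∫⁻ x, g x) ≤ (∫⁻ x, h x) ^ 2 := by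
  have e := PiLp.volume_preserving_toLp (Fin n)
  rw [← e.lintegral_comp hf, ← e.lintegral_comp hg, ← e.lintegral_comp hh]
  apply pl_pi n (hf.comp e.measurable) (hg.comp e.measurable) (hh.comp e.measurable)
  intro x y
  exact H _ _
end

section
open MeasureTheory Metric Set
open scoped ENNReal RealInnerProductSpace Pointwise

theorem cs_exp {α : Type*} [MeasurableSpace α] (μ : Measure α) {u v w : α → ℝ} (hu : Measurable u)
    (hv : Measurable v) (hw : ∀ x, 2 * w x ≤ u x + v x) :
    (∫⁻ x, ENNReal.ofReal (Real.exp (w x)) ∂μ) ^ 2 ≤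
      (∫⁻ x, ENNReal.ofReal (Real.exp (u x)) ∂μ) * (∫⁻ x, ENNReal.ofReal (Real.exp (v x)) ∂μ) := by
  have h := ENNReal.lintegral_mul_le_Lp_mul_Lq μ (p := 2) (q := 2) Real.HolderConjugate.two_two
    (f := fun x => ENNReal.ofReal (Real.exp (u x / 2)))
    (g := fun x => ENNReal.ofReal (Real.exp (v x / 2))) (by fun_prop) (by fun_prop)
  have e : ∀ t : ℝ, ENNReal.ofReal (Real.exp (t / 2)) ^ (2:ℝ) = ENNReal.ofReal (Real.exp t) := by
    intro t
    rw [ENNReal.rpow_ofNat, ← ENNReal.ofReal_pow (Real.exp_pos _).le, ← Real.exp_nat_mul]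
    congr 2; push_cast; ring
  simp only [e] at h
  have h1 : ∫⁻ x, ENNReal.ofReal (Real.exp (w x)) ∂μ ≤ _ := le_trans (lintegral_mono (fun x => by
    show _ ≤ ENNReal.ofReal (Real.exp (u x / 2)) * ENNReal.ofReal (Real.exp (v x / 2))
    rw [← ENNReal.ofReal_mul (Real.exp_pos _).le, ← Real.exp_add]
    apply ENNReal.ofReal_le_ofReal
    apply Real.exp_le_exp.2
    linarith [hw x])) h
  refine (pow_le_pow_left' h1 2).trans (le_of_eq ?_)
  rw [mul_pow]
  have e2 : ∀ t : ℝ≥0∞, (t ^ (1 / (2:ℝ))) ^ 2 = t := by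
    intro t
    rw [← ENNReal.rpow_natCast, ← ENNReal.rpow_mul]; norm_num
  rw [e2, e2]

variable {n : ℕ}

theorem laplace_lower {U : Euc n → ℝ} (hU : Measurable U) {A τ : ℝ} (hA : 0 < A)
    (hmid : ∀ x s, U (x + s) + U (x - s) ≤ 2 * U x + A * ‖s‖ ^ 2) (y h : Euc n) :
    (∫⁻ x, ENNReal.ofReal (Real.exp (τ * ⟪x, y⟫ - U x))) ^ 2
        * ENNReal.ofReal (Real.exp (τ ^ 2 * ‖h‖ ^ 2 / A)) ≤
      (∫⁻ x, ENNReal.ofReal (Real.exp (τ * ⟪x, y + h⟫ - U x))) *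
      (∫⁻ x, ENNReal.ofReal (Real.exp (τ * ⟪x, y - h⟫ - U x))) := by
  set s : Euc n := (τ / A) • h with hs
  rw [← lintegral_add_right_eq_self (fun x => ENNReal.ofReal (Real.exp (τ * ⟪x, y + h⟫ - U x))) s,
    ← lintegral_sub_right_eq_self (fun x => ENNReal.ofReal (Real.exp (τ * ⟪x, y - h⟫ - U x))) s]
  refine le_trans (le_of_eq ?_) (cs_exp volume
    (w := fun x => τ * ⟪x, y⟫ - U x + τ ^ 2 * ‖h‖ ^ 2 / A / 2) (by fun_prop) (by fun_prop) ?_)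
  · simp only [Real.exp_add, ENNReal.ofReal_mul (Real.exp_pos _).le]
    rw [lintegral_mul_const' _ _ (by simp), mul_pow, ← ENNReal.ofReal_pow (Real.exp_pos _).le,
      ← Real.exp_nat_mul]
    congr 3; push_cast; ring
  · intro x
    have h1 := hmid x s
    have h2 : ⟪s, h⟫ = τ / A * ‖h‖ ^ 2 := by
      rw [hs, real_inner_smul_left, real_inner_self_eq_norm_sq]
    have h3 : ‖s‖ ^ 2 = (τ / A) ^ 2 * ‖h‖ ^ 2 := by
      rw [hs, norm_smul, mul_pow, Real.norm_eq_abs, sq_abs]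
    simp only [inner_add_left, inner_add_right, inner_sub_left, inner_sub_right, h2]
    rw [h3] at h1
    have h4 : A * ((τ / A) ^ 2 * ‖h‖ ^ 2) = τ ^ 2 * ‖h‖ ^ 2 / A := by field_simp
    have h5 : τ * (τ / A * ‖h‖ ^ 2) = τ ^ 2 * ‖h‖ ^ 2 / A := by field_simp
    have h6 : τ ^ 2 * ‖h‖ ^ 2 / A / 2 = 1/2 * (τ ^ 2 * ‖h‖ ^ 2 / A) := by ring
    rw [h4] at h1
    rw [h6]
    nlinarith [h1, h5]

theorem young_inner {a : ℝ} (ha : 0 < a) (τ : ℝ) (h k : Euc n) :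
    2 * τ * ⟪h, k⟫ ≤ a * ‖k‖ ^ 2 + τ ^ 2 * ‖h‖ ^ 2 / a := by
  have h3 : 0 ≤ ‖a • k - τ • h‖ ^ 2 := by positivity
  rw [norm_sub_sq_real, norm_smul, norm_smul, mul_pow, mul_pow, Real.norm_eq_abs,
    Real.norm_eq_abs, sq_abs, sq_abs, real_inner_smul_left, real_inner_smul_right,
    real_inner_comm] at h3
  have : a * ‖k‖ ^ 2 + τ ^ 2 * ‖h‖ ^ 2 / a - 2 * τ * ⟪h, k⟫ =
    (a ^ 2 * ‖k‖ ^ 2 - 2 * (a * (τ * ⟪h, k⟫)) + τ ^ 2 * ‖h‖ ^ 2) / a := by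
    field_simp
    ring
  have : 0 ≤ a * ‖k‖ ^ 2 + τ ^ 2 * ‖h‖ ^ 2 / a - 2 * τ * ⟪h, k⟫ := by
    rw [this]; exact div_nonneg h3 ha.le
  linarith

theorem laplace_upper {U : Euc n → ℝ} (hU : Measurable U) {a τ : ℝ} (ha : 0 < a) {S : Set (Euc n)}
    (hS : MeasurableSet S) (hSc : Convex ℝ S)
    (hmid : ∀ x s, 2 * U x + a * ‖s‖ ^ 2 ≤ U (x + s) + U (x - s)) (x h : Euc n) :
    (∫⁻ y in S, ENNReal.ofReal (Real.exp (τ * ⟪x + h, y⟫ - U y))) *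
      (∫⁻ y in S, ENNReal.ofReal (Real.exp (τ * ⟪x - h, y⟫ - U y))) ≤
    (∫⁻ y in S, ENNReal.ofReal (Real.exp (τ * ⟪x, y⟫ - U y))) ^ 2
        * ENNReal.ofReal (Real.exp (τ ^ 2 * ‖h‖ ^ 2 / a)) := by
  have e : (∫⁻ y in S, ENNReal.ofReal (Real.exp (τ * ⟪x, y⟫ - U y))) ^ 2
        * ENNReal.ofReal (Real.exp (τ ^ 2 * ‖h‖ ^ 2 / a)) =
      (∫⁻ y in S, ENNReal.ofReal (Real.exp (τ * ⟪x, y⟫ - U y + τ ^ 2 * ‖h‖ ^ 2 / a / 2))) ^ 2 := by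
    simp only [Real.exp_add, ENNReal.ofReal_mul (Real.exp_pos _).le]
    rw [lintegral_mul_const' _ _ (by simp), mul_pow, ← ENNReal.ofReal_pow (Real.exp_pos _).le,
      ← Real.exp_nat_mul]
    congr 3; push_cast; ring
  rw [e, ← lintegral_indicator hS, ← lintegral_indicator hS, ← lintegral_indicator hS]
  apply pl_euc
  · exact Measurable.indicator (by fun_prop) hS
  · exact Measurable.indicator (by fun_prop) hS
  · exact Measurable.indicator (by fun_prop) hS
  · intro y y'
    by_cases hy : y ∈ S
    swap
    · simp [hy]
    by_cases hy' : y' ∈ S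
    swap
    · simp [hy']
    have hm : (1/2 : ℝ) • (y + y') ∈ S := by
      rw [smul_add]; exact hSc hy hy' (by norm_num) (by norm_num) (by norm_num)
    rw [indicator_of_mem hy, indicator_of_mem hy', indicator_of_mem hm,
      ← ENNReal.ofReal_mul (Real.exp_pos _).le, ← ENNReal.ofReal_pow (Real.exp_pos _).le,
      ← Real.exp_add, ← Real.exp_nat_mul]
    apply ENNReal.ofReal_le_ofReal
    apply Real.exp_le_exp.2
    set z := (1/2 : ℝ) • (y + y') with hz
    set k := (1/2 : ℝ) • (y - y') with hk
    have e1 : y = z + k := by rw [hz, hk]; module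
    have e2 : y' = z - k := by rw [hz, hk]; module
    have h1 := hmid z k
    rw [← e1, ← e2] at h1
    have e3 : ⟪x + h, y⟫ + ⟪x - h, y'⟫ = 2 * ⟪x, z⟫ + 2 * ⟪h, k⟫ := by
      rw [e1, e2]; simp only [inner_add_left, inner_add_right, inner_sub_left, inner_sub_right]; ring
    have h2 := young_inner ha τ h k
    push_cast
    have e4 : τ * ⟪x + h, y⟫ + τ * ⟪x - h, y'⟫ = τ * (2 * ⟪x, z⟫ + 2 * ⟪h, k⟫) := by
      rw [← e3]; ring
    linarith
end

section
open MeasureTheory Metric Set Filter Topology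
open scoped ENNReal RealInnerProductSpace Pointwise
variable {n : ℕ}

theorem subseq_extract (f : ℕ → Euc n → ℝ) (hb : ∀ x, ∃ B, ∀ k, |f k x| ≤ B)
    (hl : ∀ r : ℝ, ∃ M : ℝ, ∀ k x y, ‖x‖ ≤ r → ‖y‖ ≤ r → |f k x - f k y| ≤ M * ‖x - y‖) :
    ∃ σ : ℕ → ℕ, StrictMono σ ∧ ∃ f0 : Euc n → ℝ,
      ∀ x, Tendsto (fun k => f (σ k) x) atTop (𝓝 (f0 x)) := by
  choose B hB using hb
  have hK : IsCompact (Set.univ.pi fun i : ℕ => Icc (-B (TopologicalSpace.denseSeq (Euc n) i))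
      (B (TopologicalSpace.denseSeq (Euc n) i))) := isCompact_univ_pi fun i => isCompact_Icc
  obtain ⟨a, -, σ, hσ, ha⟩ := hK.tendsto_subseq
    (x := fun k i => f k (TopologicalSpace.denseSeq (Euc n) i))
    (fun k i _ => abs_le.1 (hB _ k))
  rw [tendsto_pi_nhds] at ha
  have key : ∀ x, ∃ l, Tendsto (fun k => f (σ k) x) atTop (𝓝 l) := by
    intro x
    apply cauchySeq_tendsto_of_complete
    rw [Metric.cauchySeq_iff]
    intro ε hε
    obtain ⟨M, hM⟩ := hl (‖x‖ + 1)
    have hM1 : 0 < |M| + 1 := by positivity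
    obtain ⟨i, hi⟩ := (TopologicalSpace.denseRange_denseSeq (Euc n)).exists_dist_lt x
      (ε := min 1 (ε / 4 / (|M| + 1))) (by positivity)
    set d := TopologicalSpace.denseSeq (Euc n) i
    have hd1 : ‖x - d‖ < 1 := by
      rw [← dist_eq_norm]; exact lt_of_lt_of_le hi (min_le_left _ _)
    have hd2 : ‖x - d‖ * (|M| + 1) < ε / 4 := by
      rw [← dist_eq_norm, ← lt_div_iff₀ hM1]; exact lt_of_lt_of_le hi (min_le_right _ _)
    have hdn : ‖d‖ ≤ ‖x‖ + 1 := by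
      have : ‖d‖ ≤ ‖x‖ + ‖x - d‖ := by
        have := norm_sub_le x (x - d); simpa using this
      linarith
    have hcl : ∀ k, |f k x - f k d| ≤ ε / 4 := fun k => by
      have h1 := hM k x d (by linarith) hdn
      have h2 : M * ‖x - d‖ ≤ ‖x - d‖ * (|M| + 1) := by
        nlinarith [le_abs_self M, norm_nonneg (x - d)]
      linarith
    obtain ⟨N, hN⟩ := Metric.cauchySeq_iff.1 (ha i).cauchySeq (ε / 4) (by positivity)
    refine ⟨N, fun p hp q hq => ?_⟩
    have h3 := hN p hp q hq
    simp only [Function.comp, Real.dist_eq] at h3 ⊢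
    have h4 := abs_le.1 (hcl (σ p))
    have h5 := abs_le.1 (hcl (σ q))
    have h6 := abs_lt.1 h3
    rw [abs_lt]
    constructor <;> linarith [h4.1, h4.2, h5.1, h5.2, h6.1, h6.2]
  choose f0 hf0 using key
  exact ⟨σ, hσ, f0, hf0⟩

/-- `f` has a subgradient at every point. -/
def HasSub (f : Euc n → ℝ) : Prop := ∀ x, ∃ s : Euc n, ∀ z, f x + ⟪s, z - x⟫ ≤ f z

/-- midpoint semiconcavity. -/
def MidLE (f : Euc n → ℝ) (L : ℝ) : Prop :=
  ∀ x h, f (x + h) + f (x - h) ≤ 2 * f x + L * ‖h‖ ^ 2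

theorem sub_quad {f : Euc n → ℝ} {L : ℝ} (hm : MidLE f L) {x s : Euc n}
    (hs : ∀ z, f x + ⟪s, z - x⟫ ≤ f z) (h : Euc n) : f (x + h) ≤ f x + ⟪s, h⟫ + L * ‖h‖ ^ 2 := by
  have h1 := hm x h
  have h2 := hs (x - h)
  have : x - h - x = -h := by abel
  rw [this, inner_neg_right] at h2
  linarith

theorem hasGradientAt_of_sub {f : Euc n → ℝ} {L : ℝ} (hm : MidLE f L) {x s : Euc n}
    (hs : ∀ z, f x + ⟪s, z - x⟫ ≤ f z) : HasGradientAt f s x := by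
  rw [hasGradientAt_iff_isLittleO]
  have : (fun x' => f x' - f x - ⟪s, x' - x⟫) =O[𝓝 x] fun x' => ‖x' - x‖ ^ 2 := by
    apply Asymptotics.IsBigO.of_bound |L|
    refine .of_forall fun z => ?_
    have h1 := hs z
    have h2 := sub_quad hm hs (z - x)
    rw [add_sub_cancel] at h2
    rw [Real.norm_eq_abs, abs_of_nonneg (by linarith), norm_pow, norm_norm]
    nlinarith [le_abs_self L, sq_nonneg ‖z - x‖]
  refine this.trans_isLittleO ?_
  have h2 : (fun x' : Euc n => ‖x' - x‖ ^ 2) =o[𝓝 x] fun x' => ‖x' - x‖ := by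
    have : Tendsto (fun x' : Euc n => ‖x' - x‖) (𝓝 x) (𝓝 0) := by
      have : Continuous (fun x' : Euc n => ‖x' - x‖) := by fun_prop
      simpa using this.tendsto x
    have h3 := (Asymptotics.isLittleO_pow_id (𝕜 := ℝ) (n := 2) (by norm_num)).comp_tendsto this
    simpa [Function.comp_def] using h3
  simpa using h2.norm_right

theorem sub_unique {f : Euc n → ℝ} {x s g : Euc n}
    (hs : ∀ z, f x + ⟪s, z - x⟫ ≤ f z) (hg : HasGradientAt f g x) : s = g := by
  have hmin : IsLocalMin (fun z => f z - ⟪s, z⟫) x := by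
    refine .of_forall fun z => ?_
    have := hs z
    rw [inner_sub_right] at this
    simp only
    linarith
  have hd : HasFDerivAt (fun z => f z - ⟪s, z⟫) (InnerProductSpace.toDual ℝ _ g - innerSL ℝ s) x :=
    hg.hasFDerivAt.sub (innerSL ℝ s).hasFDerivAt
  have h0 := hmin.hasFDerivAt_eq_zero hd
  have h1 := DFunLike.congr_fun h0 (g - s)
  simp only [sub_apply, InnerProductSpace.toDual_apply_apply, innerSL_apply_apply,
    zero_apply] at h1
  rw [← inner_sub_left, inner_self_eq_zero, sub_eq_zero] at h1
  exact h1.symm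

theorem convex_tangent {f : Euc n → ℝ} (hc : ConvexOn ℝ univ f) {x g : Euc n}
    (hg : HasGradientAt f g x) (z : Euc n) : f x + ⟪g, z - x⟫ ≤ f z := by
  set γ : ℝ → ℝ := fun t => f (x + t • (z - x)) with hγ
  have hγc : ConvexOn ℝ univ γ := by
    have := hc.comp_affineMap (AffineMap.lineMap x z : ℝ →ᵃ[ℝ] Euc n)
    simp only [preimage_univ] at this
    have e : γ = f ∘ (AffineMap.lineMap x z : ℝ →ᵃ[ℝ] Euc n) := by
      ext t
      simp [hγ, AffineMap.lineMap_apply, add_comm]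
    rw [e]; exact this
  have hd : HasDerivAt γ ⟪g, z - x⟫ 0 := by
    have h1 : HasDerivAt (fun t : ℝ => x + t • (z - x)) (z - x) 0 := by
      simpa using ((hasDerivAt_id (0:ℝ)).smul_const (z - x)).const_add x
    have h2 : HasFDerivAt f (InnerProductSpace.toDual ℝ _ g) (x + (0:ℝ) • (z - x)) := by
      simpa using hg.hasFDerivAt
    have h3 := h2.comp_hasDerivAt 0 h1
    rw [InnerProductSpace.toDual_apply_apply] at h3
    exact h3
  have := hγc.le_slope_of_hasDerivAt (x := 0) (y := 1) (mem_univ _) (mem_univ _) one_pos hd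
  simp [slope, hγ] at this
  linarith

theorem grad_cont {f : Euc n → ℝ} {F : Euc n → Euc n} (hF : ∀ x, HasGradientAt f (F x) x)
    (ht : ∀ x z, f x + ⟪F x, z - x⟫ ≤ f z) : Continuous F := by
  have hfc : Continuous f := continuous_iff_continuousAt.2 fun x => (hF x).hasFDerivAt.continuousAt
  rw [Metric.continuous_iff]
  intro x η hη
  have h1 := (hasGradientAt_iff_isLittleO.1 (hF x)).def (show 0 < η / 4 by positivity)
  obtain ⟨t, ht0, h2⟩ := Metric.eventually_nhds_iff.1 h1
  set t' := t / 2
  have ht' : 0 < t' := by positivity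
  have huc : UniformContinuousOn f (closedBall x (t' + 1)) :=
    (isCompact_closedBall x (t' + 1)).uniformContinuousOn_of_continuous hfc.continuousOn
  rw [Metric.uniformContinuousOn_iff] at huc
  obtain ⟨δ, hδ, h3⟩ := huc (η / 4 * t') (by positivity)
  refine ⟨min δ 1, by positivity, fun z hz => ?_⟩
  have hz1 : dist z x < δ := lt_of_lt_of_le hz (min_le_left _ _)
  have hz2 : dist z x < 1 := lt_of_lt_of_le hz (min_le_right _ _)
  by_cases hp : F z = F x
  · simp [hp, hη]
  have hpn : 0 < ‖F z - F x‖ := norm_pos_iff.2 (sub_ne_zero.2 hp)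
  set v := (t' / ‖F z - F x‖) • (F z - F x) with hv
  have hvn : ‖v‖ = t' := by
    rw [hv, norm_smul, Real.norm_eq_abs, abs_of_pos (by positivity)]; field_simp
  have hvi : ⟪F z - F x, v⟫ = t' * ‖F z - F x‖ := by
    rw [hv, real_inner_smul_right, real_inner_self_eq_norm_sq]; field_simp
  have a1 := ht z (z + v)
  rw [add_sub_cancel_left] at a1
  have a2 := h2 (y := x + v) (by simp [dist_eq_norm, hvn]; linarith [show t' = t / 2 from rfl])
  rw [add_sub_cancel_left, hvn, Real.norm_eq_abs] at a2
  have a3 := h3 (z + v) (by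
      rw [mem_closedBall, dist_eq_norm]
      calc ‖z + v - x‖ = ‖v + (z - x)‖ := by congr 1; abel
        _ ≤ ‖v‖ + ‖z - x‖ := norm_add_le _ _
        _ ≤ _ := by rw [hvn, ← dist_eq_norm]; linarith) (x + v) (by
      rw [mem_closedBall, dist_eq_norm, add_sub_cancel_left, hvn]; linarith) (by simpa using hz1)
  have a4 := h3 z (by rw [mem_closedBall]; linarith) x (by simp; linarith) hz1
  rw [Real.dist_eq] at a3 a4
  have b2 := abs_le.1 a2
  have b3 := abs_lt.1 a3
  have b4 := abs_lt.1 a4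
  rw [inner_sub_left] at hvi
  rw [dist_eq_norm]
  have : t' * ‖F z - F x‖ < t' * η := by nlinarith [b2.1, b2.2, b3.1, b3.2, b4.1, b4.2]
  exact lt_of_mul_lt_mul_left this ht'.le

theorem grad_lip {f : Euc n → ℝ} {F : Euc n → Euc n} {L : ℝ} (hL : 0 < L) (hm : MidLE f L)
    (ht : ∀ x z, f x + ⟪F x, z - x⟫ ≤ f z) (x y : Euc n) : ‖F x - F y‖ ≤ L * ‖x - y‖ := by
  have q : ∀ k : ℕ, ∀ x h, f (x + h) ≤ f x + ⟪F x, h⟫ + (1 / 2 + (1 / 2) ^ k) * L * ‖h‖ ^ 2 := by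
    intro k
    induction k with
    | zero =>
      intro x h
      have := sub_quad hm (ht x) h
      have : 0 ≤ L * ‖h‖ ^ 2 := by positivity
      norm_num
      linarith
    | succ k ih =>
      intro x h
      have h1 := ih x ((1 / 2 : ℝ) • h)
      have h2 := hm (x + (1 / 2 : ℝ) • h) ((1 / 2 : ℝ) • h)
      have e1 : x + (1 / 2 : ℝ) • h + (1 / 2 : ℝ) • h = x + h := by module
      have e2 : x + (1 / 2 : ℝ) • h - (1 / 2 : ℝ) • h = x := by module
      have e3 : ‖(1 / 2 : ℝ) • h‖ ^ 2 = 1 / 4 * ‖h‖ ^ 2 := by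
        rw [norm_smul, mul_pow]; norm_num
      rw [e1, e2, e3] at h2
      rw [e3, real_inner_smul_right] at h1
      rw [pow_succ]
      linarith
  have q' : ∀ x h, f (x + h) ≤ f x + ⟪F x, h⟫ + 1 / 2 * L * ‖h‖ ^ 2 := by
    intro x h
    have hl : Tendsto (fun k : ℕ => f x + ⟪F x, h⟫ + (1 / 2 + (1 / 2 : ℝ) ^ k) * L * ‖h‖ ^ 2) atTop
        (𝓝 (f x + ⟪F x, h⟫ + (1 / 2 + 0) * L * ‖h‖ ^ 2)) := by
      have := tendsto_pow_atTop_nhds_zero_of_lt_one (r := (1/2 : ℝ)) (by norm_num) (by norm_num)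
      exact (((this.const_add _).mul_const _).mul_const _).const_add _
    rw [add_zero] at hl
    exact ge_of_tendsto hl (.of_forall fun k => q k x h)
  have bh : ∀ x y, f x + ⟪F x, y - x⟫ + ‖F y - F x‖ ^ 2 / (2 * L) ≤ f y := by
    intro x y
    set p := F y - F x with hp
    have h1 := ht x (y + (-(1 / L)) • p)
    have h2 := q' y ((-(1 / L)) • p)
    have e1 : y + (-(1 / L)) • p - x = (y - x) + (-(1 / L)) • p := by abel
    rw [e1, inner_add_right, real_inner_smul_right] at h1
    rw [norm_smul, mul_pow, real_inner_smul_right] at h2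
    have e2 : ⟪F y, p⟫ - ⟪F x, p⟫ = ‖p‖ ^ 2 := by
      rw [← inner_sub_left, ← hp, real_inner_self_eq_norm_sq]
    have e3 : 1 / 2 * L * (‖-(1 / L)‖ ^ 2 * ‖p‖ ^ 2) = ‖p‖ ^ 2 / (2 * L) := by
      rw [Real.norm_eq_abs, sq_abs]; field_simp
    have e4 : 1 / L * ‖p‖ ^ 2 = 2 * (‖p‖ ^ 2 / (2 * L)) := by field_simp
    rw [e3] at h2
    have e5 : 1 / L * ⟪F y, p⟫ - 1 / L * ⟪F x, p⟫ = 1 / L * ‖p‖ ^ 2 := by rw [← e2]; ring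
    linarith
  have h1 := bh x y
  have h2 := bh y x
  rw [norm_sub_rev] at h1
  have h3 : ⟪F x - F y, x - y⟫ ≤ ‖F x - F y‖ * ‖x - y‖ := real_inner_le_norm _ _
  have e1 : ⟪F x, y - x⟫ = - ⟪F x, x - y⟫ := by rw [← inner_neg_right, neg_sub]
  rw [inner_sub_left] at h3
  have e4 : ‖F x - F y‖ ^ 2 / (2 * L) + ‖F x - F y‖ ^ 2 / (2 * L) = ‖F x - F y‖ ^ 2 / L := by
    field_simp; ring
  have h4 : ‖F x - F y‖ ^ 2 / L ≤ ‖F x - F y‖ * ‖x - y‖ := by linarith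
  rw [div_le_iff₀ hL] at h4
  by_cases h0 : ‖F x - F y‖ = 0
  · rw [h0]; positivity
  have h5 : 0 < ‖F x - F y‖ := lt_of_le_of_ne (norm_nonneg _) (Ne.symm h0)
  have : ‖F x - F y‖ * ‖F x - F y‖ ≤ ‖F x - F y‖ * (L * ‖x - y‖) := by nlinarith
  exact le_of_mul_le_mul_left this h5

theorem hasSub_limit {f : ℕ → Euc n → ℝ} {f0 : Euc n → ℝ} (hs : ∀ k, HasSub (f k))
    (hlim : ∀ x, Tendsto (fun k => f k x) atTop (𝓝 (f0 x)))
    (hb : ∀ r : ℝ, ∃ M : ℝ, ∀ k x, ‖x‖ ≤ r → |f k x| ≤ M) : HasSub f0 := by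
  intro x
  choose s hs using fun k => hs k x
  obtain ⟨M, hM⟩ := hb (‖x‖ + 1)
  have hsb : ∀ k, s k ∈ closedBall (0 : Euc n) (2 * M) := by
    intro k
    rw [mem_closedBall_zero_iff]
    have hM0 : 0 ≤ M := (abs_nonneg _).trans (hM k x (by linarith))
    by_cases h0 : s k = 0
    · rw [h0]; simpa using hM0
    have hp : 0 < ‖s k‖ := norm_pos_iff.2 h0
    set v := (1 / ‖s k‖) • s k with hv
    have hvn : ‖v‖ = 1 := by
      rw [hv, norm_smul, Real.norm_eq_abs, abs_of_pos (by positivity)]; field_simp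
    have h1 := hs k (x + v)
    rw [add_sub_cancel_left, hv, real_inner_smul_right, real_inner_self_eq_norm_sq, ← hv] at h1
    have e : 1 / ‖s k‖ * ‖s k‖ ^ 2 = ‖s k‖ := by field_simp
    have h2 := abs_le.1 (hM k x (by linarith))
    have h3 := abs_le.1 (hM k (x + v) (by have := norm_add_le x v; linarith))
    linarith [h2.1, h2.2, h3.1, h3.2]
  obtain ⟨a, -, σ, hσ, ha⟩ := (isCompact_closedBall (0 : Euc n) (2 * M)).tendsto_subseq hsb
  refine ⟨a, fun z => ?_⟩
  have h1 := ((hlim x).comp hσ.tendsto_atTop).add (ha.inner (tendsto_const_nhds (x := z - x)))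
  exact le_of_tendsto_of_tendsto' h1 ((hlim z).comp hσ.tendsto_atTop) fun k => hs _ z

theorem exists_pos_near {d : Euc n → ℝ} {x0 v : Euc n} (hd : HasGradientAt d v x0) (hv : v ≠ 0)
    (h0 : d x0 = 0) {U : Set (Euc n)} (hU : U ∈ 𝓝 x0) : ∃ x ∈ U, 0 < d x := by
  by_contra! h
  have hmax : IsLocalMax d x0 := by
    filter_upwards [hU] with x hx
    rw [h0]; exact h x hx
  have := hmax.hasFDerivAt_eq_zero hd.hasFDerivAt
  exact hv (by simpa using this)

theorem brenier_unique {μ : Measure (Euc n)} [IsFiniteMeasure μ] [μ.IsOpenPosMeasure]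
    {f g : Euc n → ℝ} {F G : Euc n → Euc n}
    (hF : ∀ x, HasGradientAt f (F x) x) (hG : ∀ x, HasGradientAt g (G x) x)
    (hFt : ∀ x z, f x + ⟪F x, z - x⟫ ≤ f z) (hGt : ∀ x z, g x + ⟪G x, z - x⟫ ≤ g z)
    (hmap : μ.map F = μ.map G) : F = G := by
  have hFc := grad_cont hF hFt
  have hGc := grad_cont hG hGt
  have hfc : Continuous f := continuous_iff_continuousAt.2 fun x => (hF x).hasFDerivAt.continuousAt
  have hgc : Continuous g := continuous_iff_continuousAt.2 fun x => (hG x).hasFDerivAt.continuousAt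
  funext x0
  by_contra hne
  set M : Set (Euc n) := {x | 0 < (f x - f x0) - (g x - g x0)} with hMdef
  have hMo : IsOpen M := isOpen_lt continuous_const (by fun_prop)
  have hA : MeasurableSet (F '' M) := by
    obtain ⟨C, hC1, -, hC3, -⟩ := IsOpen.exists_iUnion_isClosed hMo
    obtain ⟨K, hKc, hK⟩ : IsSigmaCompact M := by
      rw [← hC3]
      exact isSigmaCompact_iUnion C fun i => isSigmaCompact_univ.of_isClosed_subset (hC1 i) (subset_univ _)
    rw [← hK, image_iUnion]
    exact MeasurableSet.iUnion fun i => ((hKc i).image hFc).measurableSet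
  obtain ⟨w, -, hw⟩ : ∃ w ∈ univ, 0 < ⟪G x0, w - x0⟫ - (f w - f x0) := by
    apply exists_pos_near (x0 := x0) (v := G x0 - F x0) ?_ (sub_ne_zero.2 (Ne.symm hne)) (by simp)
      univ_mem
    have h1 : HasGradientAt (fun w => ⟪G x0, w - x0⟫) (G x0) x0 := by
      have : HasFDerivAt (fun w => ⟪G x0, w - x0⟫) (innerSL ℝ (G x0)) x0 := by
        have h3 := (innerSL ℝ (G x0)).hasFDerivAt.comp x0 ((hasFDerivAt_id x0).sub_const x0)
        rw [ContinuousLinearMap.comp_id] at h3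
        exact h3
      exact this
    have h2 : HasFDerivAt (fun w => ⟪G x0, w - x0⟫ - (f w - f x0))
      (InnerProductSpace.toDual ℝ _ (G x0) - InnerProductSpace.toDual ℝ _ (F x0)) x0 :=
      h1.hasFDerivAt.sub ((hF x0).hasFDerivAt.sub_const _)
    rw [← map_sub] at h2
    exact h2
  set U : Set (Euc n) := {z | f w - f x0 < (g z - g x0) + ⟪G z, w - z⟫} with hUdef
  have hUo : IsOpen U := isOpen_lt continuous_const (by fun_prop)
  have hx0U : x0 ∈ U := by simp [hUdef]; linarith
  obtain ⟨x1, hx1U, hx1⟩ : ∃ x ∈ U, 0 < (f x - f x0) - (g x - g x0) := by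
    apply exists_pos_near (x0 := x0) (v := F x0 - G x0) ?_ (sub_ne_zero.2 hne) (by simp)
      (hUo.mem_nhds hx0U)
    have h2 : HasFDerivAt (fun x => (f x - f x0) - (g x - g x0))
      (InnerProductSpace.toDual ℝ _ (F x0) - InnerProductSpace.toDual ℝ _ (G x0)) x0 :=
      ((hF x0).hasFDerivAt.sub_const _).sub ((hG x0).hasFDerivAt.sub_const _)
    rw [← map_sub] at h2
    exact h2
  have hsub : G ⁻¹' (F '' M) ⊆ M \ U := by
    rintro z ⟨x, hxM, hxz⟩
    have hx : 0 < (f x - f x0) - (g x - g x0) := hxM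
    constructor
    · show 0 < (f z - f x0) - (g z - g x0)
      have h1 := hFt x z
      have h2 := hGt z x
      rw [← hxz] at h2
      have : ⟪F x, x - z⟫ = - ⟪F x, z - x⟫ := by rw [← inner_neg_right, neg_sub]
      linarith
    · intro (hzU : f w - f x0 < (g z - g x0) + ⟪G z, w - z⟫)
      have h1 := hFt x w
      have h2 := hGt z x
      rw [← hxz] at h2 hzU
      have : ⟪F x, w - z⟫ = ⟪F x, w - x⟫ + ⟪F x, x - z⟫ := by rw [← inner_add_right]; congr 1; abel
      linarith
  have h1 : μ M ≤ μ (M \ U) := by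
    calc μ M ≤ μ (F ⁻¹' (F '' M)) := measure_mono (subset_preimage_image F M)
      _ = μ.map F (F '' M) := (Measure.map_apply hFc.measurable hA).symm
      _ = μ (G ⁻¹' (F '' M)) := by rw [hmap, Measure.map_apply hGc.measurable hA]
      _ ≤ _ := measure_mono hsub
  have h2 : μ (M ∩ U) + μ (M \ U) = μ M := measure_inter_add_sdiff _ hUo.measurableSet
  have h3 : 0 < μ (M ∩ U) := (hMo.inter hUo).measure_pos μ ⟨x1, hx1, hx1U⟩
  have h4 : μ (M \ U) ≠ ⊤ := measure_ne_top _ _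
  have : μ (M \ U) < μ (M ∩ U) + μ (M \ U) := by
    rw [add_comm]; exact ENNReal.lt_add_right h4 h3.ne'
  rw [h2] at this
  exact absurd h1 (not_le.2 this)
end

section
open MeasureTheory Metric Set Filter Topology
open scoped ENNReal RealInnerProductSpace Pointwise
variable {n : ℕ}

/-- The class of admissible potentials: normalized, `K`-Lipschitz, semiconcave. -/
structure InK (K κ : ℝ) (Φ : Euc n → ℝ) : Prop where
  zero : Φ 0 = 0
  lip : ∀ x y, |Φ x - Φ y| ≤ K * ‖x - y‖
  mid : MidLE Φ κ

theorem InK.cont {K κ : ℝ} {Φ : Euc n → ℝ} (h : InK K κ Φ) : Continuous Φ := by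
  have : LipschitzWith (Real.toNNReal K) Φ := by
    apply LipschitzWith.of_dist_le_mul
    intro x y
    rw [Real.dist_eq, dist_eq_norm]
    refine (h.lip x y).trans ?_
    gcongr
    exact Real.le_coe_toNNReal K
  exact this.continuous

theorem InK.abs_le {K κ : ℝ} {Φ : Euc n → ℝ} (h : InK K κ Φ) (x : Euc n) : |Φ x| ≤ K * ‖x‖ := by
  have := h.lip x 0
  simpa [h.zero] using this

/-- soft conjugate on the first side. -/
def softA (μ : Measure (Euc n)) (τ : ℝ) (Φ : Euc n → ℝ) (y : Euc n) : ℝ :=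
  Real.log (∫ x, Real.exp (τ * ⟪x, y⟫ - Φ x) ∂μ)

/-- soft conjugate on the second side. -/
def softB (ν : Measure (Euc n)) (τ : ℝ) (Ψ : Euc n → ℝ) (x : Euc n) : ℝ :=
  Real.log (∫ y, Real.exp (τ * ⟪x, y⟫ - Ψ y) ∂ν)

section
variable {μ ν : Measure (Euc n)} [IsProbabilityMeasure μ] [IsProbabilityMeasure ν]
  {τ R κ : ℝ}

theorem inner_bd (hτ : 0 ≤ τ) {x y : Euc n} (hy : ‖y‖ ≤ R) : |τ * ⟪x, y⟫| ≤ τ * R * ‖x‖ := by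
  rw [abs_mul, abs_of_nonneg hτ, mul_assoc]
  apply mul_le_mul_of_nonneg_left _ hτ
  refine (abs_real_inner_le_norm x y).trans ?_
  nlinarith [norm_nonneg x]

theorem intA (hμ : ∀ t : ℝ, Integrable (fun x => Real.exp (t * ‖x‖)) μ) (hτ : 0 ≤ τ)
    {Φ : Euc n → ℝ} (hΦ : InK (τ * R) κ Φ) (y : Euc n) :
    Integrable (fun x => Real.exp (τ * ⟪x, y⟫ - Φ x)) μ := by
  have hc := hΦ.cont
  refine (hμ (τ * ‖y‖ + τ * R)).mono' (by fun_prop) (.of_forall fun x => ?_)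
  rw [Real.norm_eq_abs, abs_of_pos (Real.exp_pos _)]
  apply Real.exp_le_exp.2
  have h1 := abs_le.1 (inner_bd hτ (x := x) (y := y) le_rfl)
  have h2 := abs_le.1 (hΦ.abs_le x)
  linarith [h1.2, h2.1]

theorem measA {Φ : Euc n → ℝ} (hΦ : Measurable Φ) : Measurable (softA μ τ Φ) := by
  apply Real.measurable_log.comp
  refine (StronglyMeasurable.integral_prod_right (f := fun y x => Real.exp (τ * ⟪x, y⟫ - Φ x)) ?_).measurable
  apply Measurable.stronglyMeasurable
  unfold Function.uncurry
  fun_prop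

theorem expA (hμ : ∀ t : ℝ, Integrable (fun x => Real.exp (t * ‖x‖)) μ) (hτ : 0 ≤ τ)
    {Φ : Euc n → ℝ} (hΦ : InK (τ * R) κ Φ) (y : Euc n) :
    Real.exp (softA μ τ Φ y) = ∫ x, Real.exp (τ * ⟪x, y⟫ - Φ x) ∂μ :=
  Real.exp_log (integral_exp_pos (intA hμ hτ hΦ y))

theorem bddA (hμ : ∀ t : ℝ, Integrable (fun x => Real.exp (t * ‖x‖)) μ) (hτ : 0 ≤ τ) (R κ : ℝ) :
    ∃ D : ℝ, ∀ Φ : Euc n → ℝ, InK (τ * R) κ Φ → ∀ y, ‖y‖ ≤ R → |softA μ τ Φ y| ≤ D := by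
  set m1 := ∫ x, Real.exp ((-(2 * (τ * R))) * ‖x‖) ∂μ
  set m2 := ∫ x, Real.exp ((2 * (τ * R)) * ‖x‖) ∂μ
  have hm1 : 0 < m1 := integral_exp_pos (hμ _)
  refine ⟨max |Real.log m1| |Real.log m2|, fun Φ hΦ y hy => ?_⟩
  apply abs_le_max_abs_abs
  · apply Real.log_le_log hm1
    apply integral_mono (hμ _) (intA hμ hτ hΦ y)
    intro x
    apply Real.exp_le_exp.2
    have h1 := abs_le.1 (inner_bd hτ (x := x) hy)
    have h2 := abs_le.1 (hΦ.abs_le x)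
    linarith [h1.1, h2.2]
  · apply Real.log_le_log (integral_exp_pos (intA hμ hτ hΦ y))
    apply integral_mono (intA hμ hτ hΦ y) (hμ _)
    intro x
    apply Real.exp_le_exp.2
    have h1 := abs_le.1 (inner_bd hτ (x := x) hy)
    have h2 := abs_le.1 (hΦ.abs_le x)
    linarith [h1.2, h2.1]

theorem intB (hμ : ∀ t : ℝ, Integrable (fun x => Real.exp (t * ‖x‖)) μ) (hτ : 0 ≤ τ)
    (hν : ∀ᵐ y ∂ν, ‖y‖ ≤ R) {Φ : Euc n → ℝ} (hΦ : InK (τ * R) κ Φ) (x : Euc n) :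
    Integrable (fun y => Real.exp (τ * ⟪x, y⟫ - softA μ τ Φ y)) ν := by
  obtain ⟨D, hD⟩ := bddA hμ hτ R κ
  have hm := measA (μ := μ) (τ := τ) hΦ.cont.measurable
  refine (integrable_const (Real.exp (τ * R * ‖x‖ + D))).mono' (by fun_prop) ?_
  filter_upwards [hν] with y hy
  rw [Real.norm_eq_abs, abs_of_pos (Real.exp_pos _)]
  apply Real.exp_le_exp.2
  have h1 := abs_le.1 (inner_bd hτ (x := x) hy)
  have h2 := abs_le.1 (hD Φ hΦ y hy)
  linarith [h1.2, h2.1]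

theorem expB (hμ : ∀ t : ℝ, Integrable (fun x => Real.exp (t * ‖x‖)) μ) (hτ : 0 ≤ τ)
    (hν : ∀ᵐ y ∂ν, ‖y‖ ≤ R) {Φ : Euc n → ℝ} (hΦ : InK (τ * R) κ Φ) (x : Euc n) :
    Real.exp (softB ν τ (softA μ τ Φ) x) = ∫ y, Real.exp (τ * ⟪x, y⟫ - softA μ τ Φ y) ∂ν :=
  Real.exp_log (integral_exp_pos (intB hμ hτ hν hΦ x))

theorem lipB (hμ : ∀ t : ℝ, Integrable (fun x => Real.exp (t * ‖x‖)) μ) (hτ : 0 ≤ τ)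
    (hν : ∀ᵐ y ∂ν, ‖y‖ ≤ R) {Φ : Euc n → ℝ} (hΦ : InK (τ * R) κ Φ) (x x' : Euc n) :
    |softB ν τ (softA μ τ Φ) x - softB ν τ (softA μ τ Φ) x'| ≤ τ * R * ‖x - x'‖ := by
  have key : ∀ x x', softB ν τ (softA μ τ Φ) x ≤ softB ν τ (softA μ τ Φ) x' + τ * R * ‖x - x'‖ := by
    intro x x'
    rw [← Real.exp_le_exp, Real.exp_add, expB hμ hτ hν hΦ, expB hμ hτ hν hΦ, ← integral_mul_const]
    apply integral_mono_ae (intB hμ hτ hν hΦ x) ((intB hμ hτ hν hΦ x').mul_const _)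
    filter_upwards [hν] with y hy
    rw [← Real.exp_add]
    apply Real.exp_le_exp.2
    have h1 := abs_le.1 (inner_bd hτ (x := x - x') hy)
    rw [inner_sub_left] at h1
    linarith [h1.2]
  rw [abs_le]
  have h1 := key x x'
  have h2 := key x' x
  rw [norm_sub_rev] at h2
  constructor <;> linarith

theorem intPhi (hμ : ∀ t : ℝ, Integrable (fun x => Real.exp (t * ‖x‖)) μ) {K : ℝ}
    {Φ : Euc n → ℝ} (hΦ : InK K κ Φ) : Integrable Φ μ := by
  refine (hμ K).mono' hΦ.cont.aestronglyMeasurable (.of_forall fun x => ?_)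
  rw [Real.norm_eq_abs]
  refine (hΦ.abs_le x).trans ?_
  linarith [Real.add_one_le_exp (K * ‖x‖)]

theorem intPsi (hμ : ∀ t : ℝ, Integrable (fun x => Real.exp (t * ‖x‖)) μ) (hτ : 0 ≤ τ)
    (hν : ∀ᵐ y ∂ν, ‖y‖ ≤ R) {Φ : Euc n → ℝ} (hΦ : InK (τ * R) κ Φ) :
    Integrable (softA μ τ Φ) ν := by
  obtain ⟨D, hD⟩ := bddA hμ hτ R κ
  refine (integrable_const D).mono' (measA hΦ.cont.measurable).aestronglyMeasurable ?_
  filter_upwards [hν] with y hy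
  exact hD Φ hΦ y hy

theorem intProd (hμ : ∀ t : ℝ, Integrable (fun x => Real.exp (t * ‖x‖)) μ) (hτ : 0 ≤ τ)
    (hν : ∀ᵐ y ∂ν, ‖y‖ ≤ R) {Φ Φ2 : Euc n → ℝ} (hΦ : InK (τ * R) κ Φ) (hΦ2 : InK (τ * R) κ Φ2) :
    Integrable (fun p : Euc n × Euc n => Real.exp (τ * ⟪p.1, p.2⟫ - Φ2 p.1 - softA μ τ Φ p.2))
      (μ.prod ν) := by
  obtain ⟨D, hD⟩ := bddA hμ hτ R κ
  have hm := measA (μ := μ) (τ := τ) hΦ.cont.measurable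
  have hm2 := hΦ2.cont.measurable
  refine (((hμ (2 * (τ * R))).mul_const (Real.exp D)).comp_fst ν).mono' (by fun_prop) ?_
  have hν' : ∀ᵐ p ∂(μ.prod ν), ‖p.2‖ ≤ R := Measure.quasiMeasurePreserving_snd.ae hν
  filter_upwards [hν'] with p hp
  rw [Real.norm_eq_abs, abs_of_pos (Real.exp_pos _), ← Real.exp_add]
  apply Real.exp_le_exp.2
  have h1 := abs_le.1 (inner_bd hτ (x := p.1) hp)
  have h2 := abs_le.1 (hD Φ hΦ p.2 hp)
  have h3 := abs_le.1 (hΦ2.abs_le p.1)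
  linarith [h1.2, h2.1, h3.1]

/-- the dual functional -/
def dualJ (μ ν : Measure (Euc n)) (τ : ℝ) (Φ : Euc n → ℝ) : ℝ :=
  ∫ x, Φ x ∂μ + ∫ y, softA μ τ Φ y ∂ν

theorem exists_min (hμ : ∀ t : ℝ, Integrable (fun x => Real.exp (t * ‖x‖)) μ) (hτ : 0 ≤ τ)
    (hR : 0 ≤ R) (hκ : 0 ≤ κ) (hν : ∀ᵐ y ∂ν, ‖y‖ ≤ R) :
    ∃ Φ : Euc n → ℝ, InK (τ * R) κ Φ ∧ ∀ Φ' : Euc n → ℝ, InK (τ * R) κ Φ' →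
      dualJ μ ν τ Φ ≤ dualJ μ ν τ Φ' := by
  obtain ⟨D, hD⟩ := bddA hμ hτ R κ
  set S : Set ℝ := dualJ μ ν τ '' {Φ | InK (τ * R) κ Φ} with hS
  have hne : S.Nonempty := by
    refine ⟨_, fun _ => 0, ⟨rfl, fun x y => ?_, fun x h => ?_⟩, rfl⟩
    · simp; positivity
    · simp; positivity
  have hInt1 : Integrable (fun x : Euc n => τ * R * ‖x‖) μ := by
    refine (hμ (τ * R)).mono' (by fun_prop) (.of_forall fun x => ?_)
    rw [Real.norm_eq_abs, abs_of_nonneg (by positivity)]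
    linarith [Real.add_one_le_exp (τ * R * ‖x‖)]
  have hbdd : BddBelow S := by
    refine ⟨(∫ x, -(τ * R * ‖x‖) ∂μ) + ∫ y, (-D) ∂ν, ?_⟩
    rintro _ ⟨Φ, hΦ, rfl⟩
    apply add_le_add
    · exact integral_mono hInt1.neg (intPhi hμ hΦ) fun x => (abs_le.1 (hΦ.abs_le x)).1
    · apply integral_mono_ae (integrable_const _) (intPsi hμ hτ hν hΦ)
      filter_upwards [hν] with y hy
      exact (abs_le.1 (hD Φ hΦ y hy)).1
  obtain ⟨u, -, hu, huS⟩ := exists_seq_tendsto_sInf hne hbdd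
  choose f hf hfu using huS
  obtain ⟨σ, hσ, f0, hf0⟩ := subseq_extract f (fun x => ⟨_, fun k => (hf k).abs_le x⟩)
    (fun r => ⟨τ * R, fun k x y _ _ => (hf k).lip x y⟩)
  have hK0 : InK (τ * R) κ f0 := by
    refine ⟨?_, fun x y => ?_, fun x h => ?_⟩
    · refine tendsto_nhds_unique (hf0 0) ?_
      simp only [(hf _).zero]; exact tendsto_const_nhds
    · exact le_of_tendsto ((hf0 x).sub (hf0 y)).abs (.of_forall fun k => (hf _).lip x y)
    · exact le_of_tendsto_of_tendsto' ((hf0 (x + h)).add (hf0 (x - h)))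
        (((hf0 x).const_mul 2).add_const _) fun k => (hf _).mid x h
  refine ⟨f0, hK0, fun Φ' hΦ' => ?_⟩
  have l1 : Tendsto (fun k => ∫ x, f (σ k) x ∂μ) atTop (𝓝 (∫ x, f0 x ∂μ)) := by
    apply tendsto_integral_of_dominated_convergence (fun x => τ * R * ‖x‖)
    · exact fun k => (hf _).cont.aestronglyMeasurable
    · exact hInt1
    · exact fun k => .of_forall fun x => (hf _).abs_le x
    · exact .of_forall hf0
  have l2 : ∀ y, Tendsto (fun k => softA μ τ (f (σ k)) y) atTop (𝓝 (softA μ τ f0 y)) := by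
    intro y
    apply Tendsto.log _ (integral_exp_pos (intA hμ hτ hK0 y)).ne'
    apply tendsto_integral_of_dominated_convergence (fun x => Real.exp ((τ * ‖y‖ + τ * R) * ‖x‖))
    · exact fun k => (intA hμ hτ (hf _) y).aestronglyMeasurable
    · exact hμ _
    · refine fun k => .of_forall fun x => ?_
      rw [Real.norm_eq_abs, abs_of_pos (Real.exp_pos _)]
      apply Real.exp_le_exp.2
      have h1 := abs_le.1 (inner_bd hτ (x := x) (y := y) le_rfl)
      have h2 := abs_le.1 ((hf (σ k)).abs_le x)
      linarith [h1.2, h2.1]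
    · exact .of_forall fun x => (Real.continuous_exp.tendsto _).comp ((hf0 x).const_sub _)
  have l3 : Tendsto (fun k => ∫ y, softA μ τ (f (σ k)) y ∂ν) atTop (𝓝 (∫ y, softA μ τ f0 y ∂ν)) := by
    apply tendsto_integral_of_dominated_convergence (fun x => D)
    · exact fun k => (measA (hf _).cont.measurable).aestronglyMeasurable
    · exact integrable_const _
    · intro k
      filter_upwards [hν] with y hy
      exact hD _ (hf _) y hy
    · exact .of_forall l2
  have l4 : Tendsto (fun k => dualJ μ ν τ (f (σ k))) atTop (𝓝 (dualJ μ ν τ f0)) := l1.add l3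
  have l5 : Tendsto (fun k => dualJ μ ν τ (f (σ k))) atTop (𝓝 (sInf S)) := by
    simp only [hfu]; exact hu.comp hσ.tendsto_atTop
  rw [tendsto_nhds_unique l4 l5]
  exact csInf_le hbdd ⟨Φ', hΦ', rfl⟩

theorem schro_exists [μ.IsOpenPosMeasure]
    (hμ : ∀ t : ℝ, Integrable (fun x => Real.exp (t * ‖x‖)) μ) (hτ : 0 ≤ τ)
    (hR : 0 ≤ R) (hκ : 0 ≤ κ) (hν : ∀ᵐ y ∂ν, ‖y‖ ≤ R)
    (hinv : ∀ Φ : Euc n → ℝ, InK (τ * R) κ Φ → MidLE (softB ν τ (softA μ τ Φ)) κ) :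
    ∃ Φ : Euc n → ℝ, InK (τ * R) κ Φ ∧ softB ν τ (softA μ τ Φ) = Φ := by
  obtain ⟨Φ, hΦ, hmin⟩ := exists_min hμ hτ hR hκ hν
  refine ⟨Φ, hΦ, ?_⟩
  set Ψ := softA μ τ Φ with hΨ
  set Φ' := softB ν τ Ψ with hΦ'
  set c := Φ' 0 with hc
  have hK1 : InK (τ * R) κ (fun x => Φ' x - c) := by
    refine ⟨by simp [hc], fun x y => ?_, fun x h => ?_⟩
    · simpa using lipB hμ hτ hν hΦ x y
    · have := hinv Φ hΦ x h
      simp only [← hΨ, ← hΦ'] at this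
      linarith
  have hΦ'c : Continuous Φ' := by
    have e : Φ' = fun x => (Φ' x - c) + c := by ext x; ring
    rw [e]; exact hK1.cont.add continuous_const
  have hInt' : Integrable Φ' μ := by
    have e : Φ' = fun x => (Φ' x - c) + c := by ext x; ring
    rw [e]; exact (intPhi hμ hK1).add (integrable_const c)
  have hP1 := intProd hμ hτ hν hΦ hK1
  have e1 : ∫ y, Real.exp (softA μ τ (fun x => Φ' x - c) y - Ψ y) ∂ν = Real.exp c := by
    have : ∀ y, Real.exp (softA μ τ (fun x => Φ' x - c) y - Ψ y) =
        ∫ x, Real.exp (τ * ⟪x, y⟫ - (Φ' x - c) - Ψ y) ∂μ := by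
      intro y
      rw [sub_eq_add_neg, Real.exp_add, expA hμ hτ hK1, ← integral_mul_const]
      congr 1; ext x; rw [← Real.exp_add]; ring_nf
    simp only [this]
    rw [← integral_integral_swap (f := fun x y => Real.exp (τ * ⟪x, y⟫ - (Φ' x - c) - Ψ y)) hP1]
    have : ∀ x, ∫ y, Real.exp (τ * ⟪x, y⟫ - (Φ' x - c) - Ψ y) ∂ν = Real.exp c := by
      intro x
      have h2 : ∀ y, Real.exp (τ * ⟪x, y⟫ - (Φ' x - c) - Ψ y) =
          Real.exp (c - Φ' x) * Real.exp (τ * ⟪x, y⟫ - Ψ y) := by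
        intro y; rw [← Real.exp_add]; ring_nf
      simp only [h2]
      rw [integral_const_mul, hΨ, ← expB hμ hτ hν hΦ, ← Real.exp_add]
      simp [← hΨ, ← hΦ']
    simp [this]
  have hP2 := intProd hμ hτ hν hΦ hΦ
  have e2' : ∀ x, Real.exp (Φ' x - Φ x) = ∫ y, Real.exp (τ * ⟪x, y⟫ - Φ x - Ψ y) ∂ν := by
    intro x
    rw [sub_eq_add_neg, Real.exp_add, expB hμ hτ hν hΦ, ← integral_mul_const]
    congr 1; ext y; rw [← Real.exp_add, ← hΨ]; ring_nf
  have e2 : ∫ x, Real.exp (Φ' x - Φ x) ∂μ = 1 := by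
    simp only [e2']
    rw [integral_integral_swap (f := fun x y => Real.exp (τ * ⟪x, y⟫ - Φ x - Ψ y)) hP2]
    have : ∀ y, ∫ x, Real.exp (τ * ⟪x, y⟫ - Φ x - Ψ y) ∂μ = 1 := by
      intro y
      have h2 : ∀ x, Real.exp (τ * ⟪x, y⟫ - Φ x - Ψ y) =
          Real.exp (- Ψ y) * Real.exp (τ * ⟪x, y⟫ - Φ x) := by
        intro x; rw [← Real.exp_add]; ring_nf
      simp only [h2]
      rw [integral_const_mul, ← expA hμ hτ hΦ, ← Real.exp_add]
      simp [← hΨ]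
    simp [this]
  have hIntE : Integrable (fun x => Real.exp (Φ' x - Φ x)) μ := by
    have := hP2.integral_prod_left
    simp only [e2']; exact this
  have hIntE1 : Integrable (fun y => Real.exp (softA μ τ (fun x => Φ' x - c) y - Ψ y)) ν := by
    by_contra h
    rw [integral_undef h] at e1
    exact (Real.exp_pos c).ne e1
  have i1 : ∫ y, (softA μ τ (fun x => Φ' x - c) y - Ψ y) ∂ν ≤ c := by
    have h1 : ∫ y, (softA μ τ (fun x => Φ' x - c) y - Ψ y) ∂ν ≤
        ∫ y, (Real.exp (softA μ τ (fun x => Φ' x - c) y - Ψ y) * Real.exp (-c) + (c - 1)) ∂ν := by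
      apply integral_mono ((intPsi hμ hτ hν hK1).sub (intPsi hμ hτ hν hΦ))
        ((hIntE1.mul_const _).add (integrable_const _))
      intro y
      change softA μ τ (fun x => Φ' x - c) y - Ψ y ≤
        Real.exp (softA μ τ (fun x => Φ' x - c) y - Ψ y) * Real.exp (-c) + (c - 1)
      rw [← Real.exp_add]
      linarith [Real.add_one_le_exp (softA μ τ (fun x => Φ' x - c) y - Ψ y + -c)]
    rw [integral_add (hIntE1.mul_const _) (integrable_const _), integral_mul_const, e1,
      ← Real.exp_add] at h1
    simpa using h1
  have i2 := hmin _ hK1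
  unfold dualJ at i2
  rw [integral_sub (intPsi hμ hτ hν hK1) (intPsi hμ hτ hν hΦ)] at i1
  rw [integral_sub hInt' (integrable_const _)] at i2
  simp only [integral_const, probReal_univ, smul_eq_mul, one_mul] at i2
  have A1 : Integrable (fun x => Real.exp (Φ' x - Φ x) - 1) μ := hIntE.sub (integrable_const _)
  have A2 : Integrable (fun x => Φ' x - Φ x) μ := hInt'.sub (intPhi hμ hΦ)
  have i3 : ∫ x, (Real.exp (Φ' x - Φ x) - 1 - (Φ' x - Φ x)) ∂μ ≤ 0 := by
    rw [integral_sub A1 A2,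
      integral_sub hIntE (integrable_const _), e2, integral_sub hInt' (intPhi hμ hΦ)]
    simp only [integral_const, probReal_univ, smul_eq_mul, one_mul]
    linarith
  have hnn : ∀ x, 0 ≤ Real.exp (Φ' x - Φ x) - 1 - (Φ' x - Φ x) := fun x => by
    linarith [Real.add_one_le_exp (Φ' x - Φ x)]
  have i4 : ∫ x, (Real.exp (Φ' x - Φ x) - 1 - (Φ' x - Φ x)) ∂μ = 0 :=
    le_antisymm i3 (integral_nonneg hnn)
  rw [integral_eq_zero_iff_of_nonneg hnn
    (A1.sub A2)] at i4
  have i5 : Φ' =ᵐ[μ] Φ := by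
    filter_upwards [i4] with x hx
    by_contra hne
    have := Real.add_one_lt_exp (sub_ne_zero.2 hne)
    simp only [Pi.zero_apply] at hx
    linarith
  exact Measure.eq_of_ae_eq i5 hΦ'c hΦ.cont
end
end

section
open MeasureTheory Metric Set Filter Topology
open scoped ENNReal RealInnerProductSpace Pointwise
variable {n : ℕ}

theorem lint_wd (m : Measure (Euc n)) {V u : Euc n → ℝ} (hV : Measurable V) (hu : Measurable u) :
    ∫⁻ x, ENNReal.ofReal (Real.exp (u x)) ∂(m.withDensity fun x => ENNReal.ofReal (Real.exp (-V x)))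
      = ∫⁻ x, ENNReal.ofReal (Real.exp (u x - V x)) ∂m := by
  rw [lintegral_withDensity_eq_lintegral_mul _ (by fun_prop) (by fun_prop)]
  apply lintegral_congr
  intro x
  simp only [Pi.mul_apply]
  rw [← ENNReal.ofReal_mul (Real.exp_pos _).le, ← Real.exp_add]
  ring_nf

/-- the first marginal -/
def mV (V : Euc n → ℝ) : Measure (Euc n) :=
  volume.withDensity fun x => ENNReal.ofReal (Real.exp (-V x))

/-- the second (truncated) marginal -/
def mW (R : ℝ) (W : Euc n → ℝ) : Measure (Euc n) :=
  (volume.restrict (closedBall 0 R)).withDensity fun x => ENNReal.ofReal (Real.exp (-W x))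

theorem mW_ae (R : ℝ) (W : Euc n → ℝ) : ∀ᵐ y ∂(mW R W), ‖y‖ ≤ R := by
  have h : ∀ᵐ y ∂(volume.restrict (closedBall (0 : Euc n) R)), ‖y‖ ≤ R := by
    filter_upwards [ae_restrict_mem measurableSet_closedBall] with y hy
    simpa using hy
  exact (withDensity_absolutelyContinuous _ _).ae_le h

theorem schro_inv {V W : Euc n → ℝ} {C c L τ R : ℝ} (hV : Continuous V) (hW : Continuous W)
    (hVm : MidLE V C) (hWm : ∀ x s, 2 * W x + c * ‖s‖ ^ 2 ≤ W (x + s) + W (x - s))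
    (hC : 0 < C) (hc : 0 < c) (hL : 0 < L) (hCL : C ≤ c * L ^ 2) (hτ : 0 < τ)
    [IsProbabilityMeasure (mV V)] [IsProbabilityMeasure (mW R W)]
    (hμ : ∀ t : ℝ, Integrable (fun x => Real.exp (t * ‖x‖)) (mV V))
    (Φ : Euc n → ℝ) (hΦ : InK (τ * R) (τ * L) Φ) :
    MidLE (softB (mW R W) τ (softA (mV V) τ Φ)) (τ * L) := by
  set Ψ := softA (mV V) τ Φ with hΨ
  have hA : 0 < τ * L + C := by positivity
  have hΨm : Measurable Ψ := measA hΦ.cont.measurable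
  have hν := mW_ae R W
  have eA : ∀ y, ∫⁻ x, ENNReal.ofReal (Real.exp (τ * ⟪x, y⟫ - (Φ x + V x))) =
      ENNReal.ofReal (Real.exp (Ψ y)) := by
    intro y
    have hc := hΦ.cont
    rw [hΨ, expA hμ hτ.le hΦ, ofReal_integral_eq_lintegral_ofReal (intA hμ hτ.le hΦ y)
      (.of_forall fun x => (Real.exp_pos _).le)]
    unfold mV
    rw [lint_wd _ hV.measurable (by fun_prop)]
    apply lintegral_congr; intro x; ring_nf
  have eB : ∀ x, ∫⁻ y in closedBall 0 R, ENNReal.ofReal (Real.exp (τ * ⟪x, y⟫ - (Ψ y + W y))) =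
      ENNReal.ofReal (Real.exp (softB (mW R W) τ Ψ x)) := by
    intro x
    rw [hΨ, expB hμ hτ.le hν hΦ, ofReal_integral_eq_lintegral_ofReal (intB hμ hτ.le hν hΦ x)
      (.of_forall fun x => (Real.exp_pos _).le), ← hΨ]
    rw [mW]
    rw [lint_wd _ hW.measurable (by fun_prop)]
    apply lintegral_congr; intro x; ring_nf
  have low : ∀ y h, 2 * Ψ y + τ ^ 2 * ‖h‖ ^ 2 / (τ * L + C) ≤ Ψ (y + h) + Ψ (y - h) := by
    intro y h
    have := laplace_lower (U := fun x => Φ x + V x) (A := τ * L + C)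
      (hΦ.cont.measurable.add hV.measurable) hA
      (fun x s => by have := hΦ.mid x s; have := hVm x s; linarith) (τ := τ) y h
    rw [eA, eA, eA, ← ENNReal.ofReal_pow (Real.exp_pos _).le,
      ← ENNReal.ofReal_mul (by positivity), ← ENNReal.ofReal_mul (by positivity),
      ENNReal.ofReal_le_ofReal_iff (by positivity), ← Real.exp_nat_mul, ← Real.exp_add,
      ← Real.exp_add, Real.exp_le_exp] at this
    exact_mod_cast this
  intro x h
  set a := τ ^ 2 / (τ * L + C) + c with ha
  have ha0 : 0 < a := by positivity
  have := laplace_upper (U := fun x => Ψ x + W x) (a := a) (S := closedBall 0 R)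
      (hΨm.add hW.measurable) ha0 measurableSet_closedBall (convex_closedBall _ _)
      (fun x s => by
        have h1 := low x s; have h2 := hWm x s
        have : a * ‖s‖ ^ 2 = τ ^ 2 * ‖s‖ ^ 2 / (τ * L + C) + c * ‖s‖ ^ 2 := by rw [ha]; ring
        linarith) (τ := τ) x h
  rw [eB, eB, eB, ← ENNReal.ofReal_pow (Real.exp_pos _).le,
      ← ENNReal.ofReal_mul (by positivity), ← ENNReal.ofReal_mul (by positivity),
      ENNReal.ofReal_le_ofReal_iff (by positivity), ← Real.exp_nat_mul, ← Real.exp_add,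
      ← Real.exp_add, Real.exp_le_exp] at this
  have k : τ ^ 2 * ‖h‖ ^ 2 / a ≤ τ * L * ‖h‖ ^ 2 := by
    rw [div_le_iff₀ ha0]
    have : τ ^ 2 ≤ τ * L * a := by
      have e : τ * L * a - τ ^ 2 = (τ * (c * L ^ 2 - C) * τ + τ * L * c * C) / (τ * L + C) := by
        rw [ha]; field_simp; ring
      have : 0 ≤ τ * L * a - τ ^ 2 := by
        rw [e]
        have : 0 ≤ c * L ^ 2 - C := by linarith
        positivity
      linarith
    nlinarith [sq_nonneg ‖h‖]
  push_cast at this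
  linarith

/-- Entropic transport plan, disintegrated, with its potential. -/
structure SB (μ ν : Measure (Euc n)) (τ L : ℝ) (φ : Euc n → ℝ) (ρ : Euc n → Measure (Euc n)) :
    Prop where
  zero : φ 0 = 0
  mid : MidLE φ L
  sub : HasSub φ
  prob : ∀ x, IsProbabilityMeasure (ρ x)
  mgf : ∀ x h, ∫⁻ y, ENNReal.ofReal (Real.exp (τ * ⟪h, y⟫)) ∂ρ x =
    ENNReal.ofReal (Real.exp (τ * (φ (x + h) - φ x)))
  meas : ∀ g : Euc n → ℝ≥0∞, Measurable g → Measurable fun x => ∫⁻ y, g y ∂ρ x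
  disint : ∀ g : Euc n → ℝ≥0∞, Measurable g → ∫⁻ y, g y ∂ν = ∫⁻ x, ∫⁻ y, g y ∂ρ x ∂μ

theorem exists_SB {V W : Euc n → ℝ} {C c L τ R : ℝ} (hV : Continuous V) (hW : Continuous W)
    (hVm : MidLE V C) (hWm : ∀ x s, 2 * W x + c * ‖s‖ ^ 2 ≤ W (x + s) + W (x - s))
    (hC : 0 < C) (hc : 0 < c) (hL : 0 < L) (hCL : C ≤ c * L ^ 2) (hτ : 0 < τ) (hR : 0 ≤ R)
    [IsProbabilityMeasure (mV V)] [IsProbabilityMeasure (mW R W)] [(mV V).IsOpenPosMeasure]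
    (hμ : ∀ t : ℝ, Integrable (fun x => Real.exp (t * ‖x‖)) (mV V)) :
    ∃ φ ρ, SB (mV V) (mW R W) τ L φ ρ := by
  have hν := mW_ae R W
  obtain ⟨Φ, hΦ, hfix⟩ := schro_exists hμ hτ.le hR (by positivity : 0 ≤ τ * L) hν
    (schro_inv hV hW hVm hWm hC hc hL hCL hτ hμ)
  generalize mV V = μ at *
  generalize mW R W = ν at *
  set Ψ := softA μ τ Φ with hΨ
  have hΨm : Measurable Ψ := measA hΦ.cont.measurable
  have hΦm : Measurable Φ := hΦ.cont.measurable
  set ρ : Euc n → Measure (Euc n) := fun x =>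
    ν.withDensity fun y => ENNReal.ofReal (Real.exp (-(Φ x + Ψ y - τ * ⟪x, y⟫))) with hρ
  have mgf : ∀ x h, ∫⁻ y, ENNReal.ofReal (Real.exp (τ * ⟪h, y⟫)) ∂ρ x =
      ENNReal.ofReal (Real.exp (Φ (x + h) - Φ x)) := by
    intro x h
    rw [hρ, lint_wd _ (by fun_prop) (by fun_prop)]
    have e : ∀ y, ENNReal.ofReal (Real.exp (τ * ⟪h, y⟫ - (Φ x + Ψ y - τ * ⟪x, y⟫))) =
        ENNReal.ofReal (Real.exp (- Φ x)) *
          ENNReal.ofReal (Real.exp (τ * ⟪x + h, y⟫ - Ψ y)) := by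
      intro y
      rw [← ENNReal.ofReal_mul (Real.exp_pos _).le, ← Real.exp_add, inner_add_left]
      ring_nf
    simp only [e]
    rw [lintegral_const_mul _ (by fun_prop),
      ← ofReal_integral_eq_lintegral_ofReal (intB hμ hτ.le hν hΦ (x + h))
      (.of_forall fun x => (Real.exp_pos _).le), ← expB hμ hτ.le hν hΦ, ← hΨ, hfix,
      ← ENNReal.ofReal_mul (Real.exp_pos _).le, ← Real.exp_add]
    ring_nf
  have prob : ∀ x, IsProbabilityMeasure (ρ x) := by
    intro x
    have := mgf x 0
    simp at this
    exact ⟨this⟩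
  have joint : Measurable fun p : Euc n × Euc n =>
      ENNReal.ofReal (Real.exp (-(Φ p.1 + Ψ p.2 - τ * ⟪p.1, p.2⟫))) := by fun_prop
  have eg : ∀ g : Euc n → ℝ≥0∞, Measurable g → ∀ x, ∫⁻ y, g y ∂ρ x =
      ∫⁻ y, ENNReal.ofReal (Real.exp (-(Φ x + Ψ y - τ * ⟪x, y⟫))) * g y ∂ν := by
    intro g hg x
    rw [hρ, lintegral_withDensity_eq_lintegral_mul _ (by fun_prop) hg]
    rfl
  refine ⟨fun x => Φ x / τ, ρ, ⟨by simp [hΦ.zero], ?_, ?_, prob, ?_, ?_, ?_⟩⟩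
  · intro x h
    have := hΦ.mid x h
    simp only
    rw [← add_div, div_le_iff₀ hτ]
    calc _ ≤ _ := this
      _ = _ := by field_simp
  · intro x
    have := prob x
    have hb : ∀ᵐ y ∂ρ x, ‖y‖ ≤ R := (withDensity_absolutelyContinuous _ _).ae_le hν
    have hiy : Integrable (fun y : Euc n => y) (ρ x) :=
      (integrable_const R).mono' (by fun_prop) hb
    refine ⟨∫ y, y ∂ρ x, fun z => ?_⟩
    have hi1 : Integrable (fun y : Euc n => τ * ⟪z - x, y⟫) (ρ x) :=
      (hiy.const_inner (z - x)).const_mul τ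
    have hi2 : Integrable (fun y : Euc n => Real.exp (τ * ⟪z - x, y⟫)) (ρ x) := by
      refine (integrable_const (Real.exp (τ * R * ‖z - x‖))).mono' (by fun_prop) ?_
      filter_upwards [hb] with y hy
      rw [Real.norm_eq_abs, abs_of_pos (Real.exp_pos _)]
      exact Real.exp_le_exp.2 (abs_le.1 (inner_bd hτ.le hy)).2
    have J := convexOn_exp.map_integral_le (μ := ρ x) Real.continuous_exp.continuousOn isClosed_univ
      (.of_forall fun y => mem_univ _) hi1 hi2
    have m := mgf x (z - x)
    rw [← ofReal_integral_eq_lintegral_ofReal hi2 (.of_forall fun x => (Real.exp_pos _).le),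
      ENNReal.ofReal_eq_ofReal_iff (integral_nonneg fun _ => (Real.exp_pos _).le) (Real.exp_pos _).le]
      at m
    rw [m, Real.exp_le_exp, integral_const_mul, integral_inner hiy, add_sub_cancel,
      real_inner_comm] at J
    rw [div_add' _ _ _ hτ.ne', div_le_div_iff_of_pos_right hτ]
    linarith
  · intro x h
    rw [mgf]
    congr 2; field_simp
  · intro g hg
    simp only [eg g hg]
    exact Measurable.lintegral_prod_right' (f := fun p : Euc n × Euc n =>
      ENNReal.ofReal (Real.exp (-(Φ p.1 + Ψ p.2 - τ * ⟪p.1, p.2⟫))) * g p.2)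
      (joint.mul (hg.comp measurable_snd))
  · intro g hg
    simp only [eg g hg]
    rw [lintegral_lintegral_swap (joint.mul (hg.comp measurable_snd)).aemeasurable]
    apply lintegral_congr
    intro y
    rw [lintegral_mul_const _ (by fun_prop)]
    have e : ∀ x, ENNReal.ofReal (Real.exp (-(Φ x + Ψ y - τ * ⟪x, y⟫))) =
        ENNReal.ofReal (Real.exp (- Ψ y)) *
          ENNReal.ofReal (Real.exp (τ * ⟪x, y⟫ - Φ x)) := by
      intro x
      rw [← ENNReal.ofReal_mul (Real.exp_pos _).le, ← Real.exp_add]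
      ring_nf
    simp only [e]
    rw [lintegral_const_mul _ (by fun_prop),
      ← ofReal_integral_eq_lintegral_ofReal (intA hμ hτ.le hΦ y)
      (.of_forall fun x => (Real.exp_pos _).le), ← expA hμ hτ.le hΦ, ← hΨ,
      ← ENNReal.ofReal_mul (Real.exp_pos _).le, ← Real.exp_add]
    simp
end

section
open MeasureTheory Metric Set Filter Topology
open scoped ENNReal RealInnerProductSpace Pointwise BoundedContinuousFunction NNReal
variable {n : ℕ}

/-- convergence of measures with uniformly bounded densities converging to `1`. -/
def SConv (μs : ℕ → Measure (Euc n)) (μ : Measure (Euc n)) : Prop :=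
  ∃ (d : ℕ → Euc n → ℝ≥0∞) (D : ℝ≥0∞), D ≠ ∞ ∧ (∀ k, Measurable (d k)) ∧ (∀ k x, d k x ≤ D) ∧
    (∀ x, Tendsto (fun k => d k x) atTop (𝓝 1)) ∧ ∀ k, μs k = μ.withDensity (d k)

theorem SConv.comp {μs : ℕ → Measure (Euc n)} {μ : Measure (Euc n)} (h : SConv μs μ)
    {σ : ℕ → ℕ} (hσ : Tendsto σ atTop atTop) : SConv (fun k => μs (σ k)) μ := by
  obtain ⟨d, D, hD, h1, h2, h3, h4⟩ := h
  exact ⟨fun k => d (σ k), D, hD, fun k => h1 _, fun k => h2 _, fun x => (h3 x).comp hσ, fun k => h4 _⟩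

theorem SConv.tendsto {μs : ℕ → Measure (Euc n)} {μ : Measure (Euc n)} [IsFiniteMeasure μ]
    (h : SConv μs μ) {f : ℕ → Euc n → ℝ≥0∞} {f0 : Euc n → ℝ≥0∞} {B : ℝ≥0∞} (hB : B ≠ ∞)
    (hf : ∀ k, Measurable (f k)) (hfB : ∀ k x, f k x ≤ B)
    (hlim : ∀ x, Tendsto (fun k => f k x) atTop (𝓝 (f0 x))) :
    Tendsto (fun k => ∫⁻ x, f k x ∂(μs k)) atTop (𝓝 (∫⁻ x, f0 x ∂μ)) := by
  obtain ⟨d, D, hD, h1, h2, h3, h4⟩ := h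
  have e : ∀ k, ∫⁻ x, f k x ∂(μs k) = ∫⁻ x, d k x * f k x ∂μ := by
    intro k
    rw [h4, lintegral_withDensity_eq_lintegral_mul _ (h1 k) (hf k)]; rfl
  simp only [e]
  apply tendsto_lintegral_of_dominated_convergence (fun _ => D * B)
  · exact fun k => (h1 k).mul (hf k)
  · exact fun k => .of_forall fun x => mul_le_mul' (h2 k x) (hfB k x)
  · simp only [lintegral_const]
    exact ENNReal.mul_ne_top (ENNReal.mul_ne_top hD hB) (measure_ne_top _ _)
  · refine .of_forall fun x => ?_
    have := ENNReal.Tendsto.mul (h3 x) (Or.inl one_ne_zero) (hlim x) (Or.inr ENNReal.one_ne_top)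
    simpa using this

theorem SB.chernoff {μ ν : Measure (Euc n)} {τ L : ℝ} {φ : Euc n → ℝ} {ρ : Euc n → Measure (Euc n)}
    (h : SB μ ν τ L φ ρ) (hτ : 0 < τ) (x v : Euc n) (t : ℝ) :
    ρ x {y | t ≤ ⟪v, y⟫} ≤ ENNReal.ofReal (Real.exp (τ * (φ (x + v) - φ x - t))) := by
  have h1 : ρ x {y | t ≤ ⟪v, y⟫} ≤
      ∫⁻ y, ENNReal.ofReal (Real.exp (-(τ * t))) * ENNReal.ofReal (Real.exp (τ * ⟪v, y⟫)) ∂ρ x := by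
    have hm : MeasurableSet {y : Euc n | t ≤ ⟪v, y⟫} :=
      measurableSet_le measurable_const (by fun_prop)
    rw [← lintegral_indicator_one hm]
    apply lintegral_mono
    intro y
    by_cases hy : t ≤ ⟪v, y⟫
    · simp only [mem_ofPred_eq, hy, indicator_of_mem, Pi.one_apply]
      rw [← ENNReal.ofReal_mul (Real.exp_pos _).le, ← Real.exp_add, ← ENNReal.ofReal_one]
      apply ENNReal.ofReal_le_ofReal
      apply Real.one_le_exp
      nlinarith
    · simp [hy]
  rw [lintegral_const_mul _ (by fun_prop), h.mgf, ← ENNReal.ofReal_mul (Real.exp_pos _).le,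
    ← Real.exp_add] at h1
  refine h1.trans (le_of_eq ?_)
  ring_nf

theorem SB.slope {μ ν : Measure (Euc n)} {τ L : ℝ} {φ : Euc n → ℝ} {ρ : Euc n → Measure (Euc n)}
    (h : SB μ ν τ L φ ρ) (hτ : 1 ≤ τ) (hL : 0 < L) {F : Euc n → Euc n}
    (ht : ∀ x z, φ x + ⟪F x, z - x⟫ ≤ φ z) {M : ℝ} (hM : 0 ≤ M) (hp : 2 * L + M + 1 ≤ ‖F 0‖) :
    2⁻¹ * μ (ball 0 1) ≤ ν {y | M < ‖y‖} := by
  set u : Euc n := ‖F 0‖⁻¹ • F 0 with hu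
  have hp0 : 0 < ‖F 0‖ := by linarith
  have hun : ‖u‖ = 1 := by rw [hu, norm_smul, norm_inv, norm_norm, inv_mul_cancel₀ hp0.ne']
  have hup : ⟪F 0, u⟫ = ‖F 0‖ := by
    rw [hu, real_inner_smul_right, real_inner_self_eq_norm_sq]; field_simp
  have hm : MeasurableSet {y : Euc n | M < ‖y‖} := measurableSet_lt measurable_const (by fun_prop)
  have key : ∀ x ∈ ball (0 : Euc n) 1, (2⁻¹ : ℝ≥0∞) ≤ ρ x {y | M < ‖y‖} := by
    intro x hx
    have hx' : ‖x‖ < 1 := by simpa using hx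
    have := h.prob x
    have c1 := h.chernoff (by linarith) x (-u) (-M)
    have t1 := ht (x + -u) x
    have l1 := grad_lip hL h.mid ht 0 (x + -u)
    have n1 : ‖(0 : Euc n) - (x + -u)‖ ≤ 2 := by
      rw [zero_sub, norm_neg]
      refine (norm_add_le _ _).trans ?_
      rw [norm_neg, hun]; linarith
    have s1 : ⟪F 0 - F (x + -u), u⟫ ≤ 2 * L := by
      refine (real_inner_le_norm _ _).trans ?_
      rw [hun, mul_one]; nlinarith
    rw [inner_sub_left, hup] at s1
    have e1 : x - (x + -u) = u := by abel
    rw [e1] at t1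
    have c2 : ρ x {y | -M ≤ ⟪-u, y⟫} ≤ 2⁻¹ := by
      refine c1.trans ?_
      have : τ * (φ (x + -u) - φ x - -M) ≤ -1 := by nlinarith
      have e2 : Real.exp (τ * (φ (x + -u) - φ x - -M)) ≤ 2⁻¹ := by
        refine (Real.exp_le_exp.2 this).trans ?_
        rw [Real.exp_neg]
        apply inv_anti₀ (by norm_num)
        linarith [Real.exp_one_gt_d9]
      calc _ ≤ ENNReal.ofReal (2⁻¹) := ENNReal.ofReal_le_ofReal e2
        _ = 2⁻¹ := by rw [ENNReal.ofReal_inv_of_pos (by norm_num)]; simp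
    have sub : {y : Euc n | M < ‖y‖}ᶜ ⊆ {y | -M ≤ ⟪-u, y⟫} := by
      intro y hy
      simp only [mem_compl_iff, mem_ofPred_eq, not_lt] at hy
      simp only [mem_ofPred_eq, inner_neg_left]
      have := real_inner_le_norm u y
      rw [hun] at this
      linarith
    have c3 := (measure_mono sub).trans c2
    have c4 : (1 : ℝ≥0∞) ≤ ρ x {y | M < ‖y‖} + 2⁻¹ := by
      rw [← measure_univ (μ := ρ x), ← measure_add_measure_compl hm]
      gcongr
    have c5 := tsub_le_iff_right.2 c4
    rwa [ENNReal.one_sub_inv_two] at c5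
  have d := h.disint ({y | M < ‖y‖}.indicator 1) (measurable_one.indicator hm)
  simp only [lintegral_indicator_one hm] at d
  rw [d]
  calc 2⁻¹ * μ (ball 0 1) = ∫⁻ x in ball 0 1, 2⁻¹ ∂μ := by simp
    _ ≤ ∫⁻ x in ball 0 1, ρ x {y | M < ‖y‖} ∂μ := setLIntegral_mono' measurableSet_ball key
    _ ≤ _ := setLIntegral_le_lintegral _ _

theorem exists_tail (ν : Measure (Euc n)) [IsFiniteMeasure ν] {a : ℝ≥0∞} (ha : 0 < a) :
    ∃ M : ℝ, 0 ≤ M ∧ ν {y | M < ‖y‖} < a := by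
  have h : Tendsto (fun k : ℕ => ν {y : Euc n | (k : ℝ) < ‖y‖}) atTop
      (𝓝 (ν (⋂ k : ℕ, {y : Euc n | (k : ℝ) < ‖y‖}))) := by
    apply tendsto_measure_iInter_atTop
    · exact fun k => (measurableSet_lt measurable_const (by fun_prop)).nullMeasurableSet
    · intro i j hij y hy
      simp only [mem_ofPred_eq] at hy ⊢
      exact lt_of_le_of_lt (by exact_mod_cast hij) hy
    · exact ⟨0, measure_ne_top _ _⟩
  have e : (⋂ k : ℕ, {y : Euc n | (k : ℝ) < ‖y‖}) = ∅ := by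
    ext y
    simp only [mem_iInter, mem_ofPred_eq, mem_empty_iff_false, iff_false, not_forall, not_lt]
    exact exists_nat_ge ‖y‖
  rw [e, measure_empty] at h
  obtain ⟨k, hk⟩ := (h.eventually (gt_mem_nhds ha)).exists
  exact ⟨k, by positivity, hk⟩

theorem concentrate {μs νs : ℕ → Measure (Euc n)} {τ Ls : ℕ → ℝ} {φ : ℕ → Euc n → ℝ}
    {ρ : ℕ → Euc n → Measure (Euc n)} (h : ∀ k, SB (μs k) (νs k) (τ k) (Ls k) (φ k) (ρ k))
    (hτ0 : ∀ k, 1 ≤ τ k) (hτ : Tendsto τ atTop atTop) {L : ℝ} (hL : 0 < L)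
    {φ0 : Euc n → ℝ} (hlim : ∀ x, Tendsto (fun k => φ k x) atTop (𝓝 (φ0 x)))
    (hm : MidLE φ0 L) {x g : Euc n} (hs : ∀ z, φ0 x + ⟪g, z - x⟫ ≤ φ0 z) (v : Euc n) {η : ℝ}
    (hη : 0 < η) : Tendsto (fun k => ρ k x {y | ⟪v, g⟫ + η ≤ ⟪v, y⟫}) atTop (𝓝 0) := by
  set s : ℝ := η / (4 * (L * ‖v‖ ^ 2 + 1)) with hsd
  have hD : 0 < L * ‖v‖ ^ 2 + 1 := by positivity
  have hs0 : 0 < s := by positivity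
  have q := sub_quad hm hs (s • v)
  rw [real_inner_smul_right, norm_smul, Real.norm_eq_abs, abs_of_pos hs0, mul_pow,
    real_inner_comm] at q
  have q2 : L * (s ^ 2 * ‖v‖ ^ 2) ≤ s * (η / 4) := by
    have : s * (L * ‖v‖ ^ 2 + 1) = η / 4 := by rw [hsd]; field_simp
    rw [← this]; nlinarith [sq_nonneg s]
  have lim : Tendsto (fun k => φ k (x + s • v) - φ k x) atTop (𝓝 (φ0 (x + s • v) - φ0 x)) :=
    (hlim _).sub (hlim _)
  have ev : ∀ᶠ k in atTop, φ k (x + s • v) - φ k x < s * ⟪v, g⟫ + s * (η / 2) := by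
    apply lim.eventually (gt_mem_nhds _)
    have : 0 < s * η := by positivity
    linarith
  have z : Tendsto (fun k => ENNReal.ofReal (Real.exp (-(τ k * (s * (η / 2)))))) atTop (𝓝 0) := by
    rw [← ENNReal.ofReal_zero]
    apply ENNReal.tendsto_ofReal
    apply Real.tendsto_exp_neg_atTop_nhds_zero.comp
    exact hτ.atTop_mul_const (by positivity)
  refine tendsto_of_tendsto_of_tendsto_of_le_of_le' tendsto_const_nhds z
    (.of_forall fun _ => zero_le) ?_
  filter_upwards [ev] with k hk
  have c := (h k).chernoff (by linarith [hτ0 k]) x (s • v) (s * (⟪v, g⟫ + η))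
  have e : {y : Euc n | s * (⟪v, g⟫ + η) ≤ ⟪s • v, y⟫} = {y | ⟪v, g⟫ + η ≤ ⟪v, y⟫} := by
    ext y
    simp only [mem_ofPred_eq, real_inner_smul_left]
    exact mul_le_mul_iff_right₀ hs0
  rw [e] at c
  refine c.trans (ENNReal.ofReal_le_ofReal (Real.exp_le_exp.2 ?_))
  rw [← mul_neg]
  apply mul_le_mul_of_nonneg_left _ (by linarith [hτ0 k])
  linarith

theorem concentrate_ball {ρ : ℕ → Measure (Euc n)} {g : Euc n}
    (h : ∀ (v : Euc n) (η : ℝ), 0 < η → Tendsto (fun k => ρ k {y | ⟪v, g⟫ + η ≤ ⟪v, y⟫}) atTop (𝓝 0))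
    {η : ℝ} (hη : 0 < η) : Tendsto (fun k => ρ k (ball g η)ᶜ) atTop (𝓝 0) := by
  set e : Fin n → Euc n := fun i => EuclideanSpace.single i (1:ℝ) with he
  set η' : ℝ := η / (n + 1) with hη'
  have h0 : 0 < η' := by positivity
  have hsub : (ball g η)ᶜ ⊆ ⋃ i, ({y | ⟪e i, g⟫ + η' ≤ ⟪e i, y⟫} ∪ {y | ⟪-e i, g⟫ + η' ≤ ⟪-e i, y⟫}) := by
    intro y hy
    by_contra hc
    simp only [mem_iUnion, mem_union, mem_ofPred_eq, not_exists, not_or, not_le] at hc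
    have hi : ∀ i, |(y - g) i| ≤ η' := by
      intro i
      have := hc i
      simp only [he, inner_neg_left, EuclideanSpace.inner_single_left] at this
      simp at this
      rw [abs_le]
      simp only [PiLp.sub_apply]
      constructor <;> linarith [this.1, this.2]
    have hn : ‖y - g‖ ≤ n * η' := by
      have e1 : y - g = ∑ i, (y - g) i • e i := by
        have := (EuclideanSpace.basisFun (Fin n) ℝ).sum_repr (y - g)
        simpa [he] using this.symm
      rw [e1]
      refine (norm_sum_le _ _).trans ?_
      calc _ ≤ ∑ i : Fin n, η' := by
            apply Finset.sum_le_sum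
            intro i _
            rw [norm_smul, he]
            simpa using hi i
        _ = n * η' := by simp
    apply hy
    rw [mem_ball, dist_eq_norm]
    have : η = n * η' + η' := by rw [hη']; field_simp
    linarith
  have hz : Tendsto (fun k => ∑ i, (ρ k {y | ⟪e i, g⟫ + η' ≤ ⟪e i, y⟫} +
      ρ k {y | ⟪-e i, g⟫ + η' ≤ ⟪-e i, y⟫})) atTop (𝓝 0) := by
    have := tendsto_finsetSum (Finset.univ : Finset (Fin n)) fun i _ =>
      (h (e i) η' h0).add (h (-e i) η' h0)
    simpa using this
  refine tendsto_of_tendsto_of_tendsto_of_le_of_le tendsto_const_nhds hz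
    (fun _ => zero_le) fun k => ?_
  refine (measure_mono hsub).trans ((measure_iUnion_fintype_le _ _).trans ?_)
  exact Finset.sum_le_sum fun i _ => measure_union_le _ _

theorem lint_conv {ρ : ℕ → Measure (Euc n)} [∀ k, IsProbabilityMeasure (ρ k)] {g : Euc n}
    (h : ∀ η : ℝ, 0 < η → Tendsto (fun k => ρ k (ball g η)ᶜ) atTop (𝓝 0)) (f : Euc n →ᵇ ℝ≥0) :
    Tendsto (fun k => ∫⁻ y, f y ∂ρ k) atTop (𝓝 (f g)) := by
  let pk : ℕ → ProbabilityMeasure (Euc n) := fun k => ⟨ρ k, inferInstance⟩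
  let p0 : ProbabilityMeasure (Euc n) := ⟨Measure.dirac g, inferInstance⟩
  have key : Tendsto pk atTop (𝓝 p0) := by
    apply tendsto_of_forall_isOpen_le_liminf_nat'
    intro U hU
    change Measure.dirac g U ≤ liminf (fun k => ρ k U) atTop
    by_cases hg : g ∈ U
    · obtain ⟨η, hη, hηU⟩ := Metric.isOpen_iff.1 hU g hg
      have t1 : Tendsto (fun k => ρ k Uᶜ) atTop (𝓝 0) :=
        tendsto_of_tendsto_of_tendsto_of_le_of_le tendsto_const_nhds (h η hη) (fun _ => zero_le)
          fun k => measure_mono (compl_subset_compl.2 hηU)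
      have t2 : Tendsto (fun k => ρ k U) atTop (𝓝 1) := by
        have := ENNReal.Tendsto.sub (tendsto_const_nhds (x := (1:ℝ≥0∞)) (f := atTop)) t1
          (Or.inl ENNReal.one_ne_top)
        simp only [tsub_zero] at this
        refine this.congr fun k => ?_
        rw [← prob_compl_eq_one_sub hU.measurableSet.compl, compl_compl]
      rw [t2.liminf_eq]
      exact prob_le_one
    · rw [Measure.dirac_apply' _ hU.measurableSet]
      simp [hg]
  have := (ProbabilityMeasure.tendsto_iff_forall_lintegral_tendsto.1 key) f
  change Tendsto (fun k => ∫⁻ y, f y ∂ρ k) atTop (𝓝 (∫⁻ y, f y ∂(Measure.dirac g))) at this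
  rwa [lintegral_dirac' g (f.continuous.measurable.coe_nnreal_ennreal)] at this

theorem limit_SB {μs νs : ℕ → Measure (Euc n)} {μ ν : Measure (Euc n)} [IsProbabilityMeasure μ]
    [IsProbabilityMeasure ν] [μ.IsOpenPosMeasure] (hμ : SConv μs μ) (hν : SConv νs ν)
    {τ Ls : ℕ → ℝ} {φ : ℕ → Euc n → ℝ}
    {ρ : ℕ → Euc n → Measure (Euc n)} (h : ∀ k, SB (μs k) (νs k) (τ k) (Ls k) (φ k) (ρ k))
    (hτ0 : ∀ k, 1 ≤ τ k) (hτ : Tendsto τ atTop atTop) {L L' : ℝ} (hL : 0 < L)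
    (hLs : ∀ k, Ls k ≤ L') (hLs0 : ∀ k, 0 < Ls k) (hLL : Tendsto Ls atTop (𝓝 L)) :
    ∃ (φ0 : Euc n → ℝ) (G : Euc n → Euc n), MidLE φ0 L ∧ (∀ x z, φ0 x + ⟪G x, z - x⟫ ≤ φ0 z) ∧
      (∀ x, HasGradientAt φ0 (G x) x) ∧ μ.map G = ν := by
  choose F hF using fun k => (h k).sub
  have hL'0 : 0 < L' := (hLs0 0).trans_le (hLs 0)
  have hmid' : ∀ k, MidLE (φ k) L' := fun k x v => ((h k).mid x v).trans (by
    gcongr; exact hLs k)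
  have hslope : ∃ P, ∀ k, ‖F k 0‖ ≤ P := by
    have hb : 0 < μ (ball 0 1) := measure_ball_pos _ _ one_pos
    have hb' : μ (ball 0 1) ≠ ∞ := measure_ne_top _ _
    obtain ⟨M, hM, hMν⟩ := exists_tail ν (a := 2⁻¹ * μ (ball 0 1)) (by simp [hb])
    have hm : MeasurableSet {y : Euc n | M < ‖y‖} := measurableSet_lt measurable_const (by fun_prop)
    have T : ∀ {κs : ℕ → Measure (Euc n)} {κ : Measure (Euc n)} [IsFiniteMeasure κ],
        SConv κs κ → ∀ {A : Set (Euc n)}, MeasurableSet A →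
        Tendsto (fun k => κs k A) atTop (𝓝 (κ A)) := by
      intro κs κ _ hκ A hA
      have := hκ.tendsto (f := fun _ => A.indicator 1) (f0 := A.indicator 1) (B := 1)
        ENNReal.one_ne_top (fun _ => measurable_one.indicator hA)
        (fun _ x => indicator_le_self' (fun _ _ => zero_le) x)
        (fun _ => tendsto_const_nhds)
      simpa only [lintegral_indicator_one hA] using this
    have t1 := T hν hm
    have t2 : Tendsto (fun k => 2⁻¹ * μs k (ball 0 1)) atTop (𝓝 (2⁻¹ * μ (ball 0 1))) :=
      ENNReal.Tendsto.const_mul (T hμ measurableSet_ball) (Or.inr (by simp))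
    have ev := t1.eventually_lt t2 hMν
    have ev2 : ∀ᶠ k in atTop, ‖F k 0‖ ≤ 2 * L' + M + 1 := by
      filter_upwards [ev] with k hk
      by_contra hc
      push Not at hc
      exact absurd ((h k).slope (hτ0 k) (hLs0 k) (hF k) hM
        (by linarith [hLs k])) (not_le.2 hk)
    have hbd : IsBoundedUnder (· ≤ ·) atTop fun k => ‖F k 0‖ := ⟨_, by simpa using ev2⟩
    obtain ⟨P, hP⟩ := hbd.bddAbove_range
    exact ⟨P, fun k => hP ⟨k, rfl⟩⟩
  obtain ⟨P, hP⟩ := hslope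
  have hP0 : 0 ≤ P := (norm_nonneg _).trans (hP 0)
  have hFb : ∀ k x, ‖F k x‖ ≤ P + L' * ‖x‖ := by
    intro k x
    have h1 := grad_lip hL'0 (hmid' k) (hF k) x 0
    rw [sub_zero] at h1
    have h2 := norm_sub_norm_le (F k x) (F k 0)
    linarith [hP k]
  have hlip : ∀ r k x y, ‖x‖ ≤ r → ‖y‖ ≤ r → |φ k x - φ k y| ≤ (P + L' * r) * ‖x - y‖ := by
    have one : ∀ r k x y, ‖x‖ ≤ r → φ k x - φ k y ≤ (P + L' * r) * ‖x - y‖ := by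
      intro r k x y hx
      have h1 := hF k x y
      have h2 := abs_le.1 (abs_real_inner_le_norm (F k x) (y - x))
      have h3 : ‖F k x‖ ≤ P + L' * r := (hFb k x).trans (by gcongr)
      rw [norm_sub_rev] at h2
      nlinarith [h2.1, norm_nonneg (x - y)]
    intro r k x y hx hy
    rw [abs_le]
    have h1 := one r k x y hx
    have h2 := one r k y x hy
    rw [norm_sub_rev] at h2
    constructor <;> linarith
  have hbd : ∀ r k x, ‖x‖ ≤ r → |φ k x| ≤ (P + L' * r) * r := by
    intro r k x hx
    have hr : 0 ≤ r := (norm_nonneg x).trans hx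
    have := hlip r k x 0 hx (by simpa using hr)
    rw [(h k).zero, sub_zero, sub_zero] at this
    refine this.trans ?_
    gcongr
  obtain ⟨σ, hσ, φ0, hφ0⟩ := subseq_extract φ (fun x => ⟨_, fun k => hbd ‖x‖ k x le_rfl⟩)
    (fun r => ⟨P + L' * r, fun k => hlip r k⟩)
  have hσt := hσ.tendsto_atTop
  have hm0 : MidLE φ0 L := fun x v =>
    le_of_tendsto_of_tendsto' ((hφ0 (x + v)).add (hφ0 (x - v)))
      (((hφ0 x).const_mul 2).add ((hLL.comp hσt).mul_const _)) fun k => (h (σ k)).mid x v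
  have hs0 : HasSub φ0 := hasSub_limit (fun k => (h (σ k)).sub) hφ0
    (fun r => ⟨_, fun k x => hbd r (σ k) x⟩)
  choose G hG using hs0
  have hGg : ∀ x, HasGradientAt φ0 (G x) x := fun x => hasGradientAt_of_sub hm0 (hG x)
  have hGc : Continuous G := grad_cont hGg hG
  refine ⟨φ0, G, hm0, hG, hGg, ?_⟩
  have : IsProbabilityMeasure (μ.map G) := Measure.isProbabilityMeasure_map hGc.aemeasurable
  apply ext_of_forall_lintegral_eq_of_IsFiniteMeasure
  intro f
  have hfm : Measurable fun y => (f y : ℝ≥0∞) := f.continuous.measurable.coe_nnreal_ennreal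
  rw [lintegral_map hfm hGc.measurable]
  obtain ⟨B, hB⟩ : ∃ B : ℝ≥0, ∀ y, f y ≤ B := by
    refine ⟨nndist f 0, fun y => ?_⟩
    exact BoundedContinuousFunction.NNReal.upper_bound f y
  have hB' : ∀ y, (f y : ℝ≥0∞) ≤ B := fun y => by exact_mod_cast hB y
  have pt : ∀ x, Tendsto (fun k => ∫⁻ y, f y ∂ρ (σ k) x) atTop (𝓝 (f (G x))) := by
    intro x
    have : ∀ k, IsProbabilityMeasure (ρ (σ k) x) := fun k => (h (σ k)).prob x
    apply lint_conv
    intro η hη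
    exact concentrate_ball (fun v η' hη' => concentrate (fun k => h (σ k)) (fun k => hτ0 _)
      (hτ.comp hσt) hL hφ0 hm0 (hG x) v hη') hη
  have T1 := (hμ.comp hσt).tendsto (B := B) ENNReal.coe_ne_top (fun k => (h (σ k)).meas _ hfm)
    (fun k x => by
      have := (h (σ k)).prob x
      calc _ ≤ ∫⁻ y, (B : ℝ≥0∞) ∂ρ (σ k) x := lintegral_mono hB'
        _ = B := by simp) pt
  have T2 := (hν.comp hσt).tendsto (B := B) (f := fun _ y => (f y : ℝ≥0∞)) ENNReal.coe_ne_top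
    (fun _ => hfm) (fun _ => hB') (fun _ => tendsto_const_nhds)
  refine tendsto_nhds_unique T1 (T2.congr fun k => ?_)
  exact (h (σ k)).disint _ hfm
end

section
open MeasureTheory Metric Set Filter Topology
open scoped ENNReal RealInnerProductSpace Pointwise
variable {n : ℕ}

theorem hess_mid {V : Euc n → ℝ} (hV : ContDiff ℝ 2 V) {C : ℝ}
    (hH : ∀ x v : Euc n, hess V x v ≤ C * ‖v‖ ^ 2) : MidLE V C := by
  intro x h
  have d1 : Differentiable ℝ V := hV.differentiable (by norm_num)
  have d2 : Differentiable ℝ (fderiv ℝ V) :=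
    (hV.fderiv_right (m := 1) (by norm_num)).differentiable (by norm_num)
  have hl : ∀ t : ℝ, HasDerivAt (fun t : ℝ => x + t • h) h t := by
    intro t
    simpa using ((hasDerivAt_id t).smul_const h).const_add x
  have D1 : ∀ t : ℝ, HasDerivAt (fun t : ℝ => V (x + t • h)) (fderiv ℝ V (x + t • h) h) t :=
    fun t => (d1 _).hasFDerivAt.comp_hasDerivAt t (hl t)
  have D2 : ∀ t : ℝ, HasDerivAt (fun t : ℝ => fderiv ℝ V (x + t • h) h)
      (fderiv ℝ (fderiv ℝ V) (x + t • h) h h) t := by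
    intro t
    have := (d2 (x + t • h)).hasFDerivAt.comp_hasDerivAt t (hl t)
    have h2 := HasDerivAt.clm_apply (c := fun t : ℝ => fderiv ℝ V (x + t • h)) this
      (hasDerivAt_const t h)
    simpa using h2
  set K := C * ‖h‖ ^ 2 with hK
  have D2le : ∀ t : ℝ, fderiv ℝ (fderiv ℝ V) (x + t • h) h h ≤ K := by
    intro t
    have := hH (x + t • h) h
    rw [hess, iteratedFDeriv_two_apply] at this
    simpa using this
  have A1 : Antitone fun t : ℝ => fderiv ℝ V (x + t • h) h - K * t := by
    have hd : ∀ t : ℝ, HasDerivAt (fun t : ℝ => fderiv ℝ V (x + t • h) h - K * t)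
        (fderiv ℝ (fderiv ℝ V) (x + t • h) h h - K) t := by
      intro t
      have := (D2 t).sub ((hasDerivAt_id t).const_mul K)
      rw [mul_one] at this
      exact this
    apply antitone_of_deriv_nonpos (fun t => (hd t).differentiableAt)
    intro t
    rw [(hd t).deriv]
    linarith [D2le t]
  have hd2 : ∀ t : ℝ, HasDerivAt (fun t : ℝ => V (x + t • h) + V (x + (-t) • h) - K * t ^ 2)
      (fderiv ℝ V (x + t • h) h - fderiv ℝ V (x + (-t) • h) h - K * (2 * t)) t := by
    intro t
    have h1 := (D1 (-t)).scomp t (hasDerivAt_neg t)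
    have h2 := ((D1 t).add h1).sub (((hasDerivAt_id t).pow 2).const_mul K)
    refine (h2.congr_deriv ?_)
    simp; ring
  have A2 : AntitoneOn (fun t : ℝ => V (x + t • h) + V (x + (-t) • h) - K * t ^ 2) (Ici 0) := by
    apply antitoneOn_of_deriv_nonpos (convex_Ici 0)
    · exact fun t _ => (hd2 t).continuousAt.continuousWithinAt
    · exact fun t _ => (hd2 t).differentiableAt.differentiableWithinAt
    · intro t ht
      rw [interior_Ici] at ht
      have ht' : (0:ℝ) < t := ht
      rw [(hd2 t).deriv]
      have := A1 (show -t ≤ t by linarith)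
      simp only at this
      linarith
  have := A2 (show (0:ℝ) ∈ Ici 0 by simp) (show (1:ℝ) ∈ Ici 0 by simp) zero_le_one
  simp only [one_smul, zero_smul, neg_smul, neg_zero, add_zero] at this
  rw [← sub_eq_add_neg] at this
  linarith

theorem mV_open (V : Euc n → ℝ) (hV : Continuous V) : (mV V).IsOpenPosMeasure := by
  have : (volume : Measure (Euc n)) ≪ mV V :=
    withDensity_absolutelyContinuous' (by fun_prop) (.of_forall fun x => by simp [Real.exp_pos])
  exact this.isOpenPosMeasure

theorem mV_prob {V : Euc n → ℝ} (h : ∫ x, Real.exp (-V x) = 1) :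
    IsProbabilityMeasure (mV V) := by
  have hi : Integrable fun x => Real.exp (-V x) := by
    by_contra hc
    rw [integral_undef hc] at h
    exact zero_ne_one h
  constructor
  rw [mV, withDensity_apply _ MeasurableSet.univ, Measure.restrict_univ,
    ← ofReal_integral_eq_lintegral_ofReal hi (.of_forall fun x => (Real.exp_pos _).le), h]
  simp

theorem mV_add {V q : Euc n → ℝ} (hV : Continuous V) (hq : Continuous q) :
    mV (fun x => V x + q x) = (mV V).withDensity fun x => ENNReal.ofReal (Real.exp (-q x)) := by
  rw [mV, mV, ← withDensity_mul _ (by fun_prop) (by fun_prop)]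
  congr 1
  ext x
  rw [Pi.mul_apply, ← ENNReal.ofReal_mul (Real.exp_pos _).le, ← Real.exp_add, neg_add]

theorem mW_add {W : Euc n → ℝ} (hW : Continuous W) (R l : ℝ) :
    mW R (fun x => W x + l) = (mV W).withDensity
      ((closedBall 0 R).indicator fun _ => ENNReal.ofReal (Real.exp (-l))) := by
  rw [withDensity_indicator measurableSet_closedBall, mW, mV,
    restrict_withDensity measurableSet_closedBall, ← withDensity_mul _ (by fun_prop) (by fun_prop)]
  congr 1
  ext x
  rw [Pi.mul_apply, ← ENNReal.ofReal_mul (Real.exp_pos _).le, ← Real.exp_add, neg_add]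

/-- `1/(k+1)` -/
def dl (k : ℕ) : ℝ := 1 / ((k : ℝ) + 1)

theorem dl_pos (k : ℕ) : 0 < dl k := by unfold dl; positivity
theorem dl_le (k : ℕ) : dl k ≤ 1 := by
  unfold dl; rw [div_le_one (by positivity)]; linarith [(Nat.cast_nonneg k : (0:ℝ) ≤ k)]
theorem dl_lim : Tendsto dl atTop (𝓝 0) := tendsto_one_div_add_atTop_nhds_zero_nat

/-- Approximation of the first marginal. -/
theorem approx_mu {V : Euc n → ℝ} (hV : Continuous V) [IsProbabilityMeasure (mV V)] {C : ℝ}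
    (hm : MidLE V C) :
    ∃ Vs : ℕ → Euc n → ℝ, (∀ k, Continuous (Vs k)) ∧ (∀ k, MidLE (Vs k) (C + 2 * dl k)) ∧
      (∀ k, IsProbabilityMeasure (mV (Vs k))) ∧
      (∀ k (t : ℝ), Integrable (fun x => Real.exp (t * ‖x‖)) (mV (Vs k))) ∧
      SConv (fun k => mV (Vs k)) (mV V) := by
  set Z : ℕ → ℝ := fun k => ∫ x, Real.exp (-(dl k * ‖x‖ ^ 2)) ∂(mV V) with hZ
  have hle1 : ∀ k (x : Euc n), Real.exp (-(dl k * ‖x‖ ^ 2)) ≤ 1 := by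
    intro k x
    apply Real.exp_le_one_iff.2
    have := dl_pos k
    have : 0 ≤ dl k * ‖x‖ ^ 2 := by positivity
    linarith
  have hInt : ∀ k, Integrable (fun x : Euc n => Real.exp (-(dl k * ‖x‖ ^ 2))) (mV V) := by
    intro k
    refine (integrable_const (1:ℝ)).mono' (by fun_prop) (.of_forall fun x => ?_)
    rw [Real.norm_eq_abs, abs_of_pos (Real.exp_pos _)]
    exact hle1 k x
  have hInt1 : Integrable (fun x : Euc n => Real.exp (-(1 * ‖x‖ ^ 2))) (mV V) := by
    refine (integrable_const (1:ℝ)).mono' (by fun_prop) (.of_forall fun x => ?_)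
    rw [Real.norm_eq_abs, abs_of_pos (Real.exp_pos _)]
    exact Real.exp_le_one_iff.2 (by nlinarith [sq_nonneg ‖x‖])
  set Z0 := ∫ x, Real.exp (-(1 * ‖x‖ ^ 2)) ∂(mV V) with hZ0
  have hZ0p : 0 < Z0 := integral_exp_pos hInt1
  have hZp : ∀ k, 0 < Z k := fun k => integral_exp_pos (hInt k)
  have hZge : ∀ k, Z0 ≤ Z k := by
    intro k
    apply integral_mono hInt1 (hInt k)
    intro x
    apply Real.exp_le_exp.2
    nlinarith [sq_nonneg ‖x‖, dl_le k]
  have hZlim : Tendsto Z atTop (𝓝 1) := by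
    have e : (1:ℝ) = ∫ x : Euc n, (1:ℝ) ∂(mV V) := by simp
    rw [e]
    apply tendsto_integral_of_dominated_convergence (fun _ => (1:ℝ))
    · exact fun k => (hInt k).aestronglyMeasurable
    · exact integrable_const _
    · refine fun k => .of_forall fun x => ?_
      rw [Real.norm_eq_abs, abs_of_pos (Real.exp_pos _)]
      exact hle1 k x
    · refine .of_forall fun x => ?_
      have : Tendsto (fun k => -(dl k * ‖x‖ ^ 2)) atTop (𝓝 0) := by
        simpa using (dl_lim.mul_const (‖x‖ ^ 2)).neg
      have h2 := (Real.continuous_exp.tendsto _).comp this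
      rw [Real.exp_zero] at h2
      exact h2
  set q : ℕ → Euc n → ℝ := fun k x => dl k * ‖x‖ ^ 2 + Real.log (Z k) with hq
  have hqc : ∀ k, Continuous (q k) := fun k => by simp only [hq]; fun_prop
  have hden : ∀ k x, Real.exp (-q k x) = Real.exp (-(dl k * ‖x‖ ^ 2)) * (Z k)⁻¹ := by
    intro k x
    simp only [hq]
    rw [neg_add, Real.exp_add, Real.exp_neg (Real.log _), Real.exp_log (hZp k)]
  have hwd := fun k => mV_add hV (hqc k)
  refine ⟨fun k x => V x + q k x, fun k => hV.add (hqc k), fun k x h => ?_, fun k => ?_,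
    fun k t => ?_, ?_⟩
  · have h1 := hm x h
    have h2 := parallelogram_law_with_norm ℝ x h
    have h3 : dl k * (‖x + h‖ ^ 2 + ‖x - h‖ ^ 2) =
      dl k * (2 * (‖x‖ ^ 2 + ‖h‖ ^ 2)) := by rw [h2]
    simp only [hq]
    nlinarith
  · constructor
    rw [hwd, withDensity_apply _ MeasurableSet.univ, Measure.restrict_univ]
    simp only [hden]
    rw [← ofReal_integral_eq_lintegral_ofReal ((hInt k).mul_const _)
      (.of_forall fun x => by have := hZp k; positivity), integral_mul_const]
    change ENNReal.ofReal (Z k * (Z k)⁻¹) = 1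
    rw [mul_inv_cancel₀ (hZp k).ne', ENNReal.ofReal_one]
  · refine ⟨by fun_prop, ?_⟩
    rw [hasFiniteIntegral_iff_ofReal (.of_forall fun x => (Real.exp_pos _).le), hwd,
      lint_wd _ (hqc k).measurable (by fun_prop)]
    have hb : ∀ x : Euc n, Real.exp (t * ‖x‖ - q k x) ≤
        Real.exp (t ^ 2 / (4 * dl k) - Real.log (Z k)) := by
      intro x
      apply Real.exp_le_exp.2
      simp only [hq]
      have hd := dl_pos k
      have : t ^ 2 / (4 * dl k) - (t * ‖x‖ - dl k * ‖x‖ ^ 2) =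
          (t - 2 * dl k * ‖x‖) ^ 2 / (4 * dl k) := by field_simp; ring
      have : 0 ≤ t ^ 2 / (4 * dl k) - (t * ‖x‖ - dl k * ‖x‖ ^ 2) := by rw [this]; positivity
      linarith
    refine (lintegral_mono fun x => ENNReal.ofReal_le_ofReal (hb x)).trans_lt ?_
    simp
  · refine ⟨fun k x => ENNReal.ofReal (Real.exp (-q k x)), ENNReal.ofReal (Z0⁻¹),
      ENNReal.ofReal_ne_top, fun k => ?_, fun k x => ?_, fun x => ?_, hwd⟩
    · have := hqc k; fun_prop
    · apply ENNReal.ofReal_le_ofReal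
      rw [hden]
      have i1 : (Z k)⁻¹ ≤ Z0⁻¹ := inv_anti₀ hZ0p (hZge k)
      have i2 : 0 ≤ (Z k)⁻¹ := (inv_pos.2 (hZp k)).le
      nlinarith [hle1 k x]
    · rw [← ENNReal.ofReal_one]
      apply ENNReal.tendsto_ofReal
      simp only [hden]
      have h1 : Tendsto (fun k => -(dl k * ‖x‖ ^ 2)) atTop (𝓝 0) := by
        simpa using (dl_lim.mul_const (‖x‖ ^ 2)).neg
      have h2 := (Real.continuous_exp.tendsto _).comp h1
      have h3 := h2.mul (hZlim.inv₀ one_ne_zero)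
      simpa using h3

/-- Approximation of the second marginal. -/
theorem approx_nu {W : Euc n → ℝ} (hW : Continuous W) [IsProbabilityMeasure (mV W)] :
    ∃ l : ℕ → ℝ, (∀ k : ℕ, IsProbabilityMeasure (mW ((k : ℝ) + 1) fun x => W x + l k)) ∧
      SConv (fun k : ℕ => mW ((k : ℝ) + 1) fun x => W x + l k) (mV W) := by
  have := mV_open W hW
  set Z : ℕ → ℝ := fun k => ((mV W) (closedBall 0 ((k : ℝ) + 1))).toReal with hZ
  have hZp : ∀ k, 0 < Z k := fun k => ENNReal.toReal_pos
    (measure_closedBall_pos _ _ (by positivity)).ne' (measure_ne_top _ _)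
  have hmono : ∀ i j : ℕ, i ≤ j →
      closedBall (0 : Euc n) ((i : ℝ) + 1) ⊆ closedBall 0 ((j : ℝ) + 1) := by
    intro i j hij
    apply closedBall_subset_closedBall
    have : (i : ℝ) ≤ j := by exact_mod_cast hij
    linarith
  have hZge : ∀ k, Z 0 ≤ Z k := fun k =>
    ENNReal.toReal_mono (measure_ne_top _ _) (measure_mono (hmono 0 k (Nat.zero_le k)))
  have hev : ∀ x : Euc n, ∀ᶠ k : ℕ in atTop, x ∈ closedBall (0 : Euc n) ((k : ℝ) + 1) := by
    intro x
    obtain ⟨N, hN⟩ := exists_nat_ge ‖x‖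
    filter_upwards [eventually_ge_atTop N] with k hk
    have : (N : ℝ) ≤ k := by exact_mod_cast hk
    rw [mem_closedBall, dist_zero_right]
    linarith
  have hZlim : Tendsto Z atTop (𝓝 1) := by
    have h1 := tendsto_measure_iUnion_atTop (μ := mV W)
      (s := fun k : ℕ => closedBall (0 : Euc n) ((k : ℝ) + 1)) (fun i j hij => hmono i j hij)
    have e : (⋃ k : ℕ, closedBall (0 : Euc n) ((k : ℝ) + 1)) = univ := by
      ext x
      simp only [mem_iUnion, mem_univ, iff_true]
      exact (hev x).exists
    rw [e, measure_univ] at h1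
    have := (ENNReal.tendsto_toReal ENNReal.one_ne_top).comp h1
    rw [ENNReal.toReal_one] at this
    exact this
  have hexp : ∀ k, Real.exp (-Real.log (Z k)) = (Z k)⁻¹ := fun k => by
    rw [Real.exp_neg, Real.exp_log (hZp k)]
  refine ⟨fun k => Real.log (Z k), fun k => ?_, ?_⟩
  · constructor
    rw [mW_add hW, withDensity_apply _ MeasurableSet.univ, Measure.restrict_univ,
      lintegral_indicator measurableSet_closedBall, setLIntegral_const, hexp,
      ENNReal.ofReal_inv_of_pos (hZp k), hZ,
      ENNReal.ofReal_toReal (measure_ne_top _ _), ENNReal.inv_mul_cancel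
        (measure_closedBall_pos _ _ (by positivity)).ne' (measure_ne_top _ _)]
  · refine ⟨fun (k : ℕ) => (closedBall 0 ((k : ℝ) + 1)).indicator
      fun _ => ENNReal.ofReal (Real.exp (-Real.log (Z k))), ENNReal.ofReal ((Z 0)⁻¹),
      ENNReal.ofReal_ne_top, fun k => measurable_const.indicator measurableSet_closedBall,
      fun k x => ?_, fun x => ?_, fun k => mW_add hW _ _⟩
    · refine (indicator_le_self _ _ x).trans ?_
      rw [hexp]
      exact ENNReal.ofReal_le_ofReal (inv_anti₀ (hZp 0) (hZge k))
    · have h1 : Tendsto (fun k => ENNReal.ofReal ((Z k)⁻¹)) atTop (𝓝 1) := by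
        rw [← ENNReal.ofReal_one]
        apply ENNReal.tendsto_ofReal
        simpa using hZlim.inv₀ one_ne_zero
      refine h1.congr' ?_
      filter_upwards [hev x] with k hk
      rw [indicator_of_mem hk, hexp]

theorem caff_core {V W : Euc n → ℝ} (hV : Continuous V) (hW : Continuous W)
    [IsProbabilityMeasure (mV V)] [IsProbabilityMeasure (mV W)] {C c : ℝ} (hC : 0 < C) (hc : 0 < c)
    (hVm : MidLE V C) (hWm : ∀ x s, 2 * W x + c * ‖s‖ ^ 2 ≤ W (x + s) + W (x - s)) :
    ∃ (φ0 : Euc n → ℝ) (G : Euc n → Euc n), MidLE φ0 (Real.sqrt (C / c)) ∧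
      (∀ x z, φ0 x + ⟪G x, z - x⟫ ≤ φ0 z) ∧
      (∀ x, HasGradientAt φ0 (G x) x) ∧ (mV V).map G = mV W := by
  obtain ⟨Vs, v1, v2, v3, v4, v5⟩ := approx_mu hV hVm
  obtain ⟨l, w1, w2⟩ := approx_nu hW
  have := mV_open V hV
  have hCk : ∀ k, 0 < C + 2 * dl k := fun k => by linarith [dl_pos k]
  have ex : ∀ k : ℕ, ∃ φ ρ, SB (mV (Vs k)) (mW ((k : ℝ) + 1) fun x => W x + l k) ((k : ℝ) + 1)
      (Real.sqrt ((C + 2 * dl k) / c)) φ ρ := by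
    intro k
    have := v3 k
    have := w1 k
    have := mV_open (Vs k) (v1 k)
    have hpos : 0 < (C + 2 * dl k) / c := div_pos (hCk k) hc
    refine exists_SB (C := C + 2 * dl k) (c := c) (v1 k) (hW.add continuous_const) (v2 k)
      (fun x s => by have := hWm x s; linarith) (hCk k) hc (Real.sqrt_pos.2 hpos) ?_
      (by positivity) (by positivity) (v4 k)
    rw [Real.sq_sqrt hpos.le]
    apply le_of_eq
    field_simp
  choose φ ρ h using ex
  have hpos : 0 < C / c := div_pos hC hc
  refine limit_SB v5 w2 h (fun k => by linarith [(Nat.cast_nonneg k : (0:ℝ) ≤ k)])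
    (tendsto_atTop_add_const_right _ _ tendsto_natCast_atTop_atTop)
    (L := Real.sqrt (C / c)) (L' := Real.sqrt ((C + 2) / c)) (Real.sqrt_pos.2 hpos)
    (fun k => ?_) (fun k => Real.sqrt_pos.2 (div_pos (hCk k) hc)) ?_
  · apply Real.sqrt_le_sqrt
    gcongr
    linarith [dl_le k]
  · have : Tendsto (fun k => (C + 2 * dl k) / c) atTop (𝓝 (C / c)) := by
      simpa using ((dl_lim.const_mul 2).const_add C).div_const c
    exact (Real.continuous_sqrt.tendsto _).comp this

theorem caff_final
    (V W : Euc n → ℝ) (hVreg : ContDiff ℝ 2 V) (hWreg : ContDiff ℝ 2 W)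
    (hfprob : ∫ x, Real.exp (-V x) = 1) (hgprob : ∫ y, Real.exp (-W y) = 1)
    (CV2 cW2 : ℝ) (hCV2 : 0 < CV2) (hcW2 : 0 < cW2)
    (hHessV : ∀ x v : Euc n, hess V x v ≤ CV2 * ‖v‖ ^ 2)
    (hHessW : ∀ y v : Euc n, cW2 * ‖v‖ ^ 2 ≤ hess W y v)
    (φ : Euc n → ℝ) (hφconv : ConvexOn ℝ univ φ) (hφdiff : Differentiable ℝ φ)
    (hpush : (mV V).map (fun x => gradient φ x) = mV W) :
    ∀ a b : Euc n, ‖gradient φ a - gradient φ b‖ ≤ Real.sqrt (CV2 / cW2) * ‖a - b‖ := by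
  have hVm := hess_mid hVreg hHessV
  have hWm' : MidLE (fun x => -W x) (-cW2) := by
    apply hess_mid hWreg.neg
    intro x v
    have e : hess (fun x => -W x) x v = - hess W x v := by
      have : (fun x => -W x) = -W := rfl
      rw [hess, hess, this, iteratedFDeriv_neg]
      simp
    rw [e]
    linarith [hHessW x v]
  have := mV_prob hfprob
  have := mV_prob hgprob
  have := mV_open V hVreg.continuous
  obtain ⟨φ0, G, h1, h2, h3, h4⟩ := caff_core hVreg.continuous hWreg.continuous hCV2 hcW2 hVm
    (fun x s => by have := hWm' x s; simp only at this; linarith)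
  have hg : ∀ x, HasGradientAt φ (gradient φ x) x := fun x => (hφdiff x).hasGradientAt
  have e := brenier_unique (μ := mV V) hg h3 (fun x z => convex_tangent hφconv (hg x) z) h2
    (hpush.trans h4.symm)
  intro a b
  have ea := congrFun e a
  have eb := congrFun e b
  rw [ea, eb]
  exact grad_lip (Real.sqrt_pos.2 (div_pos hCV2 hcW2)) h1 h2 a b
end

/-- **Caffarelli's contraction theorem with sharp constant.** -/
theorem caffarelli_contraction
    {n : ℕ} (hn : 1 ≤ n)
    (V W : Euc n → ℝ) (hVreg : ContDiff ℝ 2 V) (hWreg : ContDiff ℝ 2 W)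
    (hfprob : ∫ x, Real.exp (-V x) = 1) (hgprob : ∫ y, Real.exp (-W y) = 1)
    (CV2 cW2 : ℝ) (hCV2 : 0 < CV2) (hcW2 : 0 < cW2)
    (hHessV : ∀ x v : Euc n, hess V x v ≤ CV2 * ‖v‖ ^ 2)
    (hHessW : ∀ y v : Euc n, cW2 * ‖v‖ ^ 2 ≤ hess W y v)
    (φ : Euc n → ℝ) (hφconv : ConvexOn ℝ univ φ) (hφdiff : Differentiable ℝ φ)
    (hpush : Measure.map (fun x => gradient φ x)
        (volume.withDensity fun x => ENNReal.ofReal (Real.exp (-V x)))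
      = volume.withDensity fun y => ENNReal.ofReal (Real.exp (-W y))) :
    ∀ a b : Euc n, ‖gradient φ a - gradient φ b‖ ≤ Real.sqrt (CV2 / cW2) * ‖a - b‖ := by
  exact caff_final V W hVreg hWreg hfprob hgprob CV2 cW2 hCV2 hcW2 hHessV hHessW φ hφconv
    hφdiff hpush
end
end
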